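/- arXiv:2512.13181 — 2 statements merged into one kernel-verified Lean document; each statement's English description precedes it below -/
import Mathlib

section
/- Let d ∈ {3,4,5} be an integer, let f : ℝ^d → ℝ be C² and convex, and let u : ℝ^d → ℝ be a positive C³ function satisfying Δu − ∇f·∇u + u^{(d+2)/(d−2)} = 0 on all of ℝ^d, such that ∇f(x)·∇u(x) ≤ 0 for every x ∈ ℝ^d. Assume there exist o ∈ ℝ^d and C > 0 such that ∫_{B_R(o)} e^{−f(x)} dx ≤ C·R^d for all R ≥ 1. Then f is constant on ℝ^d, and there exist a, b > 0 with d(d−2)ab = 1 and a point x₀ ∈ ℝ^d such that u(x) = (a + b·|x−x₀|²)^{−(d−2)/2} for all x (i.e., u is an Aubin–Talenti bubble). [Euclidean-base instance of Theorem 2.1 i): convexity of f is exactly the hypothesis Ric_{∞,d} ≥ 0 when the underlying manifold is flat ℝ^d.] -/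
open Real MeasureTheory Filter
open scoped RealInnerProductSpace

/-- Euclidean Laplacian: trace of the second derivative. -/
noncomputable def lapl {d : ℕ} (u : EuclideanSpace ℝ (Fin d) → ℝ)
    (x : EuclideanSpace ℝ (Fin d)) : ℝ :=
  ∑ i : Fin d, iteratedFDeriv ℝ 2 u x ![EuclideanSpace.single i 1, EuclideanSpace.single i 1]


namespace LaneEmden

/-- Partial derivative. -/
noncomputable def pd {d : ℕ} (i : Fin d) (h : EuclideanSpace ℝ (Fin d) → ℝ)
    (x : EuclideanSpace ℝ (Fin d)) : ℝ := fderiv ℝ h x (EuclideanSpace.single i 1)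

/-- Inner product of gradients. -/
noncomputable def gdot {d : ℕ} (h k : EuclideanSpace ℝ (Fin d) → ℝ)
    (x : EuclideanSpace ℝ (Fin d)) : ℝ := ∑ i : Fin d, pd i h x * pd i k x

/-- Laplacian in coordinates. -/
noncomputable def lap {d : ℕ} (h : EuclideanSpace ℝ (Fin d) → ℝ)
    (x : EuclideanSpace ℝ (Fin d)) : ℝ := ∑ i : Fin d, pd i (pd i h) x

variable {d : ℕ}

theorem contDiff_pd {n : ℕ} {h : EuclideanSpace ℝ (Fin d) → ℝ} (hh : ContDiff ℝ (n + 1 : ℕ) h)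
    (i : Fin d) : ContDiff ℝ n (pd i h) := by
  unfold pd
  have := hh.fderiv_right (m := n) (by norm_cast)
  exact this.clm_apply contDiff_const

theorem continuous_pd {h : EuclideanSpace ℝ (Fin d) → ℝ} (hh : ContDiff ℝ 1 h)
    (i : Fin d) : Continuous (pd i h) :=
  (contDiff_pd (n := 0) (by simpa using hh) i).continuous

theorem continuous_gdot {h k : EuclideanSpace ℝ (Fin d) → ℝ} (hh : ContDiff ℝ 1 h)
    (hk : ContDiff ℝ 1 k) : Continuous (gdot h k) := by
  unfold gdot
  exact continuous_finsetSum _ fun i _ => (continuous_pd hh i).mul (continuous_pd hk i)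

theorem continuous_lap {h : EuclideanSpace ℝ (Fin d) → ℝ} (hh : ContDiff ℝ 2 h) :
    Continuous (lap h) := by
  unfold lap
  exact continuous_finsetSum _ fun i _ =>
    continuous_pd (by simpa using contDiff_pd (n := 1) (by simpa using hh) i) i

theorem pd_fderiv {h : EuclideanSpace ℝ (Fin d) → ℝ} (hh : ContDiff ℝ 2 h)
    (x y : EuclideanSpace ℝ (Fin d)) (j : Fin d) :
    fderiv ℝ (pd j h) x y = fderiv ℝ (fderiv ℝ h) x y (EuclideanSpace.single j 1) := by
  have h1 : DifferentiableAt ℝ (fderiv ℝ h) x :=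
    ((hh.fderiv_right (m := 1) (by norm_num)).differentiable (by norm_num)) x
  have := (h1.hasFDerivAt.clm_apply
    (hasFDerivAt_const (EuclideanSpace.single j (1:ℝ)) x)).fderiv
  unfold pd
  rw [this]
  simp

theorem pd_comm {h : EuclideanSpace ℝ (Fin d) → ℝ} (hh : ContDiff ℝ 2 h)
    (i j : Fin d) : pd i (pd j h) = pd j (pd i h) := by
  funext x
  have hs : IsSymmSndFDerivAt ℝ h x := hh.contDiffAt.isSymmSndFDerivAt (by simp)
  show fderiv ℝ (pd j h) x _ = fderiv ℝ (pd i h) x _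
  rw [pd_fderiv hh, pd_fderiv hh]
  exact hs.eq _ _

theorem lapl_eq {h : EuclideanSpace ℝ (Fin d) → ℝ} (hh : ContDiff ℝ 2 h)
    (x : EuclideanSpace ℝ (Fin d)) : lapl h x = lap h x := by
  unfold lapl lap
  refine Finset.sum_congr rfl fun i _ => ?_
  rw [iteratedFDeriv_two_apply]
  show _ = fderiv ℝ (pd i h) x _
  rw [pd_fderiv hh]
  simp

theorem inner_grad_eq (h k : EuclideanSpace ℝ (Fin d) → ℝ)
    (x : EuclideanSpace ℝ (Fin d)) : ⟪gradient h x, gradient k x⟫ = gdot h k x := by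
  have key : ∀ (g : EuclideanSpace ℝ (Fin d) → ℝ) (i : Fin d), gradient g x i = pd i g x := by
    intro g i
    have h1 : ⟪gradient g x, EuclideanSpace.single i (1:ℝ)⟫ = pd i g x := by
      unfold gradient pd
      rw [InnerProductSpace.toDual_symm_apply]
    rw [EuclideanSpace.inner_single_right] at h1
    simpa using h1
  simp only [PiLp.inner_apply, key, gdot]
  refine Finset.sum_congr rfl fun i _ => ?_
  simp [mul_comm]

theorem pd_mul {h k : EuclideanSpace ℝ (Fin d) → ℝ} {x : EuclideanSpace ℝ (Fin d)}
    (hh : DifferentiableAt ℝ h x) (hk : DifferentiableAt ℝ k x)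
    (i : Fin d) : pd i (fun x => h x * k x) x = h x * pd i k x + k x * pd i h x := by
  unfold pd
  rw [(hh.hasFDerivAt.fun_mul hk.hasFDerivAt).fderiv]
  simp

theorem pd_add {h k : EuclideanSpace ℝ (Fin d) → ℝ} {x : EuclideanSpace ℝ (Fin d)}
    (hh : DifferentiableAt ℝ h x) (hk : DifferentiableAt ℝ k x)
    (i : Fin d) : pd i (fun x => h x + k x) x = pd i h x + pd i k x := by
  unfold pd
  rw [(hh.hasFDerivAt.fun_add hk.hasFDerivAt).fderiv]
  simp

theorem pd_const_mul {h : EuclideanSpace ℝ (Fin d) → ℝ} {x : EuclideanSpace ℝ (Fin d)}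
    (c : ℝ) (hh : DifferentiableAt ℝ h x)
    (i : Fin d) : pd i (fun x => c * h x) x = c * pd i h x := by
  unfold pd
  rw [(hh.hasFDerivAt.const_mul c).fderiv]
  simp

theorem pd_add_const {h : EuclideanSpace ℝ (Fin d) → ℝ} {x : EuclideanSpace ℝ (Fin d)}
    (c : ℝ) (hh : DifferentiableAt ℝ h x)
    (i : Fin d) : pd i (fun x => h x + c) x = pd i h x := by
  unfold pd
  rw [(hh.hasFDerivAt.add_const c).fderiv]

theorem pd_sum {ι : Type*} (s : Finset ι) {h : ι → EuclideanSpace ℝ (Fin d) → ℝ}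
    {x : EuclideanSpace ℝ (Fin d)}
    (hh : ∀ k ∈ s, DifferentiableAt ℝ (h k) x)
    (i : Fin d) : pd i (fun x => ∑ k ∈ s, h k x) x = ∑ k ∈ s, pd i (h k) x := by
  unfold pd
  rw [(HasFDerivAt.fun_sum (fun k hk => (hh k hk).hasFDerivAt)).fderiv]
  simp

theorem pd_comp {h : EuclideanSpace ℝ (Fin d) → ℝ} {g : ℝ → ℝ} {g' : ℝ}
    {x : EuclideanSpace ℝ (Fin d)}
    (hh : DifferentiableAt ℝ h x) (hg : HasDerivAt g g' (h x))
    (i : Fin d) : pd i (fun x => g (h x)) x = g' * pd i h x := by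
  unfold pd
  have := (hg.comp_hasFDerivAt x hh.hasFDerivAt).fderiv
  rw [show (fun x => g (h x)) = g ∘ h from rfl, this]
  simp

theorem pd_rpow {h : EuclideanSpace ℝ (Fin d) → ℝ} {x : EuclideanSpace ℝ (Fin d)}
    (hh : DifferentiableAt ℝ h x) (hx : 0 < h x) (r : ℝ)
    (i : Fin d) : pd i (fun x => h x ^ r) x = r * h x ^ (r - 1) * pd i h x :=
  pd_comp (g := fun y => y ^ r) hh (Real.hasDerivAt_rpow_const (Or.inl hx.ne')) i

theorem pd_pow {h : EuclideanSpace ℝ (Fin d) → ℝ} {x : EuclideanSpace ℝ (Fin d)}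
    (hh : DifferentiableAt ℝ h x) (n : ℕ)
    (i : Fin d) : pd i (fun x => h x ^ n) x = n * h x ^ (n - 1) * pd i h x :=
  pd_comp (g := fun y => y ^ n) hh (hasDerivAt_pow n _) i

theorem gdot_sq_le (h k : EuclideanSpace ℝ (Fin d) → ℝ) (x : EuclideanSpace ℝ (Fin d)) :
    (gdot h k x) ^ 2 ≤ gdot h h x * gdot k k x := by
  unfold gdot
  have := Finset.sum_mul_sq_le_sq_mul_sq Finset.univ (fun i => pd i h x) (fun i => pd i k x)
  simpa [sq] using this

theorem gdot_self_nonneg (h : EuclideanSpace ℝ (Fin d) → ℝ) (x : EuclideanSpace ℝ (Fin d)) :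
    0 ≤ gdot h h x := Finset.sum_nonneg fun _ _ => mul_self_nonneg _

theorem gdot_comm (h k : EuclideanSpace ℝ (Fin d) → ℝ) (x : EuclideanSpace ℝ (Fin d)) :
    gdot h k x = gdot k h x := Finset.sum_congr rfl fun _ _ => mul_comm _ _

/-- Weighted Green formula. -/
theorem green {f h ψ : EuclideanSpace ℝ (Fin d) → ℝ} (hf : ContDiff ℝ 1 f) (hh : ContDiff ℝ 2 h)
    (hψ : ContDiff ℝ 1 ψ) {o : EuclideanSpace ℝ (Fin d)} {R : ℝ}
    (hc : HasCompactSupport ψ) (hs : tsupport ψ ⊆ Metric.ball o R) :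
    ∫ x in Metric.ball o R,
      (ψ x * (lap h x - gdot f h x) + gdot h ψ x) * Real.exp (-f x) = 0 := by
  have hw : ContDiff ℝ 1 (fun x => Real.exp (-f x)) := (hf.neg).exp
  have hψw : ContDiff ℝ 1 (fun x => ψ x * Real.exp (-f x)) := hψ.mul hw
  have hcw : HasCompactSupport (fun x => ψ x * Real.exp (-f x)) := hc.mul_right
  have hpd1 : ∀ i, ContDiff ℝ 1 (pd i h) := fun i => by
    simpa using contDiff_pd (n := 1) (by simpa using hh) i
  have hcpd : ∀ i, HasCompactSupport (pd i (fun x => ψ x * Real.exp (-f x))) := fun i => by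
    have := hcw.fderiv (𝕜 := ℝ)
    refine this.comp_left (g := fun L : EuclideanSpace ℝ (Fin d) →L[ℝ] ℝ =>
      L (EuclideanSpace.single i 1)) (by simp)
  have int1 : ∀ i, Integrable (fun x => pd i (fun x => ψ x * Real.exp (-f x)) x * pd i h x) :=
    fun i => ((continuous_pd hψw i).mul (hpd1 i).continuous).integrable_of_hasCompactSupport
      (hcpd i).mul_right
  have int2 : ∀ i, Integrable (fun x => (ψ x * Real.exp (-f x)) * pd i (pd i h) x) :=
    fun i => (hψw.continuous.mul (continuous_pd (hpd1 i) i)).integrable_of_hasCompactSupport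
      hcw.mul_right
  have int3 : ∀ i, Integrable (fun x => (ψ x * Real.exp (-f x)) * pd i h x) :=
    fun i => (hψw.continuous.mul (hpd1 i).continuous).integrable_of_hasCompactSupport
      hcw.mul_right
  have ibp : ∀ i, ∫ x, (ψ x * Real.exp (-f x)) * pd i (pd i h) x
      = - ∫ x, pd i (fun x => ψ x * Real.exp (-f x)) x * pd i h x := fun i =>
    integral_mul_fderiv_eq_neg_fderiv_mul_of_integrable (int1 i) (int2 i) (int3 i)
      (fun x _ => hψw.differentiable (by norm_num) x)
      (fun x _ => (hpd1 i).differentiable (by norm_num) x)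
  have hpw : ∀ i x, pd i (fun x => ψ x * Real.exp (-f x)) x
      = (pd i ψ x - ψ x * pd i f x) * Real.exp (-f x) := by
    intro i x
    rw [pd_mul (hψ.differentiable (by norm_num) x) (hw.differentiable (by norm_num) x)]
    have : pd i (fun x => Real.exp (-f x)) x = -Real.exp (-f x) * pd i f x := by
      refine pd_comp (g := fun y => Real.exp (-y)) (hf.differentiable (by norm_num) x) ?_ i
      simpa using (hasDerivAt_neg (f x)).exp
    rw [this]; ring
  have hzero : ∀ x ∉ Metric.ball o R,
      (ψ x * (lap h x - gdot f h x) + gdot h ψ x) * Real.exp (-f x) = 0 := by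
    intro x hx
    have hx' : x ∉ tsupport ψ := fun h => hx (hs h)
    have h0 : ψ x = 0 := image_eq_zero_of_notMem_tsupport hx'
    have h1 : fderiv ℝ ψ x = 0 := by
      by_contra hne
      exact hx' (support_fderiv_subset ℝ (f := ψ) hne)
    have : gdot h ψ x = 0 := by
      simp [gdot, pd, h1]
    rw [h0, this]; simp
  rw [setIntegral_eq_integral_of_forall_compl_eq_zero hzero]
  have hpt : ∀ x, (ψ x * (lap h x - gdot f h x) + gdot h ψ x) * Real.exp (-f x)
      = ∑ i, ((ψ x * Real.exp (-f x)) * pd i (pd i h) x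
        + pd i (fun x => ψ x * Real.exp (-f x)) x * pd i h x) := by
    intro x
    simp only [hpw, lap, gdot, Finset.sum_add_distrib, add_mul, mul_sub, sub_mul,
      Finset.sum_sub_distrib, Finset.mul_sum, Finset.sum_mul]
    have e1 : ∀ i, ψ x * pd i (pd i h) x * Real.exp (-f x)
      = ψ x * Real.exp (-f x) * pd i (pd i h) x := fun i => by ring
    have e2 : ∀ i, ψ x * (pd i f x * pd i h x) * Real.exp (-f x)
      = ψ x * pd i f x * Real.exp (-f x) * pd i h x := fun i => by ring
    have e3 : ∀ i, pd i h x * pd i ψ x * Real.exp (-f x)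
      = pd i ψ x * Real.exp (-f x) * pd i h x := fun i => by ring
    simp only [e1, e2, e3]
    ring
  simp only [hpt]
  have int4 : ∀ i, Integrable (fun x => (ψ x * Real.exp (-f x)) * pd i (pd i h) x
        + pd i (fun x => ψ x * Real.exp (-f x)) x * pd i h x) := fun i => (int2 i).add (int1 i)
  rw [integral_finsetSum _ fun i _ => int4 i]
  refine Finset.sum_eq_zero fun i _ => ?_
  rw [integral_add (int2 i) (int1 i), ibp i]
  ring

/-- Cutoff functions. -/
theorem exists_cutoff (o : EuclideanSpace ℝ (Fin d)) :
    ∃ C : ℝ, 0 < C ∧ ∀ R : ℝ, 1 ≤ R → ∃ φ : EuclideanSpace ℝ (Fin d) → ℝ,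
      ContDiff ℝ 1 φ ∧ (∀ x, 0 ≤ φ x) ∧ (∀ x, φ x ≤ 1) ∧ (∀ x ∈ Metric.ball o R, φ x = 1) ∧
      HasCompactSupport φ ∧ tsupport φ ⊆ Metric.ball o (2 * R) ∧
      ∀ x, gdot φ φ x * R ^ 2 ≤ C := by
  let b : ContDiffBump (0 : EuclideanSpace ℝ (Fin d)) := ⟨1, 3/2, by norm_num, by norm_num⟩
  have hb : ContDiff ℝ 1 (b : EuclideanSpace ℝ (Fin d) → ℝ) := b.contDiff
  have hbc : HasCompactSupport (b : EuclideanSpace ℝ (Fin d) → ℝ) := b.hasCompactSupport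
  have hcont : Continuous (fderiv ℝ (b : EuclideanSpace ℝ (Fin d) → ℝ)) :=
    hb.continuous_fderiv (by norm_num)
  obtain ⟨C, hC⟩ := hcont.bounded_above_of_compact_support (hbc.fderiv (𝕜 := ℝ))
  have hC0 : 0 ≤ C := (norm_nonneg _).trans (hC 0)
  refine ⟨d * C ^ 2 + 1, by positivity, fun R hR => ?_⟩
  have hR0 : 0 < R := by linarith
  let A : EuclideanSpace ℝ (Fin d) → EuclideanSpace ℝ (Fin d) := fun x => R⁻¹ • (x - o)
  have hA : ∀ x, HasFDerivAt A (R⁻¹ • ContinuousLinearMap.id ℝ _) x := fun x =>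
    ((hasFDerivAt_id x).sub_const o).const_smul R⁻¹
  have hnorm : ∀ x, ‖A x‖ = R⁻¹ * dist x o := by
    intro x
    simp only [A, norm_smul, dist_eq_norm, Real.norm_eq_abs, abs_of_pos (inv_pos.2 hR0)]
  have hts : tsupport (fun x => b (A x)) ⊆ Metric.closedBall o (3/2 * R) := by
    refine closure_minimal ?_ Metric.isClosed_closedBall
    intro x hx
    have : A x ∈ Function.support b := hx
    rw [b.support_eq] at this
    have h2 : ‖A x‖ < 3/2 := by simpa [b] using this
    rw [hnorm, inv_mul_lt_iff₀ hR0] at h2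
    rw [Metric.mem_closedBall]
    linarith
  refine ⟨fun x => b (A x), hb.comp (by fun_prop),
    fun x => b.nonneg, fun x => b.le_one, ?_, ?_, ?_, ?_⟩
  · intro x hx
    apply b.one_of_mem_closedBall
    rw [Metric.mem_ball] at hx
    simp only [mem_closedBall_zero_iff, hnorm, b]
    rw [inv_mul_le_iff₀ hR0]; linarith
  · exact HasCompactSupport.of_support_subset_isCompact (isCompact_closedBall o (3/2 * R))
      ((subset_tsupport _).trans hts)
  · refine hts.trans (Metric.closedBall_subset_ball (by linarith))
  · intro x
    have hpd : ∀ i, |pd i (fun x => b (A x)) x| * R ≤ C := by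
      intro i
      have h1 := ((hb.differentiable (by norm_num) (A x)).hasFDerivAt.comp x (hA x)).fderiv
      unfold pd
      rw [show (fun x => b (A x)) = b ∘ A from rfl, h1]
      simp only [ContinuousLinearMap.comp_apply, smul_apply,
        ContinuousLinearMap.id_apply, map_smul, smul_eq_mul, abs_mul, abs_inv, abs_of_pos hR0]
      have h2 := (fderiv ℝ b (A x)).le_opNorm (EuclideanSpace.single i (1:ℝ))
      simp only [Real.norm_eq_abs, EuclideanSpace.norm_single, norm_one, mul_one] at h2
      have := hC (A x)
      calc _ = |fderiv ℝ b (A x) (EuclideanSpace.single i 1)| := by field_simp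
        _ ≤ C := by simpa using h2.trans this
    have h3 : ∀ i, pd i (fun x => b (A x)) x * pd i (fun x => b (A x)) x * R ^ 2 ≤ C ^ 2 := by
      intro i
      have := pow_le_pow_left₀ (by positivity) (hpd i) 2
      calc _ = (|pd i (fun x => b (A x)) x| * R) ^ 2 := by rw [mul_pow, sq_abs]; ring
        _ ≤ _ := this
    unfold gdot
    rw [Finset.sum_mul]
    refine (Finset.sum_le_sum fun i _ => h3 i).trans ?_
    simp

/-- Convexity gives a nonnegative Hessian. -/
theorem hess_nonneg {f : EuclideanSpace ℝ (Fin d) → ℝ} (hf : ContDiff ℝ 2 f)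
    (hconv : ConvexOn ℝ Set.univ f) (x : EuclideanSpace ℝ (Fin d)) (c : Fin d → ℝ) :
    0 ≤ ∑ i, ∑ j, pd i (pd j f) x * c i * c j := by
  set y : EuclideanSpace ℝ (Fin d) := ∑ i, c i • EuclideanSpace.single i (1:ℝ) with hy
  have hsum : ∑ i, ∑ j, pd i (pd j f) x * c i * c j = fderiv ℝ (fderiv ℝ f) x y y := by
    simp only [hy, map_sum, sum_apply, map_smul,
      smul_apply, smul_eq_mul, Finset.mul_sum]
    rw [Finset.sum_comm]
    refine Finset.sum_congr rfl fun j _ => ?_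
    refine Finset.sum_congr rfl fun i _ => ?_
    have := pd_fderiv hf x (EuclideanSpace.single i 1) j
    unfold pd at this ⊢
    rw [this]; ring
  rw [hsum]
  have hline : ∀ t : ℝ, HasDerivAt (fun t : ℝ => x + t • y) y t := fun t => by
    simpa using ((hasDerivAt_id t).smul_const y).const_add x
  have hd1 : ∀ t : ℝ, HasDerivAt (fun t : ℝ => f (x + t • y)) (fderiv ℝ f (x + t • y) y) t :=
    fun t => ((hf.differentiable (by norm_num) _).hasFDerivAt).comp_hasDerivAt t (hline t)
  have hd2 : HasDerivAt (fun t : ℝ => fderiv ℝ f (x + t • y) y)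
      (fderiv ℝ (fderiv ℝ f) x y y) 0 := by
    have h1 : DifferentiableAt ℝ (fderiv ℝ f) (x + (0:ℝ) • y) :=
      ((hf.fderiv_right (m := 1) (by norm_num)).differentiable (by norm_num)) _
    have h2 := h1.hasFDerivAt.comp_hasDerivAt (0:ℝ) (hline 0)
    have h3 := h2.clm_apply (hasDerivAt_const (0:ℝ) y)
    simpa using h3
  have hcv : ConvexOn ℝ Set.univ (fun t : ℝ => f (x + t • y)) := by
    have := hconv.comp_affineMap (AffineMap.lineMap x (x + y) : ℝ →ᵃ[ℝ] EuclideanSpace ℝ (Fin d))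
    have e : (f ∘ (AffineMap.lineMap x (x + y) : ℝ →ᵃ[ℝ] EuclideanSpace ℝ (Fin d)))
        = fun t : ℝ => f (x + t • y) := by
      funext t; simp [AffineMap.lineMap_apply, add_comm]
    rw [e] at this
    simpa using this
  have hmono := hcv.monotoneOn_deriv (fun t _ => (hd1 t).differentiableAt)
  have hmono' : Monotone (fun t : ℝ => fderiv ℝ f (x + t • y) y) := by
    intro s t hst
    have := hmono (Set.mem_univ s) (Set.mem_univ t) hst
    rwa [(hd1 s).deriv, (hd1 t).deriv] at this
  have := hd2.deriv
  rw [← this]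
  exact hmono'.deriv_nonneg

end LaneEmden

namespace LaneEmden

variable {d : ℕ}

/-- The transformed problem for `v = u ^ (-2/(d-2))`. -/
structure VP (f v P : EuclideanSpace ℝ (Fin d) → ℝ) (c : ℝ) : Prop where
  hd : 0 < d
  hf : ContDiff ℝ 2 f
  hv : ContDiff ℝ 3 v
  hP : ContDiff ℝ 2 P
  vpos : ∀ x, 0 < v x
  Ppos : ∀ x, 0 < P x
  cpos : 0 < c
  hvP : ∀ x, v x * P x = (d : ℝ) / 2 * gdot v v x + c
  heq : ∀ x, lap v x = P x + gdot f v x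
  hg : ∀ x, 0 ≤ gdot f v x
  hess : ∀ x (a : Fin d → ℝ), 0 ≤ ∑ i, ∑ j, pd i (pd j f) x * a i * a j

/-- The Bochner quantity. -/
noncomputable def QQ (f v P : EuclideanSpace ℝ (Fin d) → ℝ) (x : EuclideanSpace ℝ (Fin d)) : ℝ :=
  (d : ℝ) * (∑ i, ∑ j, pd i (pd j v) x ^ 2) - P x ^ 2
    + d * ∑ i, ∑ j, pd i (pd j f) x * pd i v x * pd j v x

/-- The modified traceless Hessian, squared norm. -/
noncomputable def EE (v P : EuclideanSpace ℝ (Fin d) → ℝ) (x : EuclideanSpace ℝ (Fin d)) : ℝ :=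
  ∑ i, ∑ j, (pd i (pd j v) x - if i = j then P x / d else 0) ^ 2

section
variable {f v P : EuclideanSpace ℝ (Fin d) → ℝ} {c : ℝ}

theorem VP.hv2 (H : VP f v P c) : ContDiff ℝ 2 v := H.hv.of_le (by norm_num)
theorem VP.hv1 (H : VP f v P c) : ContDiff ℝ 1 v := H.hv.of_le (by norm_num)
theorem VP.hP1 (H : VP f v P c) : ContDiff ℝ 1 P := H.hP.of_le (by norm_num)
theorem VP.hf1 (H : VP f v P c) : ContDiff ℝ 1 f := H.hf.of_le (by norm_num)

theorem VP.pdv2 (H : VP f v P c) (i : Fin d) : ContDiff ℝ 2 (pd i v) := by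
  simpa using contDiff_pd (n := 2) (by simpa using H.hv) i
theorem VP.pdpdv (H : VP f v P c) (i j : Fin d) : ContDiff ℝ 1 (pd i (pd j v)) := by
  simpa using contDiff_pd (n := 1) (by simpa using H.pdv2 j) i
theorem VP.pdP (H : VP f v P c) (i : Fin d) : ContDiff ℝ 1 (pd i P) := by
  simpa using contDiff_pd (n := 1) (by simpa using H.hP) i
theorem VP.pdf (H : VP f v P c) (i : Fin d) : ContDiff ℝ 1 (pd i f) := by
  simpa using contDiff_pd (n := 1) (by simpa using H.hf) i

theorem VP.first (H : VP f v P c) (j : Fin d) (x : EuclideanSpace ℝ (Fin d)) :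
    v x * pd j P x + P x * pd j v x = d * ∑ i, pd i v x * pd j (pd i v) x := by
  have e : (fun x => v x * P x) = fun x => (d : ℝ) / 2 * (∑ i, pd i v x * pd i v x) + c := by
    funext x; exact H.hvP x
  have h1 := congrArg (fun F => pd j F x) e
  have dv : ∀ i, DifferentiableAt ℝ (pd i v) x := fun i =>
    (H.pdv2 i).differentiable (by norm_num) x
  have dvv : ∀ i, DifferentiableAt ℝ (fun x => pd i v x * pd i v x) x := fun i =>
    (dv i).fun_mul (dv i)
  have ds : DifferentiableAt ℝ (fun x => ∑ i, pd i v x * pd i v x) x :=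
    DifferentiableAt.fun_sum fun i _ => dvv i
  rw [pd_mul (H.hv.differentiable (by norm_num) x) (H.hP.differentiable (by norm_num) x),
    pd_add_const _ (ds.const_mul _), pd_const_mul _ ds,
    pd_sum _ (fun i _ => dvv i)] at h1
  rw [h1, Finset.mul_sum, Finset.mul_sum]
  refine Finset.sum_congr rfl fun i _ => ?_
  rw [pd_mul (dv i) (dv i)]; ring

theorem VP.second (H : VP f v P c) (j : Fin d) (x : EuclideanSpace ℝ (Fin d)) :
    v x * pd j (pd j P) x + 2 * (pd j P x * pd j v x) + P x * pd j (pd j v) x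
      = d * ∑ i, (pd i v x * pd i (pd j (pd j v)) x + pd i (pd j v) x ^ 2) := by
  have e : (fun x => v x * pd j P x + P x * pd j v x)
      = fun x => (d : ℝ) * ∑ i, pd i v x * pd j (pd i v) x := by
    funext x; exact H.first j x
  have h1 := congrArg (fun F => pd j F x) e
  have dv0 : DifferentiableAt ℝ v x := H.hv.differentiable (by norm_num) x
  have dP0 : DifferentiableAt ℝ P x := H.hP.differentiable (by norm_num) x
  have dv : ∀ i, DifferentiableAt ℝ (pd i v) x := fun i =>
    (H.pdv2 i).differentiable (by norm_num) x
  have dP : ∀ i, DifferentiableAt ℝ (pd i P) x := fun i =>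
    (H.pdP i).differentiable (by norm_num) x
  have ddv : ∀ i j, DifferentiableAt ℝ (pd i (pd j v)) x := fun i j =>
    (H.pdpdv i j).differentiable (by norm_num) x
  have dvv : ∀ i, DifferentiableAt ℝ (fun x => pd i v x * pd j (pd i v) x) x := fun i =>
    (dv i).fun_mul (ddv j i)
  have ds : DifferentiableAt ℝ (fun x => ∑ i, pd i v x * pd j (pd i v) x) x :=
    DifferentiableAt.fun_sum fun i _ => dvv i
  rw [pd_add (dv0.fun_mul (dP j)) (dP0.fun_mul (dv j)), pd_mul dv0 (dP j), pd_mul dP0 (dv j),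
    pd_const_mul _ ds, pd_sum _ (fun i _ => dvv i)] at h1
  have h2 : ∀ i, pd j (fun x => pd i v x * pd j (pd i v) x) x
      = pd i v x * pd i (pd j (pd j v)) x + pd i (pd j v) x ^ 2 := by
    intro i
    rw [pd_mul (dv i) (ddv j i), pd_comm H.hv2 j i, pd_comm (H.pdv2 j) j i]
    ring
  simp only [h2] at h1
  rw [← h1]; ring

theorem VP.pdlap (H : VP f v P c) (i : Fin d) (x : EuclideanSpace ℝ (Fin d)) :
    ∑ j, pd i (pd j (pd j v)) x
      = pd i P x + ∑ j, (pd j f x * pd i (pd j v) x + pd j v x * pd i (pd j f) x) := by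
  have e : (fun x => ∑ j, pd j (pd j v) x) = fun x => P x + ∑ j, pd j f x * pd j v x := by
    funext x; exact H.heq x
  have h1 := congrArg (fun F => pd i F x) e
  have dP0 : DifferentiableAt ℝ P x := H.hP.differentiable (by norm_num) x
  have dv : ∀ i, DifferentiableAt ℝ (pd i v) x := fun i =>
    (H.pdv2 i).differentiable (by norm_num) x
  have df : ∀ i, DifferentiableAt ℝ (pd i f) x := fun i =>
    (H.pdf i).differentiable (by norm_num) x
  have ddv : ∀ i j, DifferentiableAt ℝ (pd i (pd j v)) x := fun i j =>
    (H.pdpdv i j).differentiable (by norm_num) x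
  have dfv : ∀ j, DifferentiableAt ℝ (fun x => pd j f x * pd j v x) x := fun j =>
    (df j).fun_mul (dv j)
  rw [pd_sum _ (fun j _ => ddv j j), pd_add dP0 (DifferentiableAt.fun_sum fun j _ => dfv j),
    pd_sum _ (fun j _ => dfv j)] at h1
  rw [h1]
  congr 1
  refine Finset.sum_congr rfl fun j _ => ?_
  rw [pd_mul (df j) (dv j)]

theorem VP.bochner (H : VP f v P c) (x : EuclideanSpace ℝ (Fin d)) :
    v x * (lap P x - gdot f P x) = (d - 2) * gdot v P x + QQ f v P x := by
  have hs : ∑ j, (v x * pd j (pd j P) x + 2 * (pd j P x * pd j v x) + P x * pd j (pd j v) x)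
      = ∑ j, ((d:ℝ) * ∑ i, (pd i v x * pd i (pd j (pd j v)) x + pd i (pd j v) x ^ 2)) :=
    Finset.sum_congr rfl fun j _ => H.second j x
  have e1 : ∑ j, (v x * pd j (pd j P) x + 2 * (pd j P x * pd j v x) + P x * pd j (pd j v) x)
      = v x * lap P x + 2 * gdot v P x + P x * (P x + gdot f v x) := by
    rw [← H.heq x, gdot_comm v P]
    simp only [Finset.sum_add_distrib, lap, gdot, Finset.mul_sum]
  have e2 : ∑ j, ((d:ℝ) * ∑ i, (pd i v x * pd i (pd j (pd j v)) x + pd i (pd j v) x ^ 2))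
      = d * (∑ i, pd i v x * ∑ j, pd i (pd j (pd j v)) x)
        + d * ∑ i, ∑ j, pd i (pd j v) x ^ 2 := by
    rw [← Finset.mul_sum, Finset.sum_comm]
    rw [← mul_add, ← Finset.sum_add_distrib]
    congr 1
    refine Finset.sum_congr rfl fun i _ => ?_
    rw [Finset.mul_sum, ← Finset.sum_add_distrib]
  have e3 : ∑ i, pd i v x * ∑ j, pd i (pd j (pd j v)) x
      = gdot v P x + ∑ j, pd j f x * ∑ i, pd i v x * pd j (pd i v) x
        + ∑ i, ∑ j, pd i (pd j f) x * pd i v x * pd j v x := by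
    have hsym : ∀ i j, pd i (pd j v) x = pd j (pd i v) x := fun i j => by
      rw [pd_comm H.hv2 i j]
    simp only [H.pdlap _ x, gdot]
    have a1 : ∑ j, pd j f x * ∑ i, pd i v x * pd j (pd i v) x
      = ∑ i, ∑ j, pd i v x * (pd j f x * pd i (pd j v) x) := by
      simp only [Finset.mul_sum]
      rw [Finset.sum_comm]
      refine Finset.sum_congr rfl fun i _ => Finset.sum_congr rfl fun j _ => ?_
      rw [hsym i j]; ring
    have a2 : ∑ i, ∑ j, pd i (pd j f) x * pd i v x * pd j v x
      = ∑ i, ∑ j, pd i v x * (pd j v x * pd i (pd j f) x) :=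
      Finset.sum_congr rfl fun i _ => Finset.sum_congr rfl fun j _ => by ring
    rw [a1, a2]
    simp only [mul_add, Finset.sum_add_distrib, Finset.mul_sum]
    ring
  have e4 : (d:ℝ) * ∑ j, pd j f x * ∑ i, pd i v x * pd j (pd i v) x
      = v x * gdot f P x + P x * gdot f v x := by
    rw [Finset.mul_sum]
    simp only [gdot, Finset.mul_sum (a := v x), Finset.mul_sum (a := P x)]
    rw [← Finset.sum_add_distrib]
    refine Finset.sum_congr rfl fun j _ => ?_
    have := H.first j x
    linear_combination (-pd j f x) * this
  rw [e1, e2, e3] at hs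
  unfold QQ
  linear_combination hs + e4

theorem VP.Q_eq (H : VP f v P c) (x : EuclideanSpace ℝ (Fin d)) :
    QQ f v P x = d * EE v P x + 2 * P x * gdot f v x
      + d * ∑ i, ∑ j, pd i (pd j f) x * pd i v x * pd j v x := by
  have hd : (d:ℝ) ≠ 0 := by exact_mod_cast H.hd.ne'
  have h1 : EE v P x = ∑ i, ∑ j, pd i (pd j v) x ^ 2 - 2 * (P x / d) * lap v x + P x ^ 2 / d := by
    have e : ∀ i j, (pd i (pd j v) x - if i = j then P x / d else 0) ^ 2
      = pd i (pd j v) x ^ 2 - (if i = j then 2 * (P x / d) * pd i (pd j v) x else 0)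
        + (if i = j then (P x / d) ^ 2 else 0) := by
      intro i j
      split_ifs <;> ring
    unfold EE lap
    simp only [e, Finset.sum_add_distrib, Finset.sum_sub_distrib, Finset.sum_ite_eq,
      Finset.mem_univ, if_true, Finset.mul_sum]
    simp
    field_simp
  rw [h1, H.heq x]
  unfold QQ
  field_simp
  ring

theorem EE_nonneg (v P : EuclideanSpace ℝ (Fin d) → ℝ) (x : EuclideanSpace ℝ (Fin d)) :
    0 ≤ EE v P x := Finset.sum_nonneg fun _ _ => Finset.sum_nonneg fun _ _ => sq_nonneg _

theorem VP.EE_le (H : VP f v P c) (x : EuclideanSpace ℝ (Fin d)) :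
    d * EE v P x ≤ QQ f v P x := by
  have h1 := H.hess x (fun i => pd i v x)
  have h2 : 0 ≤ (d:ℝ) * ∑ i, ∑ j, pd i (pd j f) x * pd i v x * pd j v x := by positivity
  have h3 : 0 ≤ 2 * P x * gdot f v x := mul_nonneg (by linarith [H.Ppos x]) (H.hg x)
  rw [H.Q_eq x]; linarith

theorem VP.Q_nonneg (H : VP f v P c) (x : EuclideanSpace ℝ (Fin d)) : 0 ≤ QQ f v P x :=
  le_trans (mul_nonneg (by positivity) (EE_nonneg v P x)) (H.EE_le x)

theorem VP.gv_le (H : VP f v P c) (x : EuclideanSpace ℝ (Fin d)) :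
    (d:ℝ) * gdot v v x ≤ 2 * (v x * P x) := by
  have := H.hvP x; have := H.cpos; linarith

theorem VP.vP_eq (H : VP f v P c) (j : Fin d) (x : EuclideanSpace ℝ (Fin d)) :
    v x * pd j P x = d * ∑ i, pd i v x * (pd j (pd i v) x - if j = i then P x / d else 0) := by
  have hd : (d:ℝ) ≠ 0 := by exact_mod_cast H.hd.ne'
  have := H.first j x
  simp only [mul_sub, Finset.sum_sub_distrib, mul_ite, mul_zero, Finset.sum_ite_eq,
    Finset.mem_univ, if_true]
  rw [← this]; field_simp; ring

theorem VP.gP_le (H : VP f v P c) (x : EuclideanSpace ℝ (Fin d)) :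
    v x * gdot P P x ≤ 2 * (P x * QQ f v P x) := by
  have hv := H.vpos x
  have h1 : v x ^ 2 * gdot P P x ≤ d ^ 2 * (EE v P x * gdot v v x) := by
    have : v x ^ 2 * gdot P P x = ∑ j, (v x * pd j P x) ^ 2 := by
      unfold gdot; rw [Finset.mul_sum]
      exact Finset.sum_congr rfl fun j _ => by ring
    rw [this]
    unfold EE
    rw [Finset.sum_mul, Finset.mul_sum]
    refine Finset.sum_le_sum fun j _ => ?_
    rw [H.vP_eq j x, mul_pow]
    refine mul_le_mul_of_nonneg_left ?_ (by positivity)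
    have := Finset.sum_mul_sq_le_sq_mul_sq Finset.univ (fun i => pd i v x)
      (fun i => (pd j (pd i v) x - if j = i then P x / d else 0))
    refine this.trans (le_of_eq ?_)
    rw [mul_comm]
    congr 1
    exact Finset.sum_congr rfl fun i _ => by ring
  have h2 := H.gv_le x
  have h3 := H.EE_le x
  have h4 := EE_nonneg v P x
  have h5 := H.Q_nonneg x
  have h6 : v x ^ 2 * gdot P P x ≤ v x * (2 * (P x * QQ f v P x)) := by
    have hvP : 0 ≤ 2 * (v x * P x) := by have := H.Ppos x; positivity
    calc _ ≤ (d * EE v P x) * (d * gdot v v x) := by nlinarith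
      _ ≤ QQ f v P x * (2 * (v x * P x)) := by
        apply mul_le_mul h3 h2 (mul_nonneg (by positivity) (gdot_self_nonneg _ _)) h5
      _ = _ := by ring
  have h7 : v x * (v x * gdot P P x) ≤ v x * (2 * (P x * QQ f v P x)) := by
    calc _ = v x ^ 2 * gdot P P x := by ring
      _ ≤ _ := h6
  exact le_of_mul_le_mul_left h7 hv

theorem VP.Q_cont (H : VP f v P c) : Continuous (QQ f v P) := by
  unfold QQ
  have hcv : ∀ i, Continuous (pd i v) := fun i => (H.pdv2 i).continuous
  have hcvv : ∀ i j, Continuous (pd i (pd j v)) := fun i j => (H.pdpdv i j).continuous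
  have hcff : ∀ i j, Continuous (pd i (pd j f)) := fun i j => continuous_pd (H.pdf j) i
  have hcP := H.hP.continuous
  fun_prop

end
end LaneEmden

namespace LaneEmden

variable {d : ℕ}

/-- Cutoff function properties. -/
structure Cut (o : EuclideanSpace ℝ (Fin d)) (C R : ℝ) (φ : EuclideanSpace ℝ (Fin d) → ℝ) :
    Prop where
  hR : 1 ≤ R
  hC : 0 < C
  sm : ContDiff ℝ 1 φ
  nn : ∀ x, 0 ≤ φ x
  le1 : ∀ x, φ x ≤ 1
  eq1 : ∀ x ∈ Metric.ball o R, φ x = 1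
  cs : HasCompactSupport φ
  ts : tsupport φ ⊆ Metric.ball o (2 * R)
  gr : ∀ x, gdot φ φ x * R ^ 2 ≤ C

theorem exists_cut (o : EuclideanSpace ℝ (Fin d)) :
    ∃ C : ℝ, 0 < C ∧ ∀ R : ℝ, 1 ≤ R → ∃ φ, Cut o C R φ := by
  obtain ⟨C, hC, h⟩ := exists_cutoff o
  refine ⟨C, hC, fun R hR => ?_⟩
  obtain ⟨φ, h1, h2, h3, h4, h5, h6, h7⟩ := h R hR
  exact ⟨φ, hR, hC, h1, h2, h3, h4, h5, h6, h7⟩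

theorem intOn {F : EuclideanSpace ℝ (Fin d) → ℝ} (hF : Continuous F)
    (o : EuclideanSpace ℝ (Fin d)) (R : ℝ) : IntegrableOn F (Metric.ball o R) :=
  (hF.continuousOn.integrableOn_compact (isCompact_closedBall o R)).mono_set
    Metric.ball_subset_closedBall

theorem int_le {f F G Z : EuclideanSpace ℝ (Fin d) → ℝ} (hf : Continuous f) (hF : Continuous F)
    (hG : Continuous G) (hZ : Continuous Z)
    (o : EuclideanSpace ℝ (Fin d)) (R : ℝ) (hle : ∀ x, F x ≤ G x + Z x)
    (h0 : ∫ x in Metric.ball o R, Z x * Real.exp (-f x) = 0) :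
    ∫ x in Metric.ball o R, F x * Real.exp (-f x)
      ≤ ∫ x in Metric.ball o R, G x * Real.exp (-f x) := by
  have hw : Continuous fun x => Real.exp (-f x) := by fun_prop
  have h1 : ∫ x in Metric.ball o R, F x * Real.exp (-f x)
      ≤ ∫ x in Metric.ball o R, (G x * Real.exp (-f x) + Z x * Real.exp (-f x)) := by
    refine integral_mono (intOn (hF.mul hw) o R)
      ((intOn (hG.mul hw) o R).add (intOn (hZ.mul hw) o R)) fun x => ?_
    have := hle x
    have := Real.exp_pos (-f x)
    simp only
    nlinarith
  have i1 : IntegrableOn (fun x => G x * Real.exp (-f x)) (Metric.ball o R) :=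
    intOn (hG.mul hw) o R
  have i2 : IntegrableOn (fun x => Z x * Real.exp (-f x)) (Metric.ball o R) :=
    intOn (hZ.mul hw) o R
  rw [integral_add i1 i2, h0, add_zero] at h1
  exact h1

theorem int_le' {f F G : EuclideanSpace ℝ (Fin d) → ℝ} (hf : Continuous f) (hF : Continuous F)
    (hG : Continuous G)
    (o : EuclideanSpace ℝ (Fin d)) (R : ℝ) (hle : ∀ x, F x ≤ G x) :
    ∫ x in Metric.ball o R, F x * Real.exp (-f x)
      ≤ ∫ x in Metric.ball o R, G x * Real.exp (-f x) :=
  int_le hf hF hG continuous_const o R (Z := fun _ => 0) (by simpa using hle) (by simp)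

theorem int_mono_ball {f F : EuclideanSpace ℝ (Fin d) → ℝ} (hf : Continuous f) (hF : Continuous F)
    (hF0 : ∀ x, 0 ≤ F x)
    (o : EuclideanSpace ℝ (Fin d)) {R S : ℝ} (hRS : R ≤ S) :
    ∫ x in Metric.ball o R, F x * Real.exp (-f x)
      ≤ ∫ x in Metric.ball o S, F x * Real.exp (-f x) := by
  have hw : Continuous fun x => Real.exp (-f x) := by fun_prop
  refine setIntegral_mono_set (intOn (hF.mul hw) o S) ?_ ?_
  · exact Eventually.of_forall fun x => mul_nonneg (hF0 x) (Real.exp_pos _).le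
  · exact (Metric.ball_subset_ball hRS).eventuallyLE

theorem int_cut {f F : EuclideanSpace ℝ (Fin d) → ℝ} (hf : Continuous f) (hF : Continuous F)
    (hF0 : ∀ x, 0 ≤ F x) {o : EuclideanSpace ℝ (Fin d)} {C R : ℝ}
    {φ : EuclideanSpace ℝ (Fin d) → ℝ} (hφ : Cut o C R φ) (k : ℕ) :
    ∫ x in Metric.ball o R, F x * Real.exp (-f x)
      ≤ ∫ x in Metric.ball o (2 * R), (F x * φ x ^ k) * Real.exp (-f x) := by
  have hφc := hφ.sm.continuous
  have e : ∫ x in Metric.ball o R, F x * Real.exp (-f x)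
      = ∫ x in Metric.ball o R, (F x * φ x ^ k) * Real.exp (-f x) := by
    refine setIntegral_congr_fun measurableSet_ball fun x hx => ?_
    simp [hφ.eq1 x hx]
  rw [e]
  exact int_mono_ball hf (by fun_prop) (fun x => mul_nonneg (hF0 x) (pow_nonneg (hφ.nn x) k)) o
    (by linarith [hφ.hR])

theorem abs_le_of_sq {X a b : ℝ} (ha : 0 ≤ a) (hb : 0 ≤ b) (h : X ^ 2 ≤ 4 * (a * b)) :
    |X| ≤ a + b := by
  apply abs_le_of_sq_le_sq _ (by positivity)
  nlinarith [sq_nonneg (a - b)]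

theorem young1 {v φ R L m : ℝ} (hv : 0 < v) (hφ : 0 ≤ φ) (hφ1 : φ ≤ 1) (hR : 0 < R) (hL : 0 < L)
    (hm1 : 1 ≤ m) (hm3 : m ≤ 3) :
    v ^ (-m) * v * φ ^ 2 / R ^ 2 ≤ L⁻¹ * (v ^ (-m) / v * φ ^ 4) + L ^ ((m - 1) / 2) * R ^ (-(m + 1)) := by
  have hM : 0 < v ^ (-m) := Real.rpow_pos_of_pos hv _
  have hL2 : 0 < L ^ ((m - 1) / 2) := Real.rpow_pos_of_pos hL _
  have hR2 : 0 < R ^ (-(m + 1)) := Real.rpow_pos_of_pos hR _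
  by_cases h : L * v ^ 2 ≤ φ ^ 2 * R ^ 2
  · have : v ^ (-m) * v * φ ^ 2 / R ^ 2 ≤ L⁻¹ * (v ^ (-m) / v * φ ^ 4) := by
      rw [div_le_iff₀ (by positivity)]
      have e : L⁻¹ * (v ^ (-m) / v * φ ^ 4) * R ^ 2
        = (v ^ (-m) * φ ^ 2 / (L * v)) * (φ ^ 2 * R ^ 2) := by field_simp
      rw [e]
      calc v ^ (-m) * v * φ ^ 2 = (v ^ (-m) * φ ^ 2 / (L * v)) * (L * v ^ 2) := by field_simp
        _ ≤ _ := mul_le_mul_of_nonneg_left h (by positivity)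
    have h2 : 0 ≤ L ^ ((m - 1) / 2) * R ^ (-(m + 1)) := by positivity
    linarith
  · push Not at h
    have h1 : 0 ≤ L⁻¹ * (v ^ (-m) / v * φ ^ 4) := by positivity
    suffices h2 : v ^ (-m) * v * φ ^ 2 / R ^ 2 ≤ L ^ ((m - 1) / 2) * R ^ (-(m + 1)) by linarith
    rcases hφ.eq_or_lt with h0 | h0
    · rw [← h0]; simp; positivity
    have hs : 0 < Real.sqrt L := Real.sqrt_pos.2 hL
    have hlt : φ * R / Real.sqrt L ≤ v := by
      rw [div_le_iff₀ hs]
      apply le_of_lt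
      apply lt_of_pow_lt_pow_left₀ 2 (by positivity)
      rw [mul_pow, mul_pow, Real.sq_sqrt hL.le]; linarith
    have h3 : v ^ (1 - m) ≤ (φ * R / Real.sqrt L) ^ (1 - m) :=
      Real.rpow_le_rpow_of_nonpos (by positivity) hlt (by linarith)
    have h4 : (φ * R / Real.sqrt L) ^ (1 - m) = φ ^ (1 - m) * R ^ (1 - m) * L ^ ((m - 1) / 2) := by
      rw [Real.div_rpow (by positivity) hs.le, Real.mul_rpow h0.le hR.le, Real.sqrt_eq_rpow,
        ← Real.rpow_mul hL.le, div_eq_mul_inv, ← Real.rpow_neg hL.le]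
      congr 2; ring
    have h5 : v ^ (-m) * v = v ^ (1 - m) := by
      rw [← Real.rpow_add_one hv.ne']; congr 1; ring
    have h6 : φ ^ (1 - m) * φ ^ 2 ≤ 1 := by
      rw [← Real.rpow_natCast φ 2, ← Real.rpow_add h0]
      exact Real.rpow_le_one h0.le hφ1 (by push_cast; linarith)
    have h7 : R ^ (1 - m) / R ^ 2 = R ^ (-(m + 1)) := by
      rw [← Real.rpow_natCast R 2, ← Real.rpow_sub hR]; congr 1; push_cast; ring
    rw [h5]
    rw [h4] at h3
    calc v ^ (1 - m) * φ ^ 2 / R ^ 2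
        ≤ (φ ^ (1 - m) * R ^ (1 - m) * L ^ ((m - 1) / 2)) * φ ^ 2 / R ^ 2 := by gcongr
      _ = (φ ^ (1 - m) * φ ^ 2) * (L ^ ((m - 1) / 2) * (R ^ (1 - m) / R ^ 2)) := by ring
      _ ≤ 1 * (L ^ ((m - 1) / 2) * (R ^ (1 - m) / R ^ 2)) := by gcongr
      _ = _ := by rw [h7, one_mul]

section
variable {f v P : EuclideanSpace ℝ (Fin d) → ℝ} {c : ℝ}

theorem VP.vr (H : VP f v P c) (a : ℝ) : ContDiff ℝ 1 (fun x => v x ^ a) :=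
  H.hv1.rpow_const_of_ne fun x => (H.vpos x).ne'
theorem VP.Pr (H : VP f v P c) (a : ℝ) : ContDiff ℝ 1 (fun x => P x ^ a) :=
  H.hP1.rpow_const_of_ne fun x => (H.Ppos x).ne'

theorem VP.gdot_test (H : VP f v P c) {φ : EuclideanSpace ℝ (Fin d) → ℝ} (hφ : ContDiff ℝ 1 φ)
    (h : EuclideanSpace ℝ (Fin d) → ℝ) (a b : ℝ) (k : ℕ) (x : EuclideanSpace ℝ (Fin d)) :
    gdot h (fun x => v x ^ a * P x ^ b * φ x ^ k) x
      = a * (v x ^ a / v x) * P x ^ b * φ x ^ k * gdot h v x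
        + b * v x ^ a * (P x ^ b / P x) * φ x ^ k * gdot h P x
        + k * v x ^ a * P x ^ b * φ x ^ (k - 1) * gdot h φ x := by
  have d1 : DifferentiableAt ℝ (fun x => v x ^ a) x := (H.vr a).differentiable (by norm_num) x
  have d2 : DifferentiableAt ℝ (fun x => P x ^ b) x := (H.Pr b).differentiable (by norm_num) x
  have d0 : DifferentiableAt ℝ φ x := hφ.differentiable (by norm_num) x
  have d3 : DifferentiableAt ℝ (fun x => φ x ^ k) x := d0.fun_pow k
  have dv0 : DifferentiableAt ℝ v x := H.hv.differentiable (by norm_num) x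
  have dP0 : DifferentiableAt ℝ P x := H.hP.differentiable (by norm_num) x
  unfold gdot
  rw [Finset.mul_sum, Finset.mul_sum, Finset.mul_sum, ← Finset.sum_add_distrib,
    ← Finset.sum_add_distrib]
  refine Finset.sum_congr rfl fun i _ => ?_
  rw [pd_mul (d1.fun_mul d2) d3, pd_mul d1 d2, pd_rpow dv0 (H.vpos x), pd_rpow dP0 (H.Ppos x),
    pd_pow d0, Real.rpow_sub_one (H.vpos x).ne', Real.rpow_sub_one (H.Ppos x).ne']
  ring

/-- Green's formula with a monomial test function. -/
theorem VP.green (H : VP f v P c) {o : EuclideanSpace ℝ (Fin d)} {C R : ℝ}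
    {φ : EuclideanSpace ℝ (Fin d) → ℝ} (hφ : Cut o C R φ)
    {h : EuclideanSpace ℝ (Fin d) → ℝ} (hh : ContDiff ℝ 2 h) (a b : ℝ) (k : ℕ) (hk : k ≠ 0) :
    ∫ x in Metric.ball o (2 * R),
      (v x ^ a * P x ^ b * φ x ^ k * (lap h x - gdot f h x)
        + gdot h (fun x => v x ^ a * P x ^ b * φ x ^ k) x) * Real.exp (-f x) = 0 ∧
    Continuous (fun x => v x ^ a * P x ^ b * φ x ^ k * (lap h x - gdot f h x)
        + gdot h (fun x => v x ^ a * P x ^ b * φ x ^ k) x) := by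
  have hψ : ContDiff ℝ 1 (fun x => v x ^ a * P x ^ b * φ x ^ k) :=
    ((H.vr a).mul (H.Pr b)).mul (hφ.sm.pow k)
  have hsub : Function.support (fun x => v x ^ a * P x ^ b * φ x ^ k) ⊆ Function.support φ := by
    intro x hx h0
    apply hx
    simp only [h0, zero_pow hk, mul_zero]
  refine ⟨LaneEmden.green H.hf1 hh hψ (hφ.cs.mono hsub) ((closure_mono hsub).trans hφ.ts), ?_⟩
  have c1 := continuous_lap hh
  have c2 := continuous_gdot H.hf1 (hh.of_le (by norm_num))
  have c3 := continuous_gdot (hh.of_le (by norm_num)) hψ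
  exact (hψ.continuous.mul (c1.sub c2)).add c3

set_option maxHeartbeats 1000000 in
/-- Basic estimate. -/
theorem VP.basic (H : VP f v P c) {o : EuclideanSpace ℝ (Fin d)} {C0 : ℝ}
    (hvol : ∀ R : ℝ, 1 ≤ R → (∫ x in Metric.ball o R, Real.exp (-f x)) ≤ C0 * R ^ d)
    {m : ℝ} (hm1 : 1 ≤ m) (hm3 : m ≤ 3) (hmd : 2 * m < d) :
    ∃ K : ℝ, 0 < K ∧ ∀ R : ℝ, 1 ≤ R →
      ∫ x in Metric.ball o R, (v x ^ (-m) * P x) * Real.exp (-f x)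
        ≤ K * R ^ ((d : ℝ) - m - 1) := by
  obtain ⟨C, hC, hcut⟩ := exists_cut o
  have hd : (0:ℝ) < d := by exact_mod_cast H.hd
  have hc := H.cpos
  set k : ℝ := 1 - 2 * m / d with hk
  have hk0 : 0 < k := by
    rw [hk, sub_pos, div_lt_one hd]; exact hmd
  set C2 : ℝ := 32 * C / (k * d) with hC2
  have hC20 : 0 < C2 := by positivity
  set L : ℝ := 4 * C2 / (k * c) with hL
  have hL0 : 0 < L := by positivity
  set D : ℝ := C2 * L ^ ((m - 1) / 2) with hD
  have hD0 : 0 < D := mul_pos hC20 (Real.rpow_pos_of_pos hL0 _)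
  refine ⟨2 / k * (D * (|C0| + 1) * 2 ^ d), by positivity, fun R hR => ?_⟩
  have hR0 : 0 < R := by linarith
  obtain ⟨φ, hφ⟩ := hcut R hR
  have hfc := H.hf.continuous
  have hvm := (H.vr (-m)).continuous
  have hPc := H.hP.continuous
  have hφc := hφ.sm.continuous
  have hw : Continuous fun x => Real.exp (-f x) := by fun_prop
  obtain ⟨hz, hzc⟩ := H.green hφ H.hv2 (-m) 0 4 (by norm_num)
  have hF0 : ∀ x, 0 ≤ v x ^ (-m) * P x := fun x =>
    mul_nonneg (Real.rpow_nonneg (H.vpos x).le _) (H.Ppos x).le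
  have h1 := int_cut (F := fun x => v x ^ (-m) * P x) hfc (hvm.mul hPc) hF0 hφ 4
  have h2 : ∫ x in Metric.ball o (2 * R), (k / 2 * (v x ^ (-m) * P x * φ x ^ 4)) * Real.exp (-f x)
      ≤ ∫ x in Metric.ball o (2 * R), (D * R ^ (-(m + 1))) * Real.exp (-f x) := by
    refine int_le hfc (by fun_prop) continuous_const hzc o (2 * R) (fun x => ?_) hz
    have hv := H.vpos x
    have hP := H.Ppos x
    have hφ0 := hφ.nn x
    have hφ1 := hφ.le1 x
    rw [H.gdot_test hφ.sm, H.heq x]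
    simp only [Real.rpow_zero, mul_one, zero_mul]
    have hM : 0 < v x ^ (-m) := Real.rpow_pos_of_pos hv _
    have y1 := young1 hv hφ0 hφ1 hR0 hL0 hm1 hm3
    set M := v x ^ (-m) with hMdef
    have g1 : gdot v v x / v x ≤ 2 / d * P x := by
      rw [div_le_iff₀ hv]
      have := H.gv_le x
      calc gdot v v x = (d * gdot v v x) / d := by field_simp
        _ ≤ (2 * (v x * P x)) / d := by gcongr
        _ = _ := by ring
    have g2 : (4 * φ x ^ 3 * gdot v φ x) ^ 2
        ≤ 4 * ((k / 4 * (P x * φ x ^ 4)) * (C2 * (v x * φ x ^ 2 / R ^ 2))) := by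
      have a1 := gdot_sq_le v φ x
      have a2 : gdot φ φ x ≤ C / R ^ 2 := by
        rw [le_div_iff₀ (by positivity)]; exact hφ.gr x
      have a3 : gdot v v x ≤ 2 / d * P x * v x := by rwa [div_le_iff₀ hv] at g1
      have a4 : gdot v v x * gdot φ φ x ≤ (2 / d * P x * v x) * (C / R ^ 2) :=
        mul_le_mul a3 a2 (gdot_self_nonneg _ _) (by positivity)
      calc (4 * φ x ^ 3 * gdot v φ x) ^ 2 = 16 * φ x ^ 6 * gdot v φ x ^ 2 := by ring
        _ ≤ 16 * φ x ^ 6 * ((2 / d * P x * v x) * (C / R ^ 2)) := by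
          gcongr; exact a1.trans a4
        _ = _ := by rw [hC2]; field_simp; ring
    have g3 := abs_le_of_sq (by positivity) (by positivity) g2
    have g4 := neg_abs_le (4 * φ x ^ 3 * gdot v φ x)
    have g5 : M / v x ≤ M * P x / c := by
      rw [div_le_div_iff₀ hv hc]
      have := H.hvP x
      have h0 : 0 ≤ (d:ℝ) / 2 * gdot v v x := mul_nonneg (by positivity) (gdot_self_nonneg _ _)
      nlinarith
    have g6 : C2 * (L⁻¹ * (M / v x * φ x ^ 4)) ≤ k / 4 * (M * P x * φ x ^ 4) := by
      calc C2 * (L⁻¹ * (M / v x * φ x ^ 4)) ≤ C2 * (L⁻¹ * (M * P x / c * φ x ^ 4)) := by gcongr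
        _ = _ := by rw [hL]; field_simp
    have g7 : C2 * (M * v x * φ x ^ 2 / R ^ 2)
        ≤ k / 4 * (M * P x * φ x ^ 4) + D * R ^ (-(m + 1)) := by
      have := mul_le_mul_of_nonneg_left y1 hC20.le
      rw [mul_add] at this
      have e : C2 * (L ^ ((m - 1) / 2) * R ^ (-(m + 1))) = D * R ^ (-(m + 1)) := by rw [hD]; ring
      linarith
    have g8 : m * (M * φ x ^ 4 * (gdot v v x / v x)) ≤ (1 - k) * (M * P x * φ x ^ 4) := by
      calc _ ≤ m * (M * φ x ^ 4 * (2 / d * P x)) := by gcongr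
        _ = _ := by rw [hk]; ring
    have g9 : M * |4 * φ x ^ 3 * gdot v φ x|
        ≤ k / 4 * (M * P x * φ x ^ 4) + C2 * (M * v x * φ x ^ 2 / R ^ 2) := by
      have := mul_le_mul_of_nonneg_left g3 hM.le
      calc _ ≤ _ := this
        _ = _ := by ring
    have g10 : M * (4 * φ x ^ 3 * gdot v φ x) ≥ - (M * |4 * φ x ^ 3 * gdot v φ x|) := by
      have := mul_le_mul_of_nonneg_left g4 hM.le
      linarith
    have hh : k / 2 * (M * P x * φ x ^ 4) ≤ D * R ^ (-(m + 1)) + (M * P x * φ x ^ 4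
        - m * (M * φ x ^ 4 * (gdot v v x / v x)) + M * (4 * φ x ^ 3 * gdot v φ x)) := by
      linarith
    refine hh.trans (le_of_eq ?_)
    norm_num
    ring
  have e1 : ∫ x in Metric.ball o (2 * R), (k / 2 * (v x ^ (-m) * P x * φ x ^ 4)) * Real.exp (-f x)
      = k / 2 * ∫ x in Metric.ball o (2 * R), (v x ^ (-m) * P x * φ x ^ 4) * Real.exp (-f x) := by
    rw [← integral_const_mul]
    congr 1; funext x; ring
  rw [e1, integral_const_mul] at h2
  have h3 := hvol (2 * R) (by linarith)
  have h4 : D * R ^ (-(m + 1)) * ∫ x in Metric.ball o (2 * R), Real.exp (-f x)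
      ≤ (D * (|C0| + 1) * 2 ^ d) * R ^ ((d:ℝ) - m - 1) := by
    have hr : R ^ (-(m + 1)) * R ^ d = R ^ ((d:ℝ) - m - 1) := by
      rw [← Real.rpow_natCast R d, ← Real.rpow_add hR0]; congr 1; ring
    have hrp : 0 < R ^ (-(m + 1)) := Real.rpow_pos_of_pos hR0 _
    calc _ ≤ D * R ^ (-(m + 1)) * ((|C0| + 1) * (2 * R) ^ d) := by
          gcongr
          refine h3.trans ?_
          gcongr
          linarith [le_abs_self C0]
      _ = (D * (|C0| + 1) * 2 ^ d) * (R ^ (-(m + 1)) * R ^ d) := by rw [mul_pow]; ring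
      _ = _ := by rw [hr]
  calc _ ≤ _ := h1
    _ = 2 / k * (k / 2 * ∫ x in Metric.ball o (2 * R),
        (v x ^ (-m) * P x * φ x ^ 4) * Real.exp (-f x)) := by field_simp
    _ ≤ 2 / k * ((D * (|C0| + 1) * 2 ^ d) * R ^ ((d:ℝ) - m - 1)) := by
        exact mul_le_mul_of_nonneg_left (h2.trans h4) (by positivity)
    _ = _ := by ring

end
end LaneEmden

namespace LaneEmden

variable {d : ℕ}
section
variable {f v P : EuclideanSpace ℝ (Fin d) → ℝ} {c : ℝ}

theorem VP.key (H : VP f v P c) {s : ℝ} (hs1 : -(1/2) < s) (hs0 : s ≤ 0)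
    {o : EuclideanSpace ℝ (Fin d)} {C R : ℝ} {φ : EuclideanSpace ℝ (Fin d) → ℝ}
    (hφ : Cut o C R φ) :
    ∫ x in Metric.ball o (2 * R),
        (v x ^ (1 - (d:ℝ)) * P x ^ s * QQ f v P x * φ x ^ 6) * Real.exp (-f x)
      ≤ 72 * C / (1 + 2 * s) ^ 2 / R ^ 2 * ∫ x in Metric.ball o (2 * R),
        (v x ^ (2 - (d:ℝ)) * P x ^ (s + 1) * φ x ^ 4) * Real.exp (-f x) := by
  have hR0 : 0 < R := by linarith [hφ.hR]
  have hC := hφ.hC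
  set k : ℝ := 1 + 2 * s with hk
  have hk0 : 0 < k := by rw [hk]; linarith
  have hfc := H.hf.continuous
  have hv1 := (H.vr (1 - (d:ℝ))).continuous
  have hv2 := (H.vr (2 - (d:ℝ))).continuous
  have hPs := (H.Pr s).continuous
  have hPs1 := (H.Pr (s + 1)).continuous
  have hφc := hφ.sm.continuous
  have hQ := H.Q_cont
  obtain ⟨hz, hzc⟩ := H.green hφ H.hP (2 - (d:ℝ)) s 6 (by norm_num)
  have h2 : ∫ x in Metric.ball o (2 * R),
        (k / 2 * (v x ^ (1 - (d:ℝ)) * P x ^ s * QQ f v P x * φ x ^ 6)) * Real.exp (-f x)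
      ≤ ∫ x in Metric.ball o (2 * R), (36 * C / k / R ^ 2 *
        (v x ^ (2 - (d:ℝ)) * P x ^ (s + 1) * φ x ^ 4)) * Real.exp (-f x) := by
    refine int_le hfc (by fun_prop) (by fun_prop) hzc o (2 * R) (fun x => ?_) hz
    have hv := H.vpos x
    have hP := H.Ppos x
    have hφ0 := hφ.nn x
    have hQ0 := H.Q_nonneg x
    rw [H.gdot_test hφ.sm]
    have ev : v x ^ (2 - (d:ℝ)) = v x ^ (1 - (d:ℝ)) * v x := by
      rw [← Real.rpow_add_one hv.ne']; congr 1; ring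
    have eP : P x ^ (s + 1) = P x ^ s * P x := Real.rpow_add_one hP.ne' _
    rw [ev, eP]
    have hb := H.bochner x
    have hV : 0 < v x ^ (1 - (d:ℝ)) := Real.rpow_pos_of_pos hv _
    have hPs : 0 < P x ^ s := Real.rpow_pos_of_pos hP _
    set V := v x ^ (1 - (d:ℝ))
    set Ps := P x ^ s
    set Q := QQ f v P x
    have g1 := H.gP_le x
    have hgc := gdot_comm P v x
    have g2 : (6 * (v x * φ x ^ 5 * gdot P φ x)) ^ 2
        ≤ 4 * ((k / 2 * (φ x ^ 6 * Q)) * (36 * C / k / R ^ 2 * (v x * P x * φ x ^ 4))) := by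
      have a1 := gdot_sq_le P φ x
      have a2 : gdot φ φ x ≤ C / R ^ 2 := by
        rw [le_div_iff₀ (by positivity)]; exact hφ.gr x
      have a4 : v x * gdot P P x * gdot φ φ x ≤ (2 * (P x * Q)) * (C / R ^ 2) :=
        mul_le_mul g1 a2 (gdot_self_nonneg _ _) (by positivity)
      calc (6 * (v x * φ x ^ 5 * gdot P φ x)) ^ 2
          = 36 * φ x ^ 10 * v x ^ 2 * gdot P φ x ^ 2 := by ring
        _ ≤ 36 * φ x ^ 10 * v x ^ 2 * (gdot P P x * gdot φ φ x) := by gcongr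
        _ = 36 * φ x ^ 10 * v x * (v x * gdot P P x * gdot φ φ x) := by ring
        _ ≤ 36 * φ x ^ 10 * v x * ((2 * (P x * Q)) * (C / R ^ 2)) := by gcongr
        _ = _ := by field_simp; ring
    have g3 := abs_le_of_sq (by positivity) (by positivity) g2
    have g4 := neg_abs_le (6 * (v x * φ x ^ 5 * gdot P φ x))
    have g5 : -s * (φ x ^ 6 * (v x * gdot P P x / P x)) ≤ (1 - k) * (φ x ^ 6 * Q) := by
      have : v x * gdot P P x / P x ≤ 2 * Q := by
        rw [div_le_iff₀ hP]; linarith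
      have hs : 0 ≤ -s := by linarith
      calc _ ≤ -s * (φ x ^ 6 * (2 * Q)) := by gcongr
        _ = _ := by rw [hk]; ring
    have g6 : k / 2 * (φ x ^ 6 * Q) ≤ 36 * C / k / R ^ 2 * (v x * P x * φ x ^ 4)
      + (φ x ^ 6 * Q + s * (φ x ^ 6 * (v x * gdot P P x / P x))
        + 6 * (v x * φ x ^ 5 * gdot P φ x)) := by linarith
    have g7 := mul_le_mul_of_nonneg_left g6 (mul_pos hV hPs).le
    calc _ = V * Ps * (k / 2 * (φ x ^ 6 * Q)) := by ring
      _ ≤ _ := g7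
      _ = _ := by
        have e : V * v x * Ps * φ x ^ 6 * (lap P x - gdot f P x)
          = V * Ps * φ x ^ 6 * ((d - 2) * gdot v P x + Q) := by rw [← hb]; ring
        rw [e, hgc]
        norm_num
        field_simp
        ring
  simp only [mul_assoc (k / 2), mul_assoc (36 * C / k / R ^ 2), integral_const_mul] at h2
  calc _ = 2 / k * (k / 2 * ∫ x in Metric.ball o (2 * R),
        (v x ^ (1 - (d:ℝ)) * P x ^ s * QQ f v P x * φ x ^ 6) * Real.exp (-f x)) := by field_simp
    _ ≤ 2 / k * _ := mul_le_mul_of_nonneg_left h2 (by positivity)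
    _ = _ := by rw [← mul_assoc]; congr 1; field_simp; norm_num

/-- vP ≥ c, negative powers. -/
theorem VP.vP_rpow (H : VP f v P c) (x) {t : ℝ} (ht : 0 ≤ t) :
    v x ^ (-t) * P x ^ (-t) ≤ c ^ (-t) := by
  rw [← Real.mul_rpow (H.vpos x).le (H.Ppos x).le]
  refine Real.rpow_le_rpow_of_nonpos H.cpos ?_ (by linarith)
  rw [H.hvP x]
  have : 0 ≤ (d:ℝ) / 2 * gdot v v x := mul_nonneg (by positivity) (gdot_self_nonneg _ _)
  linarith

/-- Abstract conclusion: decay implies `Q = 0`. -/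
theorem VP.conclude (H : VP f v P c) {s γ K : ℝ} (hs1 : -(1/2) < s) (hs0 : s ≤ 0) (hγ : 0 < γ)
    {o : EuclideanSpace ℝ (Fin d)} {C : ℝ}
    (hA : ∀ R : ℝ, 1 ≤ R → ∃ φ, Cut o C R φ ∧ 
      ∫ x in Metric.ball o (2 * R),
        (v x ^ (2 - (d:ℝ)) * P x ^ (s + 1) * φ x ^ 4) * Real.exp (-f x) ≤ K * R ^ (2 - γ)) 
    (x : EuclideanSpace ℝ (Fin d)) : QQ f v P x = 0 := by
  set F : EuclideanSpace ℝ (Fin d) → ℝ := fun x => v x ^ (1 - (d:ℝ)) * P x ^ s * QQ f v P x with hF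
  have hv1 := (H.vr (1 - (d:ℝ))).continuous
  have hPs := (H.Pr s).continuous
  have hQ := H.Q_cont
  have hFc : Continuous F := by rw [hF]; fun_prop
  have hfc := H.hf.continuous
  have hF0 : ∀ x, 0 ≤ F x := fun x => mul_nonneg (mul_nonneg (Real.rpow_nonneg (H.vpos x).le _)
    (Real.rpow_nonneg (H.Ppos x).le _)) (H.Q_nonneg x)
  have hcF : Continuous fun x => F x * Real.exp (-f x) := by fun_prop
  have hb : ∀ R : ℝ, 1 ≤ R → ∫ x in Metric.ball o R, F x * Real.exp (-f x)
      ≤ 72 * C / (1 + 2 * s) ^ 2 * K * R ^ (-γ) := by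
    intro R hR
    obtain ⟨φ, hφ, hle⟩ := hA R hR
    have hR0 : 0 < R := by linarith
    have hC := hφ.hC
    refine (int_cut hfc hFc hF0 hφ 6).trans ((H.key hs1 hs0 hφ).trans ?_)
    refine (mul_le_mul_of_nonneg_left hle (by positivity)).trans (le_of_eq ?_)
    have : R ^ (2 - γ) = R ^ 2 * R ^ (-γ) := by
      rw [← Real.rpow_natCast R 2, ← Real.rpow_add hR0]; congr 1
    rw [this]; field_simp
  have hzero : ∀ R0 : ℝ, ∫ x in Metric.ball o R0, F x * Real.exp (-f x) = 0 := by
    intro R0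
    apply le_antisymm
    · have ht : Tendsto (fun R : ℝ => 72 * C / (1 + 2 * s) ^ 2 * K * R ^ (-γ)) atTop (nhds 0) := by
        simpa using (tendsto_rpow_neg_atTop hγ).const_mul (72 * C / (1 + 2 * s) ^ 2 * K)
      refine ge_of_tendsto ht ?_
      filter_upwards [eventually_ge_atTop (max R0 1)] with R hR
      exact (int_mono_ball hfc hFc hF0 o ((le_max_left _ _).trans hR)).trans
        (hb R ((le_max_right _ _).trans hR))
    · exact integral_nonneg fun x => mul_nonneg (hF0 x) (Real.exp_pos _).le
  have hx := hzero (dist x o + 1)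
  rw [setIntegral_eq_zero_iff_of_nonneg_ae
    (Eventually.of_forall fun x => mul_nonneg (hF0 x) (Real.exp_pos _).le)
    (intOn hcF o _)] at hx
  have hopen : IsOpen (Metric.ball o (dist x o + 1)) := Metric.isOpen_ball
  have h0 := Measure.eqOn_open_of_ae_eq hx hopen hcF.continuousOn continuousOn_const
  have h1 := h0 (show x ∈ Metric.ball o (dist x o + 1) by simp)
  have hv := Real.rpow_pos_of_pos (H.vpos x) (1 - (d:ℝ))
  have hP := Real.rpow_pos_of_pos (H.Ppos x) s
  simpa [hF, hv.ne', hP.ne'] using h1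

end
end LaneEmden

namespace LaneEmden

variable {d : ℕ}
section
variable {f v P : EuclideanSpace ℝ (Fin d) → ℝ} {c : ℝ}

theorem VP.A34 (H : VP f v P c) {o : EuclideanSpace ℝ (Fin d)} {C0 : ℝ}
    (hvol : ∀ R : ℝ, 1 ≤ R → (∫ x in Metric.ball o R, Real.exp (-f x)) ≤ C0 * R ^ d)
    {s : ℝ} (hs0 : s ≤ 0) (hm1 : 1 ≤ (d:ℝ) - 2 + s) (hm3 : (d:ℝ) - 2 + s ≤ 3)
    (hmd : 2 * ((d:ℝ) - 2 + s) < d) :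
    ∃ C K : ℝ, ∀ R : ℝ, 1 ≤ R → ∃ φ, Cut o C R φ ∧
      ∫ x in Metric.ball o (2 * R),
        (v x ^ (2 - (d:ℝ)) * P x ^ (s + 1) * φ x ^ 4) * Real.exp (-f x)
          ≤ K * R ^ (2 - (1 + s)) := by
  obtain ⟨C, hC, hcut⟩ := exists_cut o
  obtain ⟨K, hK, hb⟩ := H.basic hvol hm1 hm3 hmd
  have hc := H.cpos
  refine ⟨C, c ^ s * K * 2 ^ (2 - (1 + s)), fun R hR => ?_⟩
  obtain ⟨φ, hφ⟩ := hcut R hR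
  refine ⟨φ, hφ, ?_⟩
  have hR0 : 0 < R := by linarith
  have hfc := H.hf.continuous
  have hPc := H.hP.continuous
  have hv2 := (H.vr (2 - (d:ℝ))).continuous
  have hvm := (H.vr (-((d:ℝ) - 2 + s))).continuous
  have hPs1 := (H.Pr (s + 1)).continuous
  have hφc := hφ.sm.continuous
  have hcs : 0 < c ^ s := Real.rpow_pos_of_pos hc _
  have h1 : ∫ x in Metric.ball o (2 * R),
        (v x ^ (2 - (d:ℝ)) * P x ^ (s + 1) * φ x ^ 4) * Real.exp (-f x)
      ≤ ∫ x in Metric.ball o (2 * R),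
        (c ^ s * (v x ^ (-((d:ℝ) - 2 + s)) * P x)) * Real.exp (-f x) := by
    refine int_le' hfc (by fun_prop) (by fun_prop) o (2 * R) fun x => ?_
    have hv := H.vpos x
    have hP := H.Ppos x
    have e1 := H.vP_rpow x (t := -s) (by linarith)
    rw [neg_neg] at e1
    have e2 : v x ^ (2 - (d:ℝ)) = v x ^ (-((d:ℝ) - 2 + s)) * v x ^ s := by
      rw [← Real.rpow_add hv]; congr 1; ring
    have e3 : P x ^ (s + 1) = P x ^ s * P x := Real.rpow_add_one hP.ne' _
    have hV := Real.rpow_pos_of_pos hv (-((d:ℝ) - 2 + s))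
    have hVs := Real.rpow_pos_of_pos hv s
    have hPs := Real.rpow_pos_of_pos hP s
    have hφ4 : φ x ^ 4 ≤ 1 := pow_le_one₀ (hφ.nn x) (hφ.le1 x)
    rw [e2, e3]
    calc _ ≤ v x ^ (-((d:ℝ) - 2 + s)) * v x ^ s * (P x ^ s * P x) * 1 := by gcongr
      _ = (v x ^ s * P x ^ s) * (v x ^ (-((d:ℝ) - 2 + s)) * P x) := by ring
      _ ≤ _ := by gcongr
  refine h1.trans ?_
  simp only [mul_assoc (c ^ s), integral_const_mul]
  have h2 := hb (2 * R) (by linarith)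
  rw [show (d:ℝ) - ((d:ℝ) - 2 + s) - 1 = 2 - (1 + s) by ring,
    Real.mul_rpow (by norm_num) hR0.le] at h2
  calc _ ≤ c ^ s * _ := mul_le_mul_of_nonneg_left h2 hcs.le
    _ = _ := by ring

theorem rpow45 {v P R : ℝ} (hv : 0 < v) (hP : 0 < P) (hR : 0 < R) :
    v ^ (-(4/5) : ℝ) * P ^ (4/5 : ℝ) ≤ R ^ (-(8/5) : ℝ) * (R ^ 2 * (v ^ (-1:ℝ) * P) + 1) := by
  have key : ∀ z : ℝ, 0 < z → z ^ (4/5 : ℝ) ≤ z + 1 := by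
    intro z hz
    rcases le_total z 1 with h | h
    · have := Real.rpow_le_one hz.le h (show (0:ℝ) ≤ 4/5 by norm_num); linarith
    · have := Real.rpow_le_rpow_of_exponent_le h (show (4/5:ℝ) ≤ 1 by norm_num)
      rw [Real.rpow_one] at this; linarith
  have hvi : 0 < v ^ (-1:ℝ) := Real.rpow_pos_of_pos hv _
  have h := key (R ^ 2 * (v ^ (-1:ℝ) * P)) (by positivity)
  have e : (R ^ 2 * (v ^ (-1:ℝ) * P)) ^ (4/5:ℝ)
      = R ^ (8/5:ℝ) * (v ^ (-(4/5) : ℝ) * P ^ (4/5 : ℝ)) := by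
    rw [Real.mul_rpow (by positivity) (by positivity), Real.mul_rpow hvi.le hP.le,
      ← Real.rpow_natCast R 2, ← Real.rpow_mul hR.le, ← Real.rpow_mul hv.le]
    norm_num
  rw [e] at h
  have hR8 := Real.rpow_pos_of_pos hR (8/5)
  rw [Real.rpow_neg hR.le (8/5), inv_mul_eq_div, le_div_iff₀ hR8]
  linarith

set_option maxHeartbeats 1000000 in
theorem VP.A5 (H : VP f v P c) {o : EuclideanSpace ℝ (Fin d)} {C0 : ℝ}
    (hvol : ∀ R : ℝ, 1 ≤ R → (∫ x in Metric.ball o R, Real.exp (-f x)) ≤ C0 * R ^ d)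
    (hd : d = 5) :
    ∃ C K : ℝ, ∀ R : ℝ, 1 ≤ R → ∃ φ, Cut o C R φ ∧
      ∫ x in Metric.ball o (2 * R),
        (v x ^ (2 - (d:ℝ)) * P x ^ ((-(2/5):ℝ) + 1) * φ x ^ 4) * Real.exp (-f x)
          ≤ K * R ^ (2 - (3/5) : ℝ) := by
  obtain ⟨C, hC, hcut⟩ := exists_cut o
  have hdr : (d:ℝ) = 5 := by rw [hd]; norm_num
  obtain ⟨K, hK, hb⟩ := H.basic hvol (m := 1) le_rfl (by norm_num) (by rw [hdr]; norm_num)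
  have hc := H.cpos
  set q : ℝ := c ^ (-(3/5) : ℝ) with hq
  have hq0 : 0 < q := Real.rpow_pos_of_pos hc _
  set τ : ℝ := 1 / (180000 * C * q) with hτ
  have hτ0 : 0 < τ := by positivity
  set B : ℝ := 1 / (125 * τ) + 160 * C * q with hB
  have hB0 : 0 < B := by positivity
  refine ⟨C, q * (50 * B * (8 * K + 32 * C0)), fun R hR => ?_⟩
  obtain ⟨φ, hφ⟩ := hcut R hR
  refine ⟨φ, hφ, ?_⟩
  have hR0 : 0 < R := by linarith
  have hfc := H.hf.continuous
  have hPc := H.hP.continuous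
  have hv1 := (H.vr (1 - (d:ℝ))).continuous
  have hv2 := (H.vr (2 - (d:ℝ))).continuous
  have hvM := (H.vr (-(12/5))).continuous
  have hvi := (H.vr (-1)).continuous
  have hPM := (H.Pr (1/5)).continuous
  have hPs := (H.Pr (-(2/5))).continuous
  have hPs1 := (H.Pr (-(2/5) + 1)).continuous
  have hφc := hφ.sm.continuous
  have hQ := H.Q_cont
  have hw : Continuous fun x => Real.exp (-f x) := by fun_prop
  set I : ℝ := ∫ x in Metric.ball o (2 * R),
        (v x ^ (-(12/5):ℝ) * P x ^ (1/5:ℝ) * P x * φ x ^ 4) * Real.exp (-f x) with hI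
  have hAI : ∫ x in Metric.ball o (2 * R),
        (v x ^ (2 - (d:ℝ)) * P x ^ ((-(2/5):ℝ) + 1) * φ x ^ 4) * Real.exp (-f x) ≤ q * I := by
    have : ∫ x in Metric.ball o (2 * R),
        (v x ^ (2 - (d:ℝ)) * P x ^ ((-(2/5):ℝ) + 1) * φ x ^ 4) * Real.exp (-f x)
        ≤ ∫ x in Metric.ball o (2 * R),
        (q * (v x ^ (-(12/5):ℝ) * P x ^ (1/5:ℝ) * P x * φ x ^ 4)) * Real.exp (-f x) := by
      refine int_le' hfc (by fun_prop) (by fun_prop) o (2 * R) fun x => ?_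
      have hv := H.vpos x
      have hP := H.Ppos x
      have e1 := H.vP_rpow x (t := 3/5) (by norm_num)
      have e2 : v x ^ (2 - (d:ℝ)) = v x ^ (-(12/5):ℝ) * v x ^ (-(3/5):ℝ) := by
        rw [← Real.rpow_add hv, hdr]; norm_num
      have e3 : P x ^ ((-(2/5):ℝ) + 1) = P x ^ (-(3/5):ℝ) * P x ^ (1/5:ℝ) * P x := by
        rw [← Real.rpow_add hP, ← Real.rpow_add_one hP.ne']; norm_num
      have h1 := Real.rpow_pos_of_pos hv (-(12/5))
      have h2 := Real.rpow_pos_of_pos hP (1/5)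
      have h3 := hφ.nn x
      rw [e2, e3]
      calc _ = (v x ^ (-(3/5):ℝ) * P x ^ (-(3/5):ℝ)) * 
            (v x ^ (-(12/5):ℝ) * P x ^ (1/5:ℝ) * P x * φ x ^ 4) := by ring
        _ ≤ _ := by gcongr
    simpa only [mul_assoc q, integral_const_mul] using this
  have hkey := H.key (s := -(2/5)) (by norm_num) (by norm_num) hφ
  obtain ⟨hz, hzc⟩ := H.green hφ H.hv2 (-(12/5)) (1/5) 4 (by norm_num)
  set J : ℝ := ∫ x in Metric.ball o (2 * R),
        (v x ^ (1 - (d:ℝ)) * P x ^ (-(2/5):ℝ) * QQ f v P x * φ x ^ 6) * Real.exp (-f x) with hJ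
  set T : ℝ := R ^ (-(8/5):ℝ) with hT
  have hT0 : 0 < T := Real.rpow_pos_of_pos hR0 _
  have h2 : ∫ x in Metric.ball o (2 * R),
        (3/100 * (v x ^ (-(12/5):ℝ) * P x ^ (1/5:ℝ) * P x * φ x ^ 4)) * Real.exp (-f x)
      ≤ ∫ x in Metric.ball o (2 * R), (τ * R ^ 2 *
        (v x ^ (1 - (d:ℝ)) * P x ^ (-(2/5):ℝ) * QQ f v P x * φ x ^ 6)
        + B / R ^ 2 * (T * (R ^ 2 * (v x ^ (-1:ℝ) * P x) + 1))) * Real.exp (-f x) := by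
    refine int_le hfc (by fun_prop) (by fun_prop) hzc o (2 * R) (fun x => ?_) hz
    have hv := H.vpos x
    have hP := H.Ppos x
    have hφ0 := hφ.nn x
    have hφ1 := hφ.le1 x
    have hQ0 := H.Q_nonneg x
    have hG := rpow45 hv hP hR0
    rw [← hT] at hG
    rw [H.gdot_test hφ.sm, H.heq x, hdr]
    have hG0 : 0 < v x ^ (-(4/5) : ℝ) * P x ^ (4/5 : ℝ) :=
      mul_pos (Real.rpow_pos_of_pos hv _) (Real.rpow_pos_of_pos hP _)
    have hM0 : 0 < v x ^ (-(12/5) : ℝ) * P x ^ (1/5 : ℝ) :=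
      mul_pos (Real.rpow_pos_of_pos hv _) (Real.rpow_pos_of_pos hP _)
    have hN0 : 0 < v x ^ (1 - 5 : ℝ) * P x ^ (-(2/5) : ℝ) :=
      mul_pos (Real.rpow_pos_of_pos hv _) (Real.rpow_pos_of_pos hP _)
    have eMM : (v x ^ (-(12/5) : ℝ) * P x ^ (1/5 : ℝ)) ^ 2
        = (v x ^ (1 - 5 : ℝ) * P x ^ (-(2/5) : ℝ)) * (v x ^ (-(4/5) : ℝ) * P x ^ (4/5 : ℝ)) := by
      have a : (v x ^ (-(12/5) : ℝ)) ^ 2 = v x ^ (1 - 5 : ℝ) * v x ^ (-(4/5) : ℝ) := by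
        rw [sq, ← Real.rpow_add hv, ← Real.rpow_add hv]; norm_num
      have b : (P x ^ (1/5 : ℝ)) ^ 2 = P x ^ (-(2/5) : ℝ) * P x ^ (4/5 : ℝ) := by
        rw [sq, ← Real.rpow_add hP, ← Real.rpow_add hP]; norm_num
      rw [mul_pow, a, b]; ring
    have eMv : (v x ^ (-(12/5) : ℝ) * P x ^ (1/5 : ℝ)) * v x
        ≤ q * (v x ^ (-(4/5) : ℝ) * P x ^ (4/5 : ℝ)) := by
      have e1 := H.vP_rpow x (t := 3/5) (by norm_num)
      have a : v x ^ (-(12/5) : ℝ) * v x = v x ^ (-(3/5) : ℝ) * v x ^ (-(4/5) : ℝ) := by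
        rw [← Real.rpow_add_one hv.ne', ← Real.rpow_add hv]; norm_num
      have b : P x ^ (1/5 : ℝ) = P x ^ (-(3/5) : ℝ) * P x ^ (4/5 : ℝ) := by
        rw [← Real.rpow_add hP]; norm_num
      calc _ = (v x ^ (-(12/5) : ℝ) * v x) * P x ^ (1/5 : ℝ) := by ring
        _ = (v x ^ (-(3/5):ℝ) * P x ^ (-(3/5):ℝ)) *
            (v x ^ (-(4/5) : ℝ) * P x ^ (4/5 : ℝ)) := by rw [a, b]; ring
        _ ≤ _ := by gcongr
    have rw1 : ∀ y z w : ℝ, (-(12/5)) * (v x ^ (-(12/5) : ℝ) / v x) * P x ^ (1/5 : ℝ) * y * z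
       = -(12/5) * ((v x ^ (-(12/5) : ℝ) * P x ^ (1/5 : ℝ)) * y * (z / v x)) := by
      intros; ring
    have rw2 : ∀ y z : ℝ, 1/5 * v x ^ (-(12/5) : ℝ) * (P x ^ (1/5 : ℝ) / P x) * y * z
       = 1/5 * ((v x ^ (-(12/5) : ℝ) * P x ^ (1/5 : ℝ)) * y * (z / P x)) := by
      intros; ring
    have rw3 : ∀ y z w : ℝ, y * v x ^ (-(12/5) : ℝ) * P x ^ (1/5 : ℝ) * z * w
       = (v x ^ (-(12/5) : ℝ) * P x ^ (1/5 : ℝ)) * (y * z * w) := by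
      intros; ring
    rw [rw1 _ _ 0, rw2, rw3]
    set M := v x ^ (-(12/5) : ℝ) * P x ^ (1/5 : ℝ)
    set N := v x ^ (1 - 5 : ℝ) * P x ^ (-(2/5) : ℝ)
    set G := v x ^ (-(4/5) : ℝ) * P x ^ (4/5 : ℝ)
    set Q := QQ f v P x
    have gv := H.gv_le x
    rw [hdr] at gv
    have g0 : gdot v v x ≤ 2/5 * (v x * P x) := by linarith
    have g1 : gdot v v x / v x ≤ 2/5 * P x := by
      rw [div_le_iff₀ hv]; linarith
    have gP := H.gP_le x
    -- first cross term
    have s1 : (gdot v P x) ^ 2 ≤ 4/5 * P x ^ 2 * Q := by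
      have a1 := gdot_sq_le v P x
      have a2 : v x * (gdot v v x * gdot P P x) ≤ v x * (4/5 * P x ^ 2 * Q) := by
        calc _ = gdot v v x * (v x * gdot P P x) := by ring
          _ ≤ (2/5 * (v x * P x)) * (2 * (P x * Q)) :=
            mul_le_mul g0 gP (mul_nonneg hv.le (gdot_self_nonneg _ _)) (by positivity)
          _ = _ := by ring
      exact a1.trans (le_of_mul_le_mul_left a2 hv)
    have s2 : (1/5 * (M * φ x ^ 4 * (gdot v P x / P x))) ^ 2
        ≤ 4 * ((τ * R ^ 2 * (N * Q * φ x ^ 6)) * (1 / (125 * τ) / R ^ 2 * (G * φ x ^ 2))) := by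
      calc _ = 1/25 * M ^ 2 * φ x ^ 8 * (gdot v P x ^ 2 / P x ^ 2) := by ring
        _ ≤ 1/25 * M ^ 2 * φ x ^ 8 * ((4/5 * P x ^ 2 * Q) / P x ^ 2) := by gcongr
        _ = _ := by rw [eMM]; field_simp; ring
    have s3 := abs_le_of_sq (by positivity) (by positivity) s2
    have s4 := neg_abs_le (1/5 * (M * φ x ^ 4 * (gdot v P x / P x)))
    -- second cross term
    have t2 : (M * (4 * φ x ^ 3 * gdot v φ x)) ^ 2
        ≤ 4 * ((1/100 * (M * P x * φ x ^ 4)) * (160 * C / R ^ 2 * ((M * v x) * φ x ^ 2))) := by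
      have a1 := gdot_sq_le v φ x
      have a2 : gdot φ φ x ≤ C / R ^ 2 := by
        rw [le_div_iff₀ (by positivity)]; exact hφ.gr x
      have a4 : gdot v v x * gdot φ φ x ≤ (2/5 * (v x * P x)) * (C / R ^ 2) :=
        mul_le_mul g0 a2 (gdot_self_nonneg _ _) (by positivity)
      calc _ = 16 * M ^ 2 * φ x ^ 6 * gdot v φ x ^ 2 := by ring
        _ ≤ 16 * M ^ 2 * φ x ^ 6 * ((2/5 * (v x * P x)) * (C / R ^ 2)) := by
          gcongr; exact a1.trans a4
        _ = _ := by ring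
    have t3 := abs_le_of_sq (by positivity) (by positivity) t2
    have t4 := neg_abs_le (M * (4 * φ x ^ 3 * gdot v φ x))
    have t5 : 160 * C / R ^ 2 * ((M * v x) * φ x ^ 2)
        ≤ 160 * C / R ^ 2 * ((q * G) * φ x ^ 2) := by gcongr
    have u1 : 12/5 * (M * φ x ^ 4 * (gdot v v x / v x)) ≤ 24/25 * (M * P x * φ x ^ 4) := by
      calc _ ≤ 12/5 * (M * φ x ^ 4 * (2/5 * P x)) := by gcongr
        _ = _ := by ring
    have u2 : B / R ^ 2 * (G * φ x ^ 2)
        ≤ B / R ^ 2 * (T * (R ^ 2 * (v x ^ (-1:ℝ) * P x) + 1)) := by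
      have : φ x ^ 2 ≤ 1 := pow_le_one₀ hφ0 hφ1
      refine mul_le_mul_of_nonneg_left ?_ (by positivity)
      calc G * φ x ^ 2 ≤ G * 1 := by gcongr
        _ ≤ _ := by rw [mul_one]; exact hG
    have u3 : 1 / (125 * τ) / R ^ 2 * (G * φ x ^ 2) + 160 * C / R ^ 2 * ((q * G) * φ x ^ 2)
        = B / R ^ 2 * (G * φ x ^ 2) := by rw [hB]; ring
    have fin : 3/100 * (M * P x * φ x ^ 4) ≤ τ * R ^ 2 * (N * Q * φ x ^ 6)
        + B / R ^ 2 * (T * (R ^ 2 * (v x ^ (-1:ℝ) * P x) + 1))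
        + (M * P x * φ x ^ 4 - 12/5 * (M * φ x ^ 4 * (gdot v v x / v x))
          + 1/5 * (M * φ x ^ 4 * (gdot v P x / P x)) + M * (4 * φ x ^ 3 * gdot v φ x)) := by
      linarith
    refine fin.trans (le_of_eq ?_)
    norm_num
    ring
  have e1 : ∫ x in Metric.ball o (2 * R), (τ * R ^ 2 *
        (v x ^ (1 - (d:ℝ)) * P x ^ (-(2/5):ℝ) * QQ f v P x * φ x ^ 6)
        + B / R ^ 2 * (T * (R ^ 2 * (v x ^ (-1:ℝ) * P x) + 1))) * Real.exp (-f x)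
      = τ * R ^ 2 * J + (B * T * (∫ x in Metric.ball o (2 * R),
        (v x ^ (-1:ℝ) * P x) * Real.exp (-f x)) 
        + B * T / R ^ 2 * ∫ x in Metric.ball o (2 * R), Real.exp (-f x)) := by
    rw [hJ, ← integral_const_mul, ← integral_const_mul, ← integral_const_mul,
      ← integral_add (intOn (by fun_prop) _ _) (intOn (by fun_prop) _ _),
      ← integral_add (intOn (by fun_prop) _ _) (intOn (by fun_prop) _ _)]
    congr 1; funext x; field_simp
  rw [e1] at h2
  simp only [mul_assoc (3/100 : ℝ), integral_const_mul] at h2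
  have h3 : τ * R ^ 2 * J ≤ 1/100 * I := by
    calc τ * R ^ 2 * J ≤ τ * R ^ 2 * (72 * C / (1 + 2 * (-(2/5))) ^ 2 / R ^ 2 * (q * I)) := by
          gcongr
          refine hkey.trans ?_
          gcongr
      _ = _ := by rw [hτ]; field_simp; norm_num; ring
  have h4 := hb (2 * R) (by linarith)
  have h5 := hvol (2 * R) (by linarith)
  rw [hdr, show (5:ℝ) - 1 - 1 = ((3:ℕ):ℝ) by norm_num, Real.rpow_natCast] at h4
  rw [show (2 * R) ^ d = (2 * R) ^ 5 by rw [hd]] at h5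
  have hTR : T * R ^ 3 = R ^ (2 - 3/5 : ℝ) := by
    rw [hT, ← Real.rpow_natCast R 3, ← Real.rpow_add hR0]; norm_num
  have h6 : B * T * (∫ x in Metric.ball o (2 * R), (v x ^ (-1:ℝ) * P x) * Real.exp (-f x)) 
        + B * T / R ^ 2 * (∫ x in Metric.ball o (2 * R), Real.exp (-f x))
      ≤ B * (8 * K + 32 * C0) * R ^ (2 - 3/5 : ℝ) := by
    rw [← hTR]
    calc _ ≤ B * T * (K * (2 * R) ^ 3) + B * T / R ^ 2 * (C0 * (2 * R) ^ 5) := by gcongr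
      _ = _ := by field_simp; ring
  have h7 : I ≤ 50 * B * (8 * K + 32 * C0) * R ^ (2 - 3/5 : ℝ) := by
    have h2' : 3/100 * I ≤ _ := h2
    linarith
  calc _ ≤ _ := hAI
    _ ≤ q * (50 * B * (8 * K + 32 * C0) * R ^ (2 - 3/5 : ℝ)) := by gcongr
    _ = _ := by ring

/-- The Bochner quantity vanishes in low dimension. -/
theorem VP.Q_zero (H : VP f v P c) {o : EuclideanSpace ℝ (Fin d)} {C0 : ℝ}
    (hvol : ∀ R : ℝ, 1 ≤ R → (∫ x in Metric.ball o R, Real.exp (-f x)) ≤ C0 * R ^ d)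
    (hd : d = 3 ∨ d = 4 ∨ d = 5) (x : EuclideanSpace ℝ (Fin d)) : QQ f v P x = 0 := by
  rcases hd with hd | hd | hd
  · have hdr : (d:ℝ) = 3 := by rw [hd]; norm_num
    obtain ⟨C, K, h⟩ := H.A34 hvol (s := 0) le_rfl (by rw [hdr]; norm_num) (by rw [hdr]; norm_num)
      (by rw [hdr]; norm_num)
    exact H.conclude (by norm_num) le_rfl (by norm_num) h x
  · have hdr : (d:ℝ) = 4 := by rw [hd]; norm_num
    obtain ⟨C, K, h⟩ := H.A34 hvol (s := -(1/4)) (by norm_num) (by rw [hdr]; norm_num)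
      (by rw [hdr]; norm_num) (by rw [hdr]; norm_num)
    exact H.conclude (by norm_num) (by norm_num) (by norm_num) h x
  · obtain ⟨C, K, h⟩ := H.A5 hvol hd
    exact H.conclude (by norm_num) (by norm_num) (by norm_num) h x

end
end LaneEmden

namespace LaneEmden

variable {d : ℕ}

theorem fderiv_eq_sum (h : EuclideanSpace ℝ (Fin d) → ℝ) (x y : EuclideanSpace ℝ (Fin d)) :
    fderiv ℝ h x y = ∑ i, y i * pd i h x := by
  have hy : y = ∑ i, y i • EuclideanSpace.single i (1:ℝ) := by
    have := (EuclideanSpace.basisFun (Fin d) ℝ).sum_repr y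
    simpa using this.symm
  conv_lhs => rw [hy]
  simp only [map_sum, map_smul, smul_eq_mul]
  rfl

theorem const_of_pd {h : EuclideanSpace ℝ (Fin d) → ℝ} (hh : Differentiable ℝ h)
    (h0 : ∀ i x, pd i h x = 0) (x y : EuclideanSpace ℝ (Fin d)) : h x = h y := by
  refine is_const_of_fderiv_eq_zero (𝕜 := ℝ) hh (fun x => ?_) x y
  ext y
  rw [fderiv_eq_sum]
  simp [h0]

theorem pd_sub {h k : EuclideanSpace ℝ (Fin d) → ℝ} {x : EuclideanSpace ℝ (Fin d)}
    (hh : DifferentiableAt ℝ h x) (hk : DifferentiableAt ℝ k x)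
    (i : Fin d) : pd i (fun x => h x - k x) x = pd i h x - pd i k x := by
  unfold pd
  rw [(hh.hasFDerivAt.fun_sub hk.hasFDerivAt).fderiv]
  simp

theorem hasFDerivAt_coord (j : Fin d) (x : EuclideanSpace ℝ (Fin d)) :
    HasFDerivAt (fun x : EuclideanSpace ℝ (Fin d) => x j)
      (EuclideanSpace.proj j : EuclideanSpace ℝ (Fin d) →L[ℝ] ℝ) x :=
  (EuclideanSpace.proj j : EuclideanSpace ℝ (Fin d) →L[ℝ] ℝ).hasFDerivAt

theorem pd_coord (i j : Fin d) (x : EuclideanSpace ℝ (Fin d)) :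
    pd i (fun x : EuclideanSpace ℝ (Fin d) => x j) x = if i = j then 1 else 0 := by
  unfold pd
  rw [(hasFDerivAt_coord j x).fderiv]
  simp [eq_comm]

theorem hasFDerivAt_nsq (x0 x : EuclideanSpace ℝ (Fin d)) :
    HasFDerivAt (fun x : EuclideanSpace ℝ (Fin d) => ‖x - x0‖ ^ 2)
      (2 • (innerSL ℝ (x - x0))) x := by
  simpa using ((hasFDerivAt_id x).sub_const x0).norm_sq

theorem pd_nsq (x0 x : EuclideanSpace ℝ (Fin d)) (i : Fin d) :
    pd i (fun x : EuclideanSpace ℝ (Fin d) => ‖x - x0‖ ^ 2) x = 2 * (x i - x0 i) := by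
  unfold pd
  rw [(hasFDerivAt_nsq x0 x).fderiv]
  simp [EuclideanSpace.inner_single_right]

section
variable {f v P : EuclideanSpace ℝ (Fin d) → ℝ} {c : ℝ}

theorem VP.rigid (H : VP f v P c) (hQ : ∀ x, QQ f v P x = 0) :
    (∀ x y, f x = f y) ∧ ∃ a : ℝ, 0 < a ∧ ∃ b : ℝ, 0 < b ∧ 2 * d * a * b = c ∧
      ∃ x0 : EuclideanSpace ℝ (Fin d), ∀ x, v x = a + b * ‖x - x0‖ ^ 2 := by
  have hd : (0:ℝ) < d := by exact_mod_cast H.hd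
  have hE : ∀ x, EE v P x = 0 := by
    intro x
    have h1 := H.EE_le x
    rw [hQ x] at h1
    have h2 := EE_nonneg v P x
    nlinarith
  have hH : ∀ x i j, pd i (pd j v) x = if i = j then P x / d else 0 := by
    intro x i j
    have h1 := hE x
    unfold EE at h1
    rw [Finset.sum_eq_zero_iff_of_nonneg
      (fun _ _ => Finset.sum_nonneg fun _ _ => sq_nonneg _)] at h1
    have h2 := h1 i (Finset.mem_univ _)
    rw [Finset.sum_eq_zero_iff_of_nonneg (fun _ _ => sq_nonneg _)] at h2
    have h3 := h2 j (Finset.mem_univ _)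
    exact sub_eq_zero.1 (pow_eq_zero_iff (by norm_num) |>.1 h3)
  have hfv : ∀ x, gdot f v x = 0 := by
    intro x
    have h1 := H.Q_eq x
    rw [hQ x, hE x] at h1
    have h2 := H.hess x (fun i => pd i v x)
    have h3 := H.hg x
    have h4 := H.Ppos x
    have h5 : 0 ≤ (d:ℝ) * ∑ i, ∑ j, pd i (pd j f) x * pd i v x * pd j v x := by positivity
    have h6 : P x * gdot f v x ≤ 0 := by linarith
    nlinarith
  have hP0 : ∀ j x, pd j P x = 0 := by
    intro j x
    have h1 := H.vP_eq j x
    have h2 : v x * pd j P x = 0 := by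
      rw [h1]; simp [hH x]
    exact (mul_eq_zero.1 h2).resolve_left (H.vpos x).ne'
  have hPc := const_of_pd (H.hP.differentiable (by norm_num)) hP0
  set β : ℝ := P 0 / d with hβ
  have hβ0 : 0 < β := div_pos (H.Ppos 0) hd
  have hgc : ∀ j x y, pd j v x - β * x j = pd j v y - β * y j := by
    intro j x y
    have hc : Differentiable ℝ (fun x : EuclideanSpace ℝ (Fin d) => x j) := fun x =>
      (hasFDerivAt_coord j x).differentiableAt
    have hdv : Differentiable ℝ (pd j v) := (H.pdv2 j).differentiable (by norm_num)
    refine const_of_pd (h := fun x => pd j v x - β * x j) (hdv.sub (hc.const_mul β))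
      (fun i x => ?_) x y
    rw [pd_sub (hdv x) ((hc x).const_mul β), pd_const_mul _ (hc x), pd_coord, hH, hPc x 0]
    split_ifs <;> simp [hβ]
  let x0 : EuclideanSpace ℝ (Fin d) := WithLp.toLp 2 fun j => - (pd j v 0 / β)
  have hx0 : ∀ j, x0 j = -(pd j v 0 / β) := fun j => rfl
  have hgv : ∀ j x, pd j v x = β * (x j - x0 j) := by
    intro j x
    have := hgc j x 0
    simp only [PiLp.zero_apply, mul_zero, sub_zero] at this
    rw [hx0, sub_neg_eq_add, mul_add, mul_div_cancel₀ _ hβ0.ne']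
    linarith
  have hv : ∀ x, v x = v x0 + β / 2 * ‖x - x0‖ ^ 2 := by
    intro x
    have hn : Differentiable ℝ (fun x : EuclideanSpace ℝ (Fin d) => ‖x - x0‖ ^ 2) := fun x =>
      (hasFDerivAt_nsq x0 x).differentiableAt
    have hdv : Differentiable ℝ v := H.hv.differentiable (by norm_num)
    have := const_of_pd (h := fun x => v x - β / 2 * ‖x - x0‖ ^ 2) (hdv.sub (hn.const_mul _))
      (fun i x => by
        rw [pd_sub (hdv x) ((hn x).const_mul _), pd_const_mul _ (hn x), pd_nsq, hgv]; ring) x x0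
    simp only [sub_self, norm_zero] at this
    linarith
  have hff : ∀ x, f x = f x0 := by
    intro x
    have hfd : Differentiable ℝ f := H.hf.differentiable (by norm_num)
    have hrad : ∀ x, fderiv ℝ f x (x - x0) = 0 := by
      intro x
      have h1 := hfv x
      unfold gdot at h1
      rw [fderiv_eq_sum]
      have : β * ∑ i, (x - x0) i * pd i f x = 0 := by
        rw [← h1, Finset.mul_sum]
        refine Finset.sum_congr rfl fun i _ => ?_
        rw [hgv]; simp; ring
      exact (mul_eq_zero.1 this).resolve_left hβ0.ne'
    have hg : ∀ t : ℝ, HasDerivAt (fun t : ℝ => f (x0 + t • (x - x0)))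
        (fderiv ℝ f (x0 + t • (x - x0)) (x - x0)) t := by
      intro t
      have h2 : HasDerivAt (fun t : ℝ => x0 + t • (x - x0)) (x - x0) t := by
        simpa using ((hasDerivAt_id t).smul_const (x - x0)).const_add x0
      exact (hfd _).hasFDerivAt.comp_hasDerivAt t h2
    obtain ⟨t, ht, he⟩ := exists_hasDerivAt_eq_slope (fun t : ℝ => f (x0 + t • (x - x0)))
      (fun t => fderiv ℝ f (x0 + t • (x - x0)) (x - x0)) (zero_lt_one)
      (fun t _ => (hg t).continuousAt.continuousWithinAt) (fun t _ => hg t)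
    have h3 := hrad (x0 + t • (x - x0))
    simp only [add_sub_cancel_left, map_smul, smul_eq_mul] at h3
    rw [(mul_eq_zero.1 h3).resolve_left ht.1.ne'] at he
    simp at he
    linarith
  refine ⟨fun x y => (hff x).trans (hff y).symm, v x0, H.vpos x0, β / 2, by positivity, ?_, x0, hv⟩
  have h1 := H.hvP x0
  have h2 : gdot v v x0 = 0 := by unfold gdot; simp [hgv]
  rw [h2, hPc x0 0] at h1
  have : P 0 = d * β := by rw [hβ]; field_simp
  rw [this] at h1
  linarith

end

set_option maxHeartbeats 1000000 in
theorem mkVP {f u : EuclideanSpace ℝ (Fin d) → ℝ} (hd : 2 < d)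
    (hf : ContDiff ℝ 2 f) (hconv : ConvexOn ℝ Set.univ f)
    (hu : ContDiff ℝ 3 u) (hupos : ∀ x, 0 < u x)
    (heq : ∀ x, lap u x - gdot f u x + u x ^ (((d : ℝ) + 2) / ((d : ℝ) - 2)) = 0)
    (hdot : ∀ x, gdot f u x ≤ 0) :
    ∃ P, VP f (fun x => u x ^ (-2 / ((d:ℝ) - 2))) P (2 / ((d:ℝ) - 2)) := by
  have hdr : (2:ℝ) < d := by exact_mod_cast hd
  have hδ : 0 < (d:ℝ) - 2 := by linarith
  set r : ℝ := -2 / ((d:ℝ) - 2) with hr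
  set c : ℝ := 2 / ((d:ℝ) - 2) with hc
  have hc0 : 0 < c := by positivity
  have hcr : c = -r := by rw [hc, hr]; ring
  set v : EuclideanSpace ℝ (Fin d) → ℝ := fun x => u x ^ r with hv
  have hv3 : ContDiff ℝ 3 v := hu.rpow_const_of_ne fun x => (hupos x).ne'
  have hvpos : ∀ x, 0 < v x := fun x => Real.rpow_pos_of_pos (hupos x) _
  have hpv2 : ∀ i, ContDiff ℝ 2 (pd i v) := fun i => by
    simpa using contDiff_pd (n := 2) (by simpa using hv3) i
  have hpu2 : ∀ i, ContDiff ℝ 2 (pd i u) := fun i => by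
    simpa using contDiff_pd (n := 2) (by simpa using hu) i
  have hgvv : ContDiff ℝ 2 (gdot v v) := by
    unfold gdot
    exact ContDiff.sum fun i _ => (hpv2 i).mul (hpv2 i)
  have hdu : Differentiable ℝ u := hu.differentiable (by norm_num)
  have hpd : ∀ i, pd i v = fun x => r * (u x ^ (r - 1) * pd i u x) := by
    intro i; funext x
    rw [hv, pd_rpow (hdu x) (hupos x)]; ring
  have hdpu : ∀ i, Differentiable ℝ (pd i u) := fun i => (hpu2 i).differentiable (by norm_num)
  have hdr1 : Differentiable ℝ (fun x => u x ^ (r - 1)) :=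
    (hu.rpow_const_of_ne fun x => (hupos x).ne').differentiable (by norm_num)
  have hpd2 : ∀ i x, pd i (pd i v) x = r * (u x ^ (r - 1) * pd i (pd i u) x
      + (r - 1) * (u x ^ (r - 1) / u x) * (pd i u x * pd i u x)) := by
    intro i x
    rw [hpd i, pd_const_mul _ ((hdr1 x).fun_mul (hdpu i x)), pd_mul (hdr1 x) (hdpu i x),
      pd_rpow (hdu x) (hupos x), Real.rpow_sub_one (hupos x).ne' (r - 1)]
    ring
  have hlap : ∀ x, lap v x = r * (u x ^ (r - 1) * lap u x
      + (r - 1) * (u x ^ (r - 1) / u x) * gdot u u x) := by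
    intro x
    unfold lap gdot
    rw [Finset.mul_sum, Finset.mul_sum, ← Finset.sum_add_distrib, Finset.mul_sum]
    exact Finset.sum_congr rfl fun i _ => hpd2 i x
  have hgfv : ∀ x, gdot f v x = r * (u x ^ (r - 1) * gdot f u x) := by
    intro x
    unfold gdot
    rw [Finset.mul_sum, Finset.mul_sum]
    refine Finset.sum_congr rfl fun i _ => ?_
    rw [hpd i]; ring
  have hgv : ∀ x, gdot v v x = r ^ 2 * ((u x ^ (r - 1)) ^ 2 * gdot u u x) := by
    intro x
    unfold gdot
    rw [Finset.mul_sum, Finset.mul_sum]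
    refine Finset.sum_congr rfl fun i _ => ?_
    rw [hpd i]; ring
  refine ⟨fun x => ((d:ℝ) / 2 * gdot v v x + c) / v x, by omega, hf, hv3, ?_, hvpos, ?_, hc0,
    ?_, ?_, ?_, hess_nonneg hf hconv⟩
  · exact ((contDiff_const.mul hgvv).add contDiff_const).div (hv3.of_le (by norm_num))
      fun x => (hvpos x).ne'
  · intro x
    have := gdot_self_nonneg v x
    have := hvpos x
    positivity
  · intro x
    have := hvpos x
    field_simp
  · intro x
    have hux := hupos x
    have hvx := hvpos x
    have e0 : lap u x = gdot f u x - u x ^ (((d : ℝ) + 2) / ((d : ℝ) - 2)) := by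
      linarith [heq x]
    have e1 : u x ^ (r - 1) = v x / u x := Real.rpow_sub_one hux.ne' r
    have e2 : v x * (u x ^ (r - 1) * u x ^ (((d : ℝ) + 2) / ((d : ℝ) - 2))) = 1 := by
      rw [hv]
      simp only
      rw [← Real.rpow_add hux, ← Real.rpow_add hux,
        show r + (r - 1 + ((d : ℝ) + 2) / ((d : ℝ) - 2)) = 0 by
          rw [hr]; field_simp; ring, Real.rpow_zero]
    have e3 : r - 1 = d / 2 * r := by rw [hr]; field_simp; ring
    have e4 : u x ^ (r - 1) * u x ^ (((d : ℝ) + 2) / ((d : ℝ) - 2)) = 1 / v x := by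
      rw [eq_div_iff hvx.ne']; linarith
    rw [hlap, hgfv, hgv, e0, mul_sub (u x ^ (r - 1)), e4, e1, hcr, e3]
    field_simp
    ring
  · intro x
    rw [hgfv]
    have h1 := hdot x
    have h2 := Real.rpow_pos_of_pos (hupos x) (r - 1)
    have h3 : r < 0 := by linarith
    exact mul_nonneg_of_nonpos_of_nonpos h3.le (mul_nonpos_of_nonneg_of_nonpos h2.le h1)

end LaneEmden

/-- Euclidean-base instance of Theorem 2.1 i): rigidity for the critical Lane-Emden
equation in dimensions 3, 4, 5, with convex weight (Ric_{∞,d} ≥ 0), the condition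
∇f·∇u ≤ 0, and Euclidean weighted volume growth. -/
theorem critical_laneEmden_rigidity_lowDim
    (d : ℕ) (hd : d = 3 ∨ d = 4 ∨ d = 5)
    (f u : EuclideanSpace ℝ (Fin d) → ℝ)
    (hf : ContDiff ℝ 2 f) (hconv : ConvexOn ℝ Set.univ f)
    (hu : ContDiff ℝ 3 u) (hupos : ∀ x, 0 < u x)
    (heq : ∀ x, lapl u x - ⟪gradient f x, gradient u x⟫
        + u x ^ (((d : ℝ) + 2) / ((d : ℝ) - 2)) = 0)
    (hdot : ∀ x, ⟪gradient f x, gradient u x⟫ ≤ 0)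
    (hvol : ∃ o : EuclideanSpace ℝ (Fin d), ∃ C : ℝ, 0 < C ∧ ∀ R : ℝ, 1 ≤ R →
        (∫ x in Metric.ball o R, Real.exp (-f x)) ≤ C * R ^ d) :
    (∀ x y, f x = f y) ∧
    ∃ a : ℝ, 0 < a ∧ ∃ b : ℝ, 0 < b ∧ (d : ℝ) * ((d : ℝ) - 2) * a * b = 1 ∧
      ∃ x₀ : EuclideanSpace ℝ (Fin d),
        ∀ x, u x = (a + b * ‖x - x₀‖ ^ 2) ^ (-(((d : ℝ) - 2) / 2)) := by
  have hd2 : 2 < d := by omega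
  have hdr : (2:ℝ) < d := by exact_mod_cast hd2
  have hδ : 0 < (d:ℝ) - 2 := by linarith
  simp only [LaneEmden.inner_grad_eq, LaneEmden.lapl_eq (hu.of_le (by norm_num : (2:WithTop ℕ∞) ≤ 3))]
    at heq hdot
  obtain ⟨P, H⟩ := LaneEmden.mkVP hd2 hf hconv hu hupos heq hdot
  obtain ⟨o, C0, -, hvol⟩ := hvol
  obtain ⟨h1, a, ha, b, hb, hab, x0, hv⟩ := H.rigid (H.Q_zero hvol hd)
  refine ⟨h1, a, ha, b, hb, ?_, x0, fun x => ?_⟩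
  · rw [eq_div_iff hδ.ne'] at hab
    linarith
  · rw [← hv x]
    rw [← Real.rpow_mul (hupos x).le,
      show -2 / ((d:ℝ) - 2) * -(((d : ℝ) - 2) / 2) = 1 by field_simp, Real.rpow_one]
end

section
/- Let d ≥ 3 be an integer, let f : ℝ^d → ℝ be C² and convex, and let u : ℝ^d → ℝ be a positive C³ function satisfying Δu − ∇f·∇u + u^{(d+2)/(d−2)} = 0 on all of ℝ^d, such that ∇f(x)·∇u(x) ≤ 0 for every x ∈ ℝ^d. Assume there exist o ∈ ℝ^d and C > 0 such that ∫_{B_R(o)} e^{−f(x)} dx ≤ C·R^d for all R ≥ 1, that ∇f(x)·(x−o) ≥ 0 for all x ∈ ℝ^d (on Euclidean space this is exactly the weighted Laplacian comparison 𝓛(|x−o|) ≤ (d−1)/|x−o|), and that u has finite weighted energy: ∫_{ℝ^d} e^{−f(x)} u(x)^{2d/(d−2)} dx < +∞. Then f is constant on ℝ^d, and there exist a, b > 0 with d(d−2)ab = 1 and x₀ ∈ ℝ^d such that u(x) = (a + b·|x−x₀|²)^{−(d−2)/2} for all x. [Euclidean-base instance of Theorem 2.1 iii).] -/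
open Real MeasureTheory Filter
open scoped RealInnerProductSpace


/-- partial derivative -/
noncomputable def pd {d : ℕ} (i : Fin d) (g : EuclideanSpace ℝ (Fin d) → ℝ)
    (x : EuclideanSpace ℝ (Fin d)) : ℝ := fderiv ℝ g x (EuclideanSpace.single i 1)

section pdlemmas
variable {d : ℕ}

lemma pd_contDiff {n : ℕ} (i : Fin d) {g : EuclideanSpace ℝ (Fin d) → ℝ}
    (hg : ContDiff ℝ (n + 1 : ℕ) g) : ContDiff ℝ n (pd i g) := by
  unfold pd
  have : ContDiff ℝ n (fderiv ℝ g) := hg.fderiv_right (by norm_cast)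
  exact this.clm_apply contDiff_const

lemma pd_mul (i : Fin d) {g h : EuclideanSpace ℝ (Fin d) → ℝ} {x}
    (hg : DifferentiableAt ℝ g x) (hh : DifferentiableAt ℝ h x) :
    pd i (fun y => g y * h y) x = pd i g x * h x + g x * pd i h x := by
  unfold pd
  rw [fderiv_fun_mul hg hh]; simp; ring

lemma pd_add (i : Fin d) {g h : EuclideanSpace ℝ (Fin d) → ℝ} {x}
    (hg : DifferentiableAt ℝ g x) (hh : DifferentiableAt ℝ h x) :
    pd i (fun y => g y + h y) x = pd i g x + pd i h x := by
  unfold pd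
  rw [fderiv_fun_add hg hh]; simp

lemma pd_sub (i : Fin d) {g h : EuclideanSpace ℝ (Fin d) → ℝ} {x}
    (hg : DifferentiableAt ℝ g x) (hh : DifferentiableAt ℝ h x) :
    pd i (fun y => g y - h y) x = pd i g x - pd i h x := by
  unfold pd
  rw [fderiv_fun_sub hg hh]; simp

lemma pd_const_mul (i : Fin d) (c : ℝ) {g : EuclideanSpace ℝ (Fin d) → ℝ} {x}
    (hg : DifferentiableAt ℝ g x) :
    pd i (fun y => c * g y) x = c * pd i g x := by
  unfold pd
  rw [fderiv_const_mul hg]; simp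

lemma pd_const (i : Fin d) (c : ℝ) (x) :
    pd i (fun _ => c) x = 0 := by
  unfold pd
  simp

lemma pd_sum (i : Fin d) {ι : Type} (s : Finset ι) {g : ι → EuclideanSpace ℝ (Fin d) → ℝ} {x}
    (hg : ∀ j ∈ s, DifferentiableAt ℝ (g j) x) :
    pd i (fun y => ∑ j ∈ s, g j y) x = ∑ j ∈ s, pd i (g j) x := by
  unfold pd
  rw [fderiv_fun_sum hg]; simp

lemma pd_comp (i : Fin d) {g : EuclideanSpace ℝ (Fin d) → ℝ} {x} {F : ℝ → ℝ} {F' : ℝ}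
    (hF : HasDerivAt F F' (g x)) (hg : DifferentiableAt ℝ g x) :
    pd i (fun y => F (g y)) x = F' * pd i g x := by
  unfold pd
  have := hF.comp_hasFDerivAt x hg.hasFDerivAt
  have h2 : fderiv ℝ (fun y => F (g y)) x = F' • fderiv ℝ g x := this.fderiv
  rw [h2]; simp

lemma pd_comm (i j : Fin d) {g : EuclideanSpace ℝ (Fin d) → ℝ} (hg : ContDiff ℝ 2 g) (x) :
    pd i (pd j g) x = pd j (pd i g) x := by
  have hd : Differentiable ℝ (fderiv ℝ g) :=
    (hg.fderiv_right (m := 1) (by norm_num)).differentiable (by norm_num)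
  have key : ∀ i j : Fin d, pd i (pd j g) x =
      fderiv ℝ (fderiv ℝ g) x (EuclideanSpace.single i 1) (EuclideanSpace.single j 1) := by
    intro i j
    unfold pd
    rw [fderiv_clm_apply (hd x) (differentiableAt_const _)]
    simp
  rw [key, key]
  exact (hg.contDiffAt.isSymmSndFDerivAt (by simp)).eq _ _

lemma lapl_eq {g : EuclideanSpace ℝ (Fin d) → ℝ} (hg : ContDiff ℝ 2 g) (x) :
    lapl g x = ∑ i, pd i (pd i g) x := by
  have hd : Differentiable ℝ (fderiv ℝ g) :=
    (hg.fderiv_right (m := 1) (by norm_num)).differentiable (by norm_num)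
  unfold lapl
  refine Finset.sum_congr rfl fun i _ => ?_
  rw [iteratedFDeriv_two_apply]
  unfold pd
  rw [fderiv_clm_apply (hd x) (differentiableAt_const _)]
  simp

lemma fderiv_eq_sum (g : EuclideanSpace ℝ (Fin d) → ℝ) (x y) :
    fderiv ℝ g x y = ∑ i, y i * pd i g x := by
  unfold pd
  conv_lhs => rw [← (EuclideanSpace.basisFun (Fin d) ℝ).sum_repr y]
  simp

lemma grad_apply (g : EuclideanSpace ℝ (Fin d) → ℝ) (x) (i) :
    (gradient g x) i = pd i g x := by
  have : ⟪gradient g x, EuclideanSpace.single i (1:ℝ)⟫ = pd i g x := by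
    unfold pd gradient
    rw [InnerProductSpace.toDual_symm_apply]
  rw [← this, EuclideanSpace.inner_single_right]
  simp

lemma inner_grad (g : EuclideanSpace ℝ (Fin d) → ℝ) (x y) :
    ⟪gradient g x, y⟫ = ∑ i, pd i g x * y i := by
  rw [PiLp.inner_apply]
  refine Finset.sum_congr rfl fun i _ => ?_
  rw [grad_apply]; simp [mul_comm]

/-- integration by parts -/
lemma ibp (X : Fin d → EuclideanSpace ℝ (Fin d) → ℝ) (η : EuclideanSpace ℝ (Fin d) → ℝ)
    (hX : ∀ i, ContDiff ℝ 1 (X i)) (hη : ContDiff ℝ 1 η) (hc : HasCompactSupport η) :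
    ∫ x, ((∑ i, pd i (X i) x) * η x ^ 2 + 2 * η x * ∑ i, X i x * pd i η x) = 0 := by
  have key : ∀ i, Integrable (pd i (fun y => X i y * η y ^ 2)) ∧ ∫ x, pd i (fun y => X i y * η y ^ 2) x = 0 := by
    intro i
    have hC : ContDiff ℝ 1 (fun y => X i y * η y ^ 2) := (hX i).mul (hη.pow 2)
    have hs : HasCompactSupport (fun y => X i y * η y ^ 2) := by
      refine hc.mono ?_
      intro y hy
      simp only [Function.mem_support] at hy ⊢
      intro h; apply hy; simp [h]
    have hi : Integrable (pd i (fun y => X i y * η y ^ 2)) := by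
      refine Continuous.integrable_of_hasCompactSupport ?_ ?_
      · exact (pd_contDiff (n := 0) i (by simpa using hC)).continuous
      · exact hs.fderiv_apply (𝕜 := ℝ) _
    refine ⟨hi, ?_⟩
    have hi0 : Integrable (fun y => X i y * η y ^ 2) :=
      hC.continuous.integrable_of_hasCompactSupport hs
    have := integral_mul_fderiv_eq_neg_fderiv_mul_of_integrable (μ := volume)
      (f := fun _ : EuclideanSpace ℝ (Fin d) => (1:ℝ)) (g := fun y => X i y * η y ^ 2)
      (v := EuclideanSpace.single i 1) (by simp) (by simp only [one_mul]; exact hi) (by simpa using hi0)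
      (fun x _ => differentiableAt_const _) (fun x _ => hC.differentiable (by norm_num) x)
    simpa [pd] using this
  have e : ∀ x, ((∑ i, pd i (X i) x) * η x ^ 2 + 2 * η x * ∑ i, X i x * pd i η x) =
      ∑ i, pd i (fun y => X i y * η y ^ 2) x := by
    intro x
    rw [Finset.sum_mul, Finset.mul_sum, ← Finset.sum_add_distrib]
    refine Finset.sum_congr rfl fun i _ => ?_
    have h1 := (hX i).differentiable (by norm_num) x
    have h2 := hη.differentiable (by norm_num) x
    rw [pd_mul i h1 (h2.fun_pow 2), pd_comp i (F := fun t => t^2) (hasDerivAt_pow 2 _) h2]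
    push_cast; ring
  simp_rw [e]
  rw [integral_finsetSum _ (fun i _ => (key i).1)]
  exact Finset.sum_eq_zero fun i _ => (key i).2

end pdlemmas


section pdlemmas2
variable {d : ℕ}

lemma pd_congr (i : Fin d) {g h : EuclideanSpace ℝ (Fin d) → ℝ} {x}
    (hgh : g =ᶠ[nhds x] h) : pd i g x = pd i h x := by
  unfold pd; rw [hgh.fderiv_eq]

lemma pd_rpow (i : Fin d) (α : ℝ) {h : EuclideanSpace ℝ (Fin d) → ℝ} {x}
    (hh : DifferentiableAt ℝ h x) (hx : 0 < h x) :
    pd i (fun y => h y ^ α) x = α * h x ^ (α - 1) * pd i h x :=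
  pd_comp i (F := fun t => t ^ α) (Real.hasDerivAt_rpow_const (Or.inl hx.ne')) hh

lemma pd_rpow_ev (i : Fin d) (α : ℝ) {h : EuclideanSpace ℝ (Fin d) → ℝ} {x}
    (hh : ContDiff ℝ 2 h) (hx : 0 < h x) :
    pd i (fun y => h y ^ α) =ᶠ[nhds x] fun y => α * h y ^ (α - 1) * pd i h y := by
  have : ∀ᶠ y in nhds x, 0 < h y := hh.continuous.continuousAt.eventually (lt_mem_nhds hx)
  filter_upwards [this] with y hy
  exact pd_rpow i α (hh.differentiable (by norm_num) y) hy

lemma pd_rpow_diff (i : Fin d) (α : ℝ) {h : EuclideanSpace ℝ (Fin d) → ℝ} {x}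
    (hh : ContDiff ℝ 2 h) (hx : 0 < h x) :
    DifferentiableAt ℝ (pd i (fun y => h y ^ α)) x := by
  have h1 := hh.differentiable (by norm_num) x
  have h2 : DifferentiableAt ℝ (pd i h) x :=
    (pd_contDiff (n := 1) i (by simpa using hh)).differentiable (by norm_num) x
  refine DifferentiableAt.congr_of_eventuallyEq ?_ (pd_rpow_ev i α hh hx)
  exact ((h1.rpow_const (Or.inl hx.ne')).const_mul α).mul h2

lemma pd_pd_rpow (i : Fin d) (α : ℝ) {h : EuclideanSpace ℝ (Fin d) → ℝ} {x}
    (hh : ContDiff ℝ 2 h) (hx : 0 < h x) :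
    pd i (pd i (fun y => h y ^ α)) x = α * h x ^ (α - 2) *
      (h x * pd i (pd i h) x + (α - 1) * pd i h x ^ 2) := by
  have h1 := hh.differentiable (by norm_num) x
  have h2 : DifferentiableAt ℝ (pd i h) x :=
    (pd_contDiff (n := 1) i (by simpa using hh)).differentiable (by norm_num) x
  rw [pd_congr i (pd_rpow_ev i α hh hx),
    pd_mul i ((h1.rpow_const (Or.inl hx.ne')).const_mul α) h2,
    pd_const_mul i α (h1.rpow_const (Or.inl hx.ne')), pd_rpow i (α - 1) h1 hx]
  have e1 : h x ^ (α - 1) = h x ^ (α - 2) * h x := by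
    rw [← Real.rpow_add_one hx.ne']; congr 1; ring
  have e2 : α - 1 - 1 = α - 2 := by ring
  rw [e1, e2]; ring

lemma line_hasDerivAt {g : EuclideanSpace ℝ (Fin d) → ℝ} (x ξ : EuclideanSpace ℝ (Fin d)) (t : ℝ)
    (hg : DifferentiableAt ℝ g (x + t • ξ)) :
    HasDerivAt (fun s : ℝ => g (x + s • ξ)) (fderiv ℝ g (x + t • ξ) ξ) t := by
  have h1 : HasDerivAt (fun s : ℝ => x + s • ξ) ξ t := by
    simpa using ((hasDerivAt_id t).smul_const ξ).const_add x
  exact hg.hasFDerivAt.comp_hasDerivAt t h1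

lemma locmin_pd (i : Fin d) {g : EuclideanSpace ℝ (Fin d) → ℝ} {x} (hm : IsLocalMin g x) :
    pd i g x = 0 := by
  unfold pd; rw [hm.fderiv_eq_zero]; simp

lemma locmin_pd_pd (i : Fin d) {g : EuclideanSpace ℝ (Fin d) → ℝ} {x} (hm : IsLocalMin g x)
    (hg : ∀ᶠ y in nhds x, DifferentiableAt ℝ g y) (hg2 : DifferentiableAt ℝ (pd i g) x) :
    0 ≤ pd i (pd i g) x := by
  set ξ : EuclideanSpace ℝ (Fin d) := EuclideanSpace.single i 1 with hξ
  set γ : ℝ → ℝ := fun s => g (x + s • ξ) with hγ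
  have hcont : Tendsto (fun s : ℝ => x + s • ξ) (nhds 0) (nhds x) := by
    have : Continuous (fun s : ℝ => x + s • ξ) := by fun_prop
    simpa using this.tendsto 0
  have hd1 : deriv γ =ᶠ[nhds 0] fun s => pd i g (x + s • ξ) := by
    filter_upwards [hcont.eventually hg] with s hs
    exact (line_hasDerivAt x ξ s hs).deriv
  have hd2 : deriv (deriv γ) 0 = pd i (pd i g) x := by
    rw [hd1.deriv_eq]
    have := (line_hasDerivAt (g := pd i g) x ξ 0 (by simpa using hg2)).deriv
    rw [this]; simp [pd, hξ]
  have hmin : IsLocalMin γ 0 := by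
    have := hcont.eventually hm
    filter_upwards [this] with s hs
    simpa [hγ] using hs
  by_contra hneg
  push Not at hneg
  have hc : ContinuousAt γ 0 := 
    (line_hasDerivAt x ξ 0 (by simpa using hg.self_of_nhds)).continuousAt
  have hmax := isLocalMax_of_deriv_deriv_neg (f := γ) (x₀ := 0) (by rw [hd2]; exact hneg)
    hmin.deriv_eq_zero hc
  have hconst : γ =ᶠ[nhds 0] fun _ => γ 0 := by
    filter_upwards [hmin, hmax] with s h1 h2
    exact le_antisymm h2 h1
  have : deriv (deriv γ) 0 = 0 := by
    rw [hconst.deriv.deriv_eq]; simp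
  rw [hd2] at this
  linarith

lemma hess_convex {f : EuclideanSpace ℝ (Fin d) → ℝ} (hf : ContDiff ℝ 2 f)
    (hconv : ConvexOn ℝ Set.univ f) (x : EuclideanSpace ℝ (Fin d)) (ξ : Fin d → ℝ) :
    0 ≤ ∑ i, ∑ j, pd i (pd j f) x * ξ i * ξ j := by
  set z : EuclideanSpace ℝ (Fin d) := WithLp.toLp 2 ξ with hz
  set γ : ℝ → ℝ := fun s => f (x + s • z) with hγ
  have hdf := hf.differentiable (by norm_num)
  have hpd : ∀ j, Differentiable ℝ (pd j f) := fun j =>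
    (pd_contDiff (n := 1) j (by simpa using hf)).differentiable (by norm_num)
  have hcγ : ConvexOn ℝ Set.univ γ := by
    refine ⟨convex_univ, fun s _ t _ a b ha hb hab => ?_⟩
    have := hconv.2 (Set.mem_univ (x + s • z)) (Set.mem_univ (x + t • z)) ha hb hab
    refine le_trans (le_of_eq ?_) this
    simp only [hγ]
    congr 1
    have : x = a • x + b • x := by rw [← add_smul, hab, one_smul]
    conv_lhs => rw [this]
    simp only [smul_eq_mul]
    module
  have hd1 : deriv γ = fun s => ∑ j, ξ j * pd j f (x + s • z) := by
    ext s
    rw [(line_hasDerivAt x z s (hdf _)).deriv, fderiv_eq_sum]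
  have hmono : Monotone (deriv γ) := by
    rw [← monotoneOn_univ]
    exact hcγ.monotoneOn_deriv fun s _ => (line_hasDerivAt x z s (hdf _)).differentiableAt
  have h0 : 0 ≤ deriv (deriv γ) 0 := hmono.deriv_nonneg
  have hd2 : HasDerivAt (deriv γ) (∑ j, ξ j * fderiv ℝ (pd j f) (x + (0:ℝ) • z) z) 0 := by
    rw [hd1]
    exact HasDerivAt.fun_sum fun j _ => (line_hasDerivAt x z 0 (hpd j _)).const_mul _
  rw [hd2.deriv] at h0
  refine le_trans h0 (le_of_eq ?_)
  rw [Finset.sum_comm]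
  refine Finset.sum_congr rfl fun j _ => ?_
  rw [fderiv_eq_sum, Finset.mul_sum]
  refine Finset.sum_congr rfl fun i _ => ?_
  simp [hz]; ring

end pdlemmas2


section comparison
variable {d : ℕ}

lemma q_contDiff {n : WithTop ℕ∞} (o : EuclideanSpace ℝ (Fin d)) : ContDiff ℝ n (fun y => ‖y - o‖ ^ 2) :=
  (contDiff_id.sub contDiff_const).norm_sq ℝ

lemma pd_coord (i j : Fin d) (o : EuclideanSpace ℝ (Fin d)) (x) :
    pd i (fun y : EuclideanSpace ℝ (Fin d) => y j - o j) x = if j = i then 1 else 0 := by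
  unfold pd
  have h : HasFDerivAt (fun y : EuclideanSpace ℝ (Fin d) => y j - o j)
      (EuclideanSpace.proj j : EuclideanSpace ℝ (Fin d) →L[ℝ] ℝ) x :=
    (EuclideanSpace.proj j : EuclideanSpace ℝ (Fin d) →L[ℝ] ℝ).hasFDerivAt.sub_const _
  rw [h.fderiv]
  simp [Pi.single_apply]

lemma pd_q (i : Fin d) (o : EuclideanSpace ℝ (Fin d)) (x) :
    pd i (fun y => ‖y - o‖ ^ 2) x = 2 * (x i - o i) := by
  have e : (fun y : EuclideanSpace ℝ (Fin d) => ‖y - o‖ ^ 2) =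
      fun y => ∑ j, (y j - o j) ^ 2 := by
    ext y; rw [EuclideanSpace.real_norm_sq_eq]; simp
  have hdj : ∀ j, DifferentiableAt ℝ (fun y : EuclideanSpace ℝ (Fin d) => y j - o j) x := by
    intro j; fun_prop
  rw [e, pd_sum i _ (fun j _ => (hdj j).fun_pow 2)]
  have : ∀ j, pd i (fun y : EuclideanSpace ℝ (Fin d) => (y j - o j) ^ 2) x =
      if j = i then 2 * (x i - o i) else 0 := by
    intro j
    rw [pd_comp i (F := fun t => t^2) (hasDerivAt_pow 2 _) (hdj j), pd_coord]
    by_cases h : j = i <;> simp [h]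
  simp [this]

lemma pd_pd_q (i : Fin d) (o : EuclideanSpace ℝ (Fin d)) (x) :
    pd i (pd i (fun y => ‖y - o‖ ^ 2)) x = 2 := by
  have : pd i (fun y => ‖y - o‖ ^ 2) = fun x => 2 * (x i - o i) := by
    ext x; exact pd_q i o x
  rw [this, pd_const_mul i 2 (by fun_prop), pd_coord]; simp

lemma compare (hd : 3 ≤ d) (f u : EuclideanSpace ℝ (Fin d) → ℝ)
    (hu : ContDiff ℝ 2 u) (hupos : ∀ x, 0 < u x)
    (hlap : ∀ x, ∑ i, pd i (pd i u) x - ∑ i, pd i f x * pd i u x < 0)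
    (o : EuclideanSpace ℝ (Fin d)) (hcomp : ∀ x, 0 ≤ ∑ i, pd i f x * (x i - o i)) :
    ∃ c : ℝ, 0 < c ∧ ∀ x, 1 ≤ ‖x - o‖ →
      c * (‖x - o‖ ^ 2) ^ (-(((d:ℝ) - 2) / 2)) ≤ u x := by
  have hd' : (3:ℝ) ≤ d := by exact_mod_cast hd
  set α : ℝ := -(((d:ℝ) - 2) / 2) with hα
  have hα0 : α < 0 := by rw [hα]; linarith
  have : Nonempty (Fin d) := ⟨⟨0, by omega⟩⟩
  have : Nontrivial (EuclideanSpace ℝ (Fin d)) := inferInstance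
  obtain ⟨s, hs, hmin⟩ := (isCompact_sphere o (1:ℝ)).exists_isMinOn
    (NormedSpace.sphere_nonempty.2 (by norm_num)) hu.continuous.continuousOn
  refine ⟨u s, hupos s, ?_⟩
  set c := u s with hc
  have hcpos : 0 < c := hupos s
  set q : EuclideanSpace ℝ (Fin d) → ℝ := fun y => ‖y - o‖ ^ 2 with hq
  have hqC : ContDiff ℝ 2 q := q_contDiff o
  set φ : EuclideanSpace ℝ (Fin d) → ℝ := fun y => u y - c * q y ^ α with hφ
  by_contra! hcon
  obtain ⟨x0, hx0, hneg⟩ := hcon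
  have hφ0 : φ x0 < 0 := by simp only [hφ, hq]; linarith
  -- radius at infinity
  have hlim : Tendsto (fun r : ℝ => c * (r ^ 2) ^ α) atTop (nhds 0) := by
    have h1 : Tendsto (fun t : ℝ => t ^ α) atTop (nhds 0) := by
      have := tendsto_rpow_neg_atTop (y := -α) (by linarith)
      simpa using this
    have h2 : Tendsto (fun r : ℝ => r ^ 2) atTop atTop := tendsto_pow_atTop (by norm_num)
    simpa using (h1.comp h2).const_mul c
  obtain ⟨R, hR1, hR2⟩ : ∃ R, ‖x0 - o‖ < R ∧ c * (R ^ 2) ^ α < - φ x0 :=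
    ((eventually_gt_atTop _).and (hlim.eventually (gt_mem_nhds (by linarith)))).exists
  set A : Set (EuclideanSpace ℝ (Fin d)) := {y | 1 ≤ ‖y - o‖ ∧ ‖y - o‖ ≤ R} with hA
  have hAc : IsCompact A := by
    have h1 : IsClosed {y : EuclideanSpace ℝ (Fin d) | 1 ≤ ‖y - o‖} :=
      isClosed_le continuous_const (by fun_prop)
    have : A = Metric.closedBall o R ∩ {y | 1 ≤ ‖y - o‖} := by
      ext y; simp [hA, dist_eq_norm, and_comm]
    rw [this]
    exact (isCompact_closedBall o R).inter_right h1
  have hqpos : ∀ y, 1 ≤ ‖y - o‖ → 0 < q y := fun y hy => by simp only [hq]; positivity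
  have hφc : ContinuousOn φ A := by
    intro y hy
    have hqy := hqpos y hy.1
    exact (hu.continuous.continuousAt.sub (continuousAt_const.mul
      (hqC.continuous.continuousAt.rpow_const (Or.inl hqy.ne')))).continuousWithinAt
  obtain ⟨x1, hx1A, hx1⟩ := hAc.exists_isMinOn ⟨x0, hx0, hR1.le⟩ hφc
  have hφ1 : φ x1 ≤ φ x0 := hx1 (show x0 ∈ A from ⟨hx0, hR1.le⟩)
  have hne1 : 1 < ‖x1 - o‖ := by
    rcases hx1A.1.lt_or_eq with h | h
    · exact h
    · exfalso
      have : c ≤ u x1 := hmin (show x1 ∈ Metric.sphere o 1 by simp [dist_eq_norm, ← h])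
      have h2 : φ x1 = u x1 - c := by simp [hφ, hq, ← h]
      linarith
  have hneR : ‖x1 - o‖ < R := by
    rcases hx1A.2.lt_or_eq with h | h
    · exact h
    · exfalso
      have h2 : φ x1 = u x1 - c * (R ^ 2) ^ α := by simp [hφ, hq, ← h]
      have := hupos x1
      linarith
  have hloc : IsLocalMin φ x1 := by
    have hco : Continuous fun y : EuclideanSpace ℝ (Fin d) => ‖y - o‖ := by fun_prop
    filter_upwards [hco.continuousAt.eventually (lt_mem_nhds hne1),
      hco.continuousAt.eventually (gt_mem_nhds hneR)] with y h1 h2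
    exact hx1 (show y ∈ A from ⟨h1.le, h2.le⟩)
  have hq1 : 0 < q x1 := hqpos x1 hne1.le
  have hdq : ∀ y, 0 < q y → DifferentiableAt ℝ (fun y => q y ^ α) y := fun y hy =>
    (hqC.differentiable (by norm_num) y).rpow_const (Or.inl hy.ne')
  have hdu : Differentiable ℝ u := hu.differentiable (by norm_num)
  have hevq : ∀ᶠ y in nhds x1, 0 < q y := hqC.continuous.continuousAt.eventually (lt_mem_nhds hq1)
  have hpdφ : ∀ i, ∀ y, 0 < q y → pd i φ y = pd i u y - c * pd i (fun y => q y ^ α) y := by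
    intro i y hy
    rw [hφ, pd_sub i (hdu y) ((hdq y hy).const_mul c), pd_const_mul i c (hdq y hy)]
  have hpdu : ∀ i, DifferentiableAt ℝ (pd i u) x1 := fun i =>
    (pd_contDiff (n := 1) i (by simpa using hu)).differentiable (by norm_num) x1
  have hev : ∀ i, pd i φ =ᶠ[nhds x1] fun y => pd i u y - c * pd i (fun y => q y ^ α) y := by
    intro i
    filter_upwards [hevq] with y hy using hpdφ i y hy
  have hdd : ∀ i, DifferentiableAt ℝ (pd i (fun y => q y ^ α)) x1 := fun i =>
    pd_rpow_diff i α hqC hq1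
  have hA1 : ∀ i, pd i u x1 = c * (α * q x1 ^ (α - 1) * (2 * (x1 i - o i))) := by
    intro i
    have := locmin_pd i hloc
    rw [hpdφ i x1 hq1, pd_rpow i α (hqC.differentiable (by norm_num) x1) hq1, pd_q] at this
    linarith
  have hA2 : ∀ i, c * (α * q x1 ^ (α - 2) * (q x1 * 2 + (α - 1) * (2 * (x1 i - o i)) ^ 2)) ≤ pd i (pd i u) x1 := by
    intro i
    have := locmin_pd_pd i hloc
      (by filter_upwards [hevq] with y hy using (hdu y).sub ((hdq y hy).const_mul c))
      (DifferentiableAt.congr_of_eventuallyEq ((hpdu i).sub ((hdd i).const_mul c)) (hev i))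
    rw [pd_congr i (hev i), pd_sub i (hpdu i) ((hdd i).const_mul c), pd_const_mul i c (hdd i),
      pd_pd_rpow i α hqC hq1, pd_pd_q, pd_q] at this
    linarith
  have hsumq : ∑ i, (x1 i - o i) ^ 2 = q x1 := by
    simp only [hq]; rw [EuclideanSpace.real_norm_sq_eq]; simp
  have h1 : 0 ≤ ∑ i, pd i (pd i u) x1 := by
    refine le_trans (le_of_eq ?_) (Finset.sum_le_sum fun i _ => hA2 i)
    rw [← Finset.mul_sum, ← Finset.mul_sum, Finset.sum_add_distrib, ← Finset.mul_sum]
    simp_rw [mul_pow]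
    rw [← Finset.mul_sum, ← Finset.mul_sum, hsumq]
    simp only [Finset.sum_const, Finset.card_univ, Fintype.card_fin, nsmul_eq_mul]
    have : q x1 * ((d:ℝ) * 2) + (α - 1) * (2 ^ 2 * q x1) = 0 := by rw [hα]; ring
    rw [this]; ring
  have h2 : ∑ i, pd i f x1 * pd i u x1 ≤ 0 := by
    have e : ∑ i, pd i f x1 * pd i u x1 =
        (2 * c * q x1 ^ (α - 1)) * α * ∑ i, pd i f x1 * (x1 i - o i) := by
      rw [Finset.mul_sum]
      refine Finset.sum_congr rfl fun i _ => ?_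
      rw [hA1]; ring
    rw [e]
    have hp : 0 < 2 * c * q x1 ^ (α - 1) := by positivity
    exact mul_nonpos_of_nonpos_of_nonneg (mul_nonpos_of_nonneg_of_nonpos hp.le hα0.le) (hcomp x1)
  linarith [hlap x1]

/-- equation for v -/
lemma v_eq (hd : 3 ≤ d) (f v u : EuclideanSpace ℝ (Fin d) → ℝ)
    (hv : ContDiff ℝ 2 v) (hvpos : ∀ x, 0 < v x) (huv : u = fun x => v x ^ (-(((d:ℝ) - 2) / 2)))
    (x : EuclideanSpace ℝ (Fin d))
    (heq : ∑ i, pd i (pd i u) x - ∑ i, pd i f x * pd i u x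
      + u x ^ (((d : ℝ) + 2) / ((d : ℝ) - 2)) = 0) :
    v x * (∑ i, pd i (pd i v) x - ∑ i, pd i f x * pd i v x) =
      (d:ℝ) / 2 * ∑ i, pd i v x ^ 2 + 2 / ((d:ℝ) - 2) := by
  have hd' : (3:ℝ) ≤ d := by exact_mod_cast hd
  set α : ℝ := -(((d:ℝ) - 2) / 2) with hα
  have hx := hvpos x
  have hdv := hv.differentiable (by norm_num) x
  rw [huv] at heq
  simp_rw [pd_pd_rpow _ α hv hx, pd_rpow _ α hdv hx] at heq
  have e1 : v x ^ (α - 1) = v x ^ (α - 2) * v x := by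
    rw [← Real.rpow_add_one hx.ne']; congr 1; ring
  have e3 : (v x ^ α) ^ (((d : ℝ) + 2) / ((d : ℝ) - 2)) = v x ^ (α - 2) := by
    rw [← Real.rpow_mul hx.le]; congr 1
    have : (d:ℝ) - 2 ≠ 0 := by linarith
    rw [hα]; field_simp; ring
  rw [e3, e1] at heq
  have e2 : ∑ i, pd i f x * (α * (v x ^ (α - 2) * v x) * pd i v x) =
      v x ^ (α - 2) * (α * v x * ∑ i, pd i f x * pd i v x) := by
    simp_rw [Finset.mul_sum]
    refine Finset.sum_congr rfl fun i _ => ?_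
    ring
  have e4 : ∑ i, α * v x ^ (α - 2) * (v x * pd i (pd i v) x + (α - 1) * pd i v x ^ 2) =
      v x ^ (α - 2) * (α * (v x * ∑ i, pd i (pd i v) x + (α - 1) * ∑ i, pd i v x ^ 2)) := by
    simp_rw [Finset.mul_sum]
    rw [← Finset.sum_add_distrib, Finset.mul_sum, Finset.mul_sum]
    refine Finset.sum_congr rfl fun i _ => ?_
    ring
  rw [e2, e4] at heq
  have hp : 0 < v x ^ (α - 2) := Real.rpow_pos_of_pos hx _
  set S := ∑ i, pd i (pd i v) x
  set T := ∑ i, pd i f x * pd i v x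
  set G := ∑ i, pd i v x ^ 2
  have key : α * (v x * S + (α - 1) * G) - α * v x * T + 1 = 0 := by
    have : v x ^ (α - 2) * (α * (v x * S + (α - 1) * G) - α * v x * T + 1) = 0 := by
      linarith
    exact (mul_eq_zero.1 this).resolve_left hp.ne'
  have hd2 : (d:ℝ) - 2 ≠ 0 := by linarith
  rw [hα] at key
  field_simp
  linear_combination (-4) * key

end comparison


section bochner
variable {d : ℕ}

/-- weighted Laplacian -/
noncomputable def PP (f v : EuclideanSpace ℝ (Fin d) → ℝ) (x : EuclideanSpace ℝ (Fin d)) : ℝ :=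
  ∑ i, pd i (pd i v) x - ∑ i, pd i f x * pd i v x

/-- the vector field -/
noncomputable def XX (f v : EuclideanSpace ℝ (Fin d) → ℝ) (i : Fin d)
    (x : EuclideanSpace ℝ (Fin d)) : ℝ :=
  (d:ℝ) * ∑ j, pd i (pd j v) x * pd j v x - PP f v x * pd i v x

/-- the deficit -/
noncomputable def KK (f v : EuclideanSpace ℝ (Fin d) → ℝ) (x : EuclideanSpace ℝ (Fin d)) : ℝ :=
  (d:ℝ) * ∑ i, ∑ j, pd i (pd j v) x ^ 2 - PP f v x ^ 2
    + (d:ℝ) * ∑ i, ∑ j, pd i (pd j f) x * pd i v x * pd j v x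

/-- the weight -/
noncomputable def ww (f v : EuclideanSpace ℝ (Fin d) → ℝ) (k : ℕ)
    (x : EuclideanSpace ℝ (Fin d)) : ℝ := Real.exp (-f x) * (v x ^ k)⁻¹

variable {f v : EuclideanSpace ℝ (Fin d) → ℝ}

lemma pd1_C2 (hv : ContDiff ℝ 3 v) (i : Fin d) : ContDiff ℝ 2 (pd i v) :=
  pd_contDiff (n := 2) i (by simpa using hv)
lemma pd1_C1 (hf : ContDiff ℝ 2 f) (i : Fin d) : ContDiff ℝ 1 (pd i f) :=
  pd_contDiff (n := 1) i (by simpa using hf)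
lemma pd1_C0 (hf : ContDiff ℝ 1 f) (i : Fin d) : Continuous (pd i f) :=
  (pd_contDiff (n := 0) i (by simpa using hf)).continuous

lemma PP_C1 (hf : ContDiff ℝ 2 f) (hv : ContDiff ℝ 3 v) : ContDiff ℝ 1 (PP f v) := by
  unfold PP
  refine ContDiff.sub (ContDiff.sum fun i _ => pd1_C1 (pd1_C2 hv i) i) (ContDiff.sum fun i _ => ?_)
  exact (pd1_C1 hf i).mul ((pd1_C2 hv i).of_le (by norm_num))

lemma XX_C1 (hf : ContDiff ℝ 2 f) (hv : ContDiff ℝ 3 v) (i : Fin d) : ContDiff ℝ 1 (XX f v i) := by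
  unfold XX
  refine ContDiff.sub (contDiff_const.mul (ContDiff.sum fun j _ => ?_)) ?_
  · exact (pd1_C1 (pd1_C2 hv j) i).mul ((pd1_C2 hv j).of_le (by norm_num))
  · exact (PP_C1 hf hv).mul ((pd1_C2 hv i).of_le (by norm_num))

lemma KK_cont (hf : ContDiff ℝ 2 f) (hv : ContDiff ℝ 3 v) : Continuous (KK f v) := by
  unfold KK
  have h1 : ∀ i, Continuous (pd i v) := fun i => (pd1_C2 hv i).continuous
  have h2 : ∀ i j, Continuous (pd i (pd j v)) := fun i j => (pd1_C1 (pd1_C2 hv j) i).continuous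
  have h3 : ∀ i j, Continuous (pd i (pd j f)) := fun i j => pd1_C0 (pd1_C1 hf j) i
  have h4 := (PP_C1 hf hv).continuous
  fun_prop

lemma ww_C1 (hf : ContDiff ℝ 2 f) (hv : ContDiff ℝ 3 v) (hvpos : ∀ x, 0 < v x) (k : ℕ) :
    ContDiff ℝ 1 (ww f v k) := by
  unfold ww
  refine ContDiff.mul ?_ ?_
  · exact (hf.of_le (by norm_num)).neg.exp
  · exact ((hv.of_le (by norm_num)).pow k).inv fun x => (pow_pos (hvpos x) k).ne'

lemma ww_pos (hvpos : ∀ x, 0 < v x) (k : ℕ) (x) : 0 < ww f v k x :=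
  mul_pos (Real.exp_pos _) (inv_pos.2 (pow_pos (hvpos x) k))

lemma ww_succ (hvpos : ∀ x, 0 < v x) (k : ℕ) (x) : ww f v k x = v x * ww f v (k+1) x := by
  unfold ww
  have := (hvpos x).ne'
  field_simp
  ring

lemma pd_ww (hf : ContDiff ℝ 2 f) (hv : ContDiff ℝ 3 v) (hvpos : ∀ x, 0 < v x) (k : ℕ)
    (i : Fin d) (x) :
    pd i (ww f v k) x = ww f v k x * (- pd i f x - k * pd i v x / v x) := by
  have h1 := hf.differentiable (by norm_num) x
  have h2 := hv.differentiable (by norm_num) x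
  have hx := (hvpos x).ne'
  have e1 : HasDerivAt (fun t : ℝ => Real.exp (-t)) (-Real.exp (- f x)) (f x) := by
    simpa using (hasDerivAt_neg (f x)).exp
  have e2 : HasDerivAt (fun t : ℝ => (t ^ k)⁻¹) (-(k * v x ^ (k-1)) / (v x ^ k) ^ 2) (v x) :=
    (hasDerivAt_pow k (v x)).fun_inv (pow_ne_zero _ hx)
  unfold ww
  rw [pd_mul i (h1.fun_neg.exp) ((h2.fun_pow k).fun_inv (pow_ne_zero _ hx)),
    pd_comp i e1 h1, pd_comp i e2 h2]
  rcases k with _ | k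
  · simp
  · simp only [Nat.add_sub_cancel]
    field_simp
    ring

/-- X = v ∇P -/
lemma XX_eq (hf : ContDiff ℝ 2 f) (hv : ContDiff ℝ 3 v) 
    (heq : ∀ x, v x * PP f v x = (d:ℝ) / 2 * ∑ i, pd i v x ^ 2 + 2 / ((d:ℝ) - 2)) (i : Fin d) (x) :
    XX f v i x = v x * pd i (PP f v) x := by
  have hfun : (fun x => v x * PP f v x) = fun x => (d:ℝ) / 2 * ∑ i, pd i v x ^ 2 + 2 / ((d:ℝ) - 2) :=
    funext heq
  have h1 := (PP_C1 hf hv).differentiable (by norm_num) x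
  have h2 := hv.differentiable (by norm_num) x
  have h3 : ∀ j, DifferentiableAt ℝ (pd j v) x := fun j => 
    (pd1_C2 hv j).differentiable (by norm_num) x
  have hd3 : ∀ j ∈ (Finset.univ : Finset (Fin d)), DifferentiableAt ℝ (fun y => pd j v y ^ 2) x :=
    fun j _ => (h3 j).fun_pow 2
  have := congrArg (fun g => pd i g x) hfun
  rw [pd_mul i h2 h1, pd_add i ((DifferentiableAt.fun_sum hd3).const_mul _)
    (differentiableAt_const _), pd_const, pd_const_mul i _ (DifferentiableAt.fun_sum hd3),
    pd_sum i _ hd3] at this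
  have e : ∀ j, pd i (fun y => pd j v y ^ 2) x = 2 * (pd i (pd j v) x * pd j v x) := by
    intro j
    rw [pd_comp i (F := fun t => t^2) (hasDerivAt_pow 2 _) (h3 j)]
    push_cast; ring
  simp_rw [e] at this
  rw [← Finset.mul_sum] at this
  unfold XX
  linarith

lemma third (hf : ContDiff ℝ 2 f) (hv : ContDiff ℝ 3 v) (j : Fin d) (x) :
    ∑ i, pd i (pd i (pd j v)) x = pd j (PP f v) x +
      ∑ i, (pd j (pd i f) x * pd i v x + pd i f x * pd j (pd i v) x) := by
  have hv2 : ContDiff ℝ 2 v := hv.of_le (by norm_num)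
  have e1 : ∀ i, pd i (pd i (pd j v)) x = pd j (pd i (pd i v)) x := by
    intro i
    have : pd i (pd j v) = pd j (pd i v) := funext fun y => pd_comm i j hv2 y
    rw [this, pd_comm i j (pd1_C2 hv i)]
  simp_rw [e1]
  have hdf : ∀ i, DifferentiableAt ℝ (pd i f) x := fun i =>
    (pd1_C1 hf i).differentiable (by norm_num) x
  have hdv : ∀ i, DifferentiableAt ℝ (pd i v) x := fun i =>
    (pd1_C2 hv i).differentiable (by norm_num) x
  have hdvv : ∀ i, DifferentiableAt ℝ (pd i (pd i v)) x := fun i =>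
    (pd1_C1 (pd1_C2 hv i) i).differentiable (by norm_num) x
  have e2 : pd j (PP f v) x = ∑ i, pd j (pd i (pd i v)) x -
      ∑ i, (pd j (pd i f) x * pd i v x + pd i f x * pd j (pd i v) x) := by
    unfold PP
    rw [pd_sub j (DifferentiableAt.fun_sum fun i _ => hdvv i)
      (DifferentiableAt.fun_sum fun i _ => (hdf i).fun_mul (hdv i)),
      pd_sum j _ (fun i _ => hdvv i), pd_sum j _ (fun i _ => (hdf i).fun_mul (hdv i))]
    congr 1
    refine Finset.sum_congr rfl fun i _ => ?_
    rw [pd_mul j (hdf i) (hdv i)]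
  rw [e2]; ring

lemma div_X (hd : 3 ≤ d) (hf : ContDiff ℝ 2 f) (hv : ContDiff ℝ 3 v) (hvpos : ∀ x, 0 < v x)
    (heq : ∀ x, v x * PP f v x = (d:ℝ) / 2 * ∑ i, pd i v x ^ 2 + 2 / ((d:ℝ) - 2)) (x) :
    ∑ i, pd i (fun y => ww f v (d-1) y * XX f v i y) x = ww f v (d-1) x * KK f v x := by
  have hv2 : ContDiff ℝ 2 v := hv.of_le (by norm_num)
  have hcast : ((d - 1 : ℕ) : ℝ) = (d:ℝ) - 1 := by
    rw [Nat.cast_sub (by omega)]; simp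
  have hdw := (ww_C1 hf hv hvpos (d-1)).differentiable (by norm_num) x
  have hP := (PP_C1 hf hv).differentiable (by norm_num) x
  have hdv : ∀ i, DifferentiableAt ℝ (pd i v) x := fun i =>
    (pd1_C2 hv i).differentiable (by norm_num) x
  have hdvv : ∀ i j, DifferentiableAt ℝ (pd i (pd j v)) x := fun i j =>
    (pd1_C1 (pd1_C2 hv j) i).differentiable (by norm_num) x
  have e1 : ∀ i, pd i (fun y => ww f v (d-1) y * XX f v i y) x = ww f v (d-1) x *
      (- pd i f x * XX f v i x - ((d:ℝ) - 1) * pd i v x * pd i (PP f v) x + pd i (XX f v i) x) := by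
    intro i
    rw [pd_mul i hdw ((XX_C1 hf hv i).differentiable (by norm_num) x), pd_ww hf hv hvpos, hcast]
    have := XX_eq hf hv heq i x
    have hx := (hvpos x).ne'
    have h3 : pd i v x / v x * XX f v i x = pd i v x * pd i (PP f v) x := by
      rw [this]; field_simp
    linear_combination (- ww f v (d-1) x * ((d:ℝ) - 1)) * h3
  have e2 : ∀ i, pd i (XX f v i) x = (d:ℝ) * ∑ j, (pd i (pd i (pd j v)) x * pd j v x +
      pd i (pd j v) x ^ 2) - (pd i (PP f v) x * pd i v x + PP f v x * pd i (pd i v) x) := by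
    intro i
    have hs : ∀ j ∈ (Finset.univ : Finset (Fin d)),
      DifferentiableAt ℝ (fun y => pd i (pd j v) y * pd j v y) x := fun j _ =>
        (hdvv i j).fun_mul (hdv j)
    have : XX f v i = fun y => (d:ℝ) * ∑ j, pd i (pd j v) y * pd j v y - PP f v y * pd i v y := rfl
    rw [this, pd_sub i ((DifferentiableAt.fun_sum hs).const_mul _) (hP.fun_mul (hdv i)),
      pd_const_mul i _ (DifferentiableAt.fun_sum hs), pd_sum i _ hs, pd_mul i hP (hdv i)]
    congr 2
    refine Finset.sum_congr rfl fun j _ => ?_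
    rw [pd_mul i (hdvv i j) (hdv j)]; ring
  simp_rw [e1]
  rw [← Finset.mul_sum]
  congr 1
  simp_rw [e2]
  -- now pure algebra
  have t1 : ∑ i, ∑ j, pd i (pd i (pd j v)) x * pd j v x =
      ∑ j, pd j (PP f v) x * pd j v x + ∑ i, ∑ j, pd i (pd j f) x * pd i v x * pd j v x
      + ∑ i, pd i f x * ∑ j, pd i (pd j v) x * pd j v x := by
    rw [Finset.sum_comm]
    have : ∀ j, ∑ i, pd i (pd i (pd j v)) x * pd j v x = pd j (PP f v) x * pd j v x +
       (∑ i, pd j (pd i f) x * pd j v x * pd i v x + 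
        ∑ i, pd i f x * (pd i (pd j v) x * pd j v x)) := by
      intro j
      rw [← Finset.sum_mul, third hf hv, add_mul, Finset.sum_mul, ← Finset.sum_add_distrib]
      congr 1
      refine Finset.sum_congr rfl fun i _ => ?_
      rw [pd_comm i j hv2]; ring
    simp_rw [this]
    rw [Finset.sum_add_distrib, Finset.sum_add_distrib, ← add_assoc]
    congr 1
    rw [Finset.sum_comm]
    refine Finset.sum_congr rfl fun i _ => ?_
    rw [Finset.mul_sum]
  have t2 : ∑ i, pd i f x * XX f v i x = (d:ℝ) * ∑ i, pd i f x * ∑ j, pd i (pd j v) x * pd j v x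
      - PP f v x * ∑ i, pd i f x * pd i v x := by
    unfold XX
    rw [Finset.mul_sum, Finset.mul_sum, ← Finset.sum_sub_distrib]
    refine Finset.sum_congr rfl fun i _ => ?_
    ring
  have hPd : PP f v x = ∑ i, pd i (pd i v) x - ∑ i, pd i f x * pd i v x := rfl
  have t3 : ∑ i, (- pd i f x * XX f v i x - ((d:ℝ) - 1) * pd i v x * pd i (PP f v) x +
      ((d:ℝ) * ∑ j, (pd i (pd i (pd j v)) x * pd j v x + pd i (pd j v) x ^ 2) -
        (pd i (PP f v) x * pd i v x + PP f v x * pd i (pd i v) x))) =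
      - ∑ i, pd i f x * XX f v i x - (d:ℝ) * ∑ i, pd i (PP f v) x * pd i v x +
      (d:ℝ) * (∑ i, ∑ j, pd i (pd i (pd j v)) x * pd j v x + ∑ i, ∑ j, pd i (pd j v) x ^ 2) -
      PP f v x * ∑ i, pd i (pd i v) x := by
    have s1 : ∑ i, ∑ j, pd i (pd i (pd j v)) x * pd j v x + ∑ i, ∑ j, pd i (pd j v) x ^ 2 =
        ∑ i, ∑ j, (pd i (pd i (pd j v)) x * pd j v x + pd i (pd j v) x ^ 2) := by
      simp_rw [Finset.sum_add_distrib]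
    rw [s1, Finset.mul_sum, Finset.mul_sum, Finset.mul_sum,
      ← Finset.sum_neg_distrib, ← Finset.sum_sub_distrib, ← Finset.sum_add_distrib,
      ← Finset.sum_sub_distrib]
    refine Finset.sum_congr rfl fun i _ => ?_
    ring
  rw [t3, t1, t2]
  unfold KK
  have hPd2 : ∑ i, pd i (pd i v) x = PP f v x + ∑ i, pd i f x * pd i v x := by rw [hPd]; ring
  rw [hPd2]
  ring

lemma div_Y (hd : 3 ≤ d) (hf : ContDiff ℝ 2 f) (hv : ContDiff ℝ 3 v) (hvpos : ∀ x, 0 < v x)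
    (heq : ∀ x, v x * PP f v x = (d:ℝ) / 2 * ∑ i, pd i v x ^ 2 + 2 / ((d:ℝ) - 2)) (x) :
    ∑ i, pd i (fun y => ww f v (d-1) y * pd i v y) x =
      ww f v d x * (2 / ((d:ℝ) - 2) - ((d:ℝ) / 2 - 1) * ∑ i, pd i v x ^ 2) := by
  have hcast : ((d - 1 : ℕ) : ℝ) = (d:ℝ) - 1 := by
    rw [Nat.cast_sub (by omega)]; simp
  have hdw := (ww_C1 hf hv hvpos (d-1)).differentiable (by norm_num) x
  have hdv : ∀ i, DifferentiableAt ℝ (pd i v) x := fun i =>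
    (pd1_C2 hv i).differentiable (by norm_num) x
  have hw : ww f v (d-1) x = v x * ww f v d x := by
    have := ww_succ (f := f) hvpos (d-1) x
    rwa [Nat.sub_add_cancel (by omega)] at this
  have hx := (hvpos x).ne'
  have e1 : ∀ i, pd i (fun y => ww f v (d-1) y * pd i v y) x = ww f v d x *
      (v x * (pd i (pd i v) x - pd i f x * pd i v x) - ((d:ℝ) - 1) * pd i v x ^ 2) := by
    intro i
    rw [pd_mul i hdw (hdv i), pd_ww hf hv hvpos, hcast, hw]
    field_simp
    ring
  simp_rw [e1]
  rw [← Finset.mul_sum, Finset.sum_sub_distrib, ← Finset.mul_sum, ← Finset.mul_sum,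
    Finset.sum_sub_distrib]
  have := heq x
  unfold PP at this
  rw [this]; ring

lemma KK_ge (hd : 3 ≤ d) (hvpos : ∀ x, 0 < v x)
    (hconv : ∀ x, ∀ ξ : Fin d → ℝ, 0 ≤ ∑ i, ∑ j, pd i (pd j f) x * ξ i * ξ j)
    (hsgn : ∀ x, 0 ≤ ∑ i, pd i f x * pd i v x)
    (heq : ∀ x, v x * PP f v x = (d:ℝ) / 2 * ∑ i, pd i v x ^ 2 + 2 / ((d:ℝ) - 2)) (x) :
    (d:ℝ) * ∑ i, ∑ j, (pd i (pd j v) x - if i = j then PP f v x / d else 0) ^ 2 ≤ KK f v x := by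
  have hd' : (3:ℝ) ≤ d := by exact_mod_cast hd
  have hP : 0 ≤ PP f v x := by
    have h1 : 0 ≤ v x * PP f v x := by
      rw [heq]
      have : 0 ≤ ∑ i, pd i v x ^ 2 := Finset.sum_nonneg fun i _ => sq_nonneg _
      have : 0 < (d:ℝ) - 2 := by linarith
      positivity
    exact nonneg_of_mul_nonneg_right h1 (hvpos x)
  have e : ∑ i, ∑ j, (pd i (pd j v) x - if i = j then PP f v x / d else 0) ^ 2 =
      ∑ i, ∑ j, pd i (pd j v) x ^ 2 - 2 * (PP f v x / d) * ∑ i, pd i (pd i v) x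
       + d * (PP f v x / d) ^ 2 := by
    have : ∀ i j, (pd i (pd j v) x - if i = j then PP f v x / d else 0) ^ 2 =
        pd i (pd j v) x ^ 2 + if i = j then (- 2 * (PP f v x / d) * pd i (pd j v) x + (PP f v x / d)^2) else 0 := by
      intro i j
      split_ifs <;> ring
    simp_rw [this, Finset.sum_add_distrib, Finset.sum_ite_eq]
    simp [Finset.sum_add_distrib, ← Finset.mul_sum]
    ring
  rw [e]
  unfold KK
  have h1 := hconv x (fun i => pd i v x)
  have h2 : ∑ i, pd i (pd i v) x = PP f v x + ∑ i, pd i f x * pd i v x := by unfold PP; ring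
  rw [h2]
  have h3 := mul_nonneg hP (hsgn x)
  have h4 : 0 ≤ (d:ℝ) * ∑ i, ∑ j, pd i (pd j f) x * pd i v x * pd j v x := by positivity
  set T := ∑ i, pd i f x * pd i v x
  set S := ∑ i, ∑ j, pd i (pd j v) x ^ 2
  have h5 : (d:ℝ) * (S - 2 * (PP f v x / d) * (PP f v x + T) + d * (PP f v x / d) ^ 2) =
      d * S - PP f v x ^ 2 - 2 * (PP f v x * T) := by
    field_simp; ring
  rw [h5]; linarith

lemma XX_bound (hd : 3 ≤ d) (hvpos : ∀ x, 0 < v x)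
    (hconv : ∀ x, ∀ ξ : Fin d → ℝ, 0 ≤ ∑ i, ∑ j, pd i (pd j f) x * ξ i * ξ j)
    (hsgn : ∀ x, 0 ≤ ∑ i, pd i f x * pd i v x)
    (heq : ∀ x, v x * PP f v x = (d:ℝ) / 2 * ∑ i, pd i v x ^ 2 + 2 / ((d:ℝ) - 2)) (x) :
    ∑ i, XX f v i x ^ 2 ≤ (d:ℝ) * KK f v x * ∑ i, pd i v x ^ 2 := by
  have hd' : (3:ℝ) ≤ d := by exact_mod_cast hd
  have e : ∀ i, XX f v i x = d * ∑ j, (pd i (pd j v) x - if i = j then PP f v x / d else 0) * pd j v x := by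
    intro i
    unfold XX
    simp_rw [sub_mul, Finset.sum_sub_distrib, ite_mul, zero_mul, Finset.sum_ite_eq]
    simp
    field_simp
  have hG : 0 ≤ ∑ i, pd i v x ^ 2 := Finset.sum_nonneg fun i _ => sq_nonneg _
  calc ∑ i, XX f v i x ^ 2 ≤ ∑ i, (d:ℝ)^2 * ((∑ j, (pd i (pd j v) x - if i = j then PP f v x / d else 0)^2) * ∑ j, pd j v x ^ 2) := by
        refine Finset.sum_le_sum fun i _ => ?_
        rw [e, mul_pow]
        exact mul_le_mul_of_nonneg_left (Finset.sum_mul_sq_le_sq_mul_sq _ _ _) (by positivity)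
    _ = (d:ℝ) * (d * ∑ i, ∑ j, (pd i (pd j v) x - if i = j then PP f v x / d else 0) ^ 2) * ∑ i, pd i v x ^ 2 := by
        rw [← Finset.mul_sum, ← Finset.sum_mul]; ring
    _ ≤ _ := by
        refine mul_le_mul_of_nonneg_right (mul_le_mul_of_nonneg_left ?_ (by positivity)) hG
        exact KK_ge hd hvpos hconv hsgn heq x

end bochner


section cutoffs
variable {d : ℕ}

lemma cutoff (o : EuclideanSpace ℝ (Fin d)) : ∃ M : ℝ, 0 ≤ M ∧ ∀ R : ℝ, 1 ≤ R →
    ∃ η : EuclideanSpace ℝ (Fin d) → ℝ, ContDiff ℝ 1 η ∧ HasCompactSupport η ∧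
      (∀ x, 0 ≤ η x) ∧ (∀ x, η x ≤ 1) ∧ (∀ x, ‖x - o‖ ≤ R → η x = 1) ∧
      (∀ x, 2 * R ≤ ‖x - o‖ → η x = 0) ∧
      (∀ x, ∑ i, pd i η x ^ 2 ≤ (M / R) ^ 2) ∧
      (∀ x, (‖x - o‖ < R ∨ 2 * R < ‖x - o‖) → ∑ i, pd i η x ^ 2 = 0) := by
  let b : ContDiffBump (0 : EuclideanSpace ℝ (Fin d)) := ⟨1, 2, by norm_num, by norm_num⟩
  have hb : ContDiff ℝ 1 b := b.contDiff
  have hbc : HasCompactSupport b := b.hasCompactSupport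
  have hcont : Continuous (fun x => ∑ i, pd i b x ^ 2) := by
    have := fun i => pd1_C0 hb i
    fun_prop
  have hsupp : HasCompactSupport (fun x => ∑ i, pd i b x ^ 2) := by
    refine (hbc.fderiv (𝕜 := ℝ)).mono ?_
    intro x hx
    simp only [Function.mem_support] at hx ⊢
    intro h; apply hx
    simp [pd, h]
  obtain ⟨M, hM⟩ := hcont.bounded_above_of_compact_support hsupp
  refine ⟨Real.sqrt M, Real.sqrt_nonneg _, fun R hR => ?_⟩
  have hR0 : 0 < R := by linarith
  have hM0 : 0 ≤ M := le_trans (norm_nonneg _) (hM 0)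
  set η : EuclideanSpace ℝ (Fin d) → ℝ := fun x => b (R⁻¹ • (x - o)) with hη
  have hn : ∀ x, ‖R⁻¹ • (x - o)‖ = ‖x - o‖ / R := by
    intro x; rw [norm_smul, Real.norm_of_nonneg (by positivity)]; field_simp
  have h1 : ∀ x, ‖x - o‖ ≤ R → η x = 1 := by
    intro x hx
    refine b.one_of_mem_closedBall ?_
    simp only [mem_closedBall_zero_iff, hn]
    rw [div_le_iff₀ hR0]; simpa [b] using hx
  have h2 : ∀ x, 2 * R ≤ ‖x - o‖ → η x = 0 := by
    intro x hx
    refine b.zero_of_le_dist ?_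
    rw [dist_zero_right, hn, le_div_iff₀ hR0]; simpa [b] using hx
  have hpd : ∀ i x, pd i η x = R⁻¹ * pd i b (R⁻¹ • (x - o)) := by
    intro i x
    unfold pd
    have ha : HasFDerivAt (fun x : EuclideanSpace ℝ (Fin d) => R⁻¹ • (x - o))
        (R⁻¹ • ContinuousLinearMap.id ℝ (EuclideanSpace ℝ (Fin d))) x :=
      ((hasFDerivAt_id x).sub_const o).const_smul R⁻¹
    have hc := (hb.differentiable (by norm_num) (R⁻¹ • (x - o))).hasFDerivAt.comp x ha
    have : fderiv ℝ η x = _ := hc.fderiv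
    rw [this]; simp
  refine ⟨η, hb.comp (by fun_prop : ContDiff ℝ 1 fun x : EuclideanSpace ℝ (Fin d) => R⁻¹ • (x - o)), ?_, 
    fun x => b.nonneg, fun x => b.le_one, h1, h2, ?_, ?_⟩
  · refine HasCompactSupport.of_support_subset_isCompact (isCompact_closedBall o (2 * R)) ?_
    intro x hx
    rw [mem_closedBall_iff_norm]
    by_contra! h
    exact hx (h2 x h.le)
  · intro x
    simp_rw [hpd, mul_pow]
    rw [← Finset.mul_sum, div_pow, Real.sq_sqrt hM0]
    have := le_trans (le_abs_self _) (hM (R⁻¹ • (x - o)))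
    calc R⁻¹ ^ 2 * ∑ i, pd i b (R⁻¹ • (x - o)) ^ 2 ≤ R⁻¹ ^ 2 * M :=
          mul_le_mul_of_nonneg_left this (by positivity)
      _ = M / R ^ 2 := by field_simp
  · intro x hx
    have hco : Continuous fun y : EuclideanSpace ℝ (Fin d) => ‖y - o‖ := by fun_prop
    refine Finset.sum_eq_zero fun i _ => ?_
    rcases hx with hx | hx
    · have : η =ᶠ[nhds x] fun _ => 1 := by
        filter_upwards [hco.continuousAt.eventually (gt_mem_nhds hx)] with y hy
        exact h1 y hy.le
      rw [pd_congr i this, pd_const]; simp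
    · have : η =ᶠ[nhds x] fun _ => 0 := by
        filter_upwards [hco.continuousAt.eventually (lt_mem_nhds hx)] with y hy
        exact h2 y hy.le
      rw [pd_congr i this, pd_const]; simp

lemma cs_mul_sq {g η : EuclideanSpace ℝ (Fin d) → ℝ} (hη : HasCompactSupport η) :
    HasCompactSupport (fun x => g x * η x ^ 2) := by
  refine hη.mono ?_
  intro y hy
  simp only [Function.mem_support] at hy ⊢
  intro h; apply hy; simp [h]

variable {f v : EuclideanSpace ℝ (Fin d) → ℝ}

lemma ibp_integrable (X : Fin d → EuclideanSpace ℝ (Fin d) → ℝ) (η : EuclideanSpace ℝ (Fin d) → ℝ)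
    (hX : ∀ i, ContDiff ℝ 1 (X i)) (hη : ContDiff ℝ 1 η) (hc : HasCompactSupport η) :
    Integrable fun x => ((∑ i, pd i (X i) x) * η x ^ 2 + 2 * η x * ∑ i, X i x * pd i η x) := by
  have h1 := fun i => pd1_C0 (hX i) i
  have h2 := fun i => pd1_C0 hη i
  have h3 := fun i => (hX i).continuous
  have h4 := hη.continuous
  refine Continuous.integrable_of_hasCompactSupport (by fun_prop) ?_
  refine hc.mono ?_
  intro y hy
  simp only [Function.mem_support] at hy ⊢
  intro h; apply hy; simp [h]

lemma energy (hd : 3 ≤ d) (hf : ContDiff ℝ 2 f) (hv : ContDiff ℝ 3 v) (hvpos : ∀ x, 0 < v x)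
    (heq : ∀ x, v x * PP f v x = (d:ℝ) / 2 * ∑ i, pd i v x ^ 2 + 2 / ((d:ℝ) - 2))
    (o : EuclideanSpace ℝ (Fin d)) (C : ℝ)
    (hvol : ∀ R : ℝ, 1 ≤ R → (∫ x in Metric.ball o R, Real.exp (-f x)) ≤ C * R ^ d)
    (hE : Integrable (ww f v d)) :
    Integrable (fun x => ww f v d x * ∑ i, pd i v x ^ 2) := by
  have hd' : (3:ℝ) ≤ d := by exact_mod_cast hd
  obtain ⟨M, hM0, hM⟩ := cutoff o
  have hgc : Continuous (fun x => ww f v d x * ∑ i, pd i v x ^ 2) := by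
    have h1 := (ww_C1 hf hv hvpos d).continuous
    have h2 := fun i => (pd1_C2 hv i).continuous
    fun_prop
  have hfc : Continuous (fun x => Real.exp (-f x)) := hf.continuous.neg.rexp
  have hwp := fun k x => ww_pos (f := f) hvpos k x
  have hg0 : ∀ x, 0 ≤ ∑ i, pd i v x ^ 2 := fun x => Finset.sum_nonneg fun i _ => sq_nonneg _
  set δ : ℝ := ((d:ℝ) - 2) / 4 with hδ
  have hδ0 : 0 < δ := by rw [hδ]; linarith
  have hdδ : (d:ℝ) - 2 = 4 * δ := by rw [hδ]; ring
  have main : ∀ R : ℝ, 1 ≤ R → ∫ x in Metric.ball o R, ww f v d x * ∑ i, pd i v x ^ 2 ≤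
      (2 / δ * (∫ x, ww f v d x) + 1 / δ * (M ^ d * (C * 3 ^ d))) / δ := by
    intro R hR
    have hR0 : 0 < R := by linarith
    obtain ⟨η, hη, hηc, hη0, hη1, hηR, hη2R, hηg, hηz⟩ := hM R hR
    have hXc : ∀ i, ContDiff ℝ 1 (fun y => ww f v (d-1) y * pd i v y) := fun i =>
      (ww_C1 hf hv hvpos (d-1)).mul ((pd1_C2 hv i).of_le (by norm_num))
    have h0 := ibp (fun i y => ww f v (d-1) y * pd i v y) η hXc hη hηc
    have hI := ibp_integrable (fun i y => ww f v (d-1) y * pd i v y) η hXc hη hηc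
    simp_rw [div_Y hd hf hv hvpos heq] at h0 hI
    have hA : Integrable (fun x => (ww f v d x * ∑ i, pd i v x ^ 2) * η x ^ 2) :=
      Continuous.integrable_of_hasCompactSupport (hgc.mul (hη.continuous.pow 2)) (cs_mul_sq hηc)
    have hB : IntegrableOn (fun x => Real.exp (-f x)) (Metric.ball o (3 * R)) :=
      (hfc.continuousOn.integrableOn_compact (isCompact_closedBall o (3 * R))).mono_set
        Metric.ball_subset_closedBall
    have hB' : Integrable ((Metric.ball o (3 * R)).indicator (fun x => Real.exp (-f x))) :=
      hB.integrable_indicator measurableSet_ball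
    have hpt : ∀ x, ww f v d x * (2 / ((d:ℝ) - 2) - ((d:ℝ) / 2 - 1) * ∑ i, pd i v x ^ 2) * η x ^ 2 +
        2 * η x * ∑ i, ww f v (d-1) x * pd i v x * pd i η x ≤
        - δ * ((ww f v d x * ∑ i, pd i v x ^ 2) * η x ^ 2) + (2 / δ * ww f v d x +
         1 / δ * ((M / R) ^ d * (Metric.ball o (3 * R)).indicator (fun x => Real.exp (-f x)) x)) := by
      intro x
      have hw1 : ww f v (d-1) x = v x * ww f v d x := by
        have := ww_succ (f := f) hvpos (d-1) x
        rwa [Nat.sub_add_cancel (by omega)] at this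
      have hw := hwp d x
      have hvx := hvpos x
      set W := ww f v d x with hW
      have step1 : 2 * η x * ∑ i, ww f v (d-1) x * pd i v x * pd i η x ≤
          W * (δ * η x ^ 2 * ∑ i, pd i v x ^ 2 + 1 / δ * (v x ^ 2 * ∑ i, pd i η x ^ 2)) := by
        rw [Finset.mul_sum, Finset.mul_sum, Finset.mul_sum, Finset.mul_sum,
          ← Finset.sum_add_distrib, Finset.mul_sum]
        refine Finset.sum_le_sum fun i _ => ?_
        rw [hw1]
        have : 2 * (η x * pd i v x) * (v x * pd i η x) ≤
            δ * (η x * pd i v x) ^ 2 + 1 / δ * (v x * pd i η x) ^ 2 := by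
          have h := sq_nonneg (δ * (η x * pd i v x) - v x * pd i η x)
          have : δ * (η x * pd i v x) ^ 2 + 1 / δ * (v x * pd i η x) ^ 2 - 2 * (η x * pd i v x) * (v x * pd i η x) =
              1 / δ * (δ * (η x * pd i v x) - v x * pd i η x) ^ 2 := by field_simp; ring
          have : 0 ≤ 1 / δ * (δ * (η x * pd i v x) - v x * pd i η x) ^ 2 := by positivity
          linarith
        calc _ = W * (2 * (η x * pd i v x) * (v x * pd i η x)) := by ring
          _ ≤ W * (δ * (η x * pd i v x) ^ 2 + 1 / δ * (v x * pd i η x) ^ 2) :=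
            mul_le_mul_of_nonneg_left this hw.le
          _ = _ := by ring
      have step2 : W * (v x ^ 2 * ∑ i, pd i η x ^ 2) ≤ W + 
          (M / R) ^ d * (Metric.ball o (3 * R)).indicator (fun x => Real.exp (-f x)) x := by
        by_cases hx : x ∈ Metric.ball o (3 * R)
        · rw [Set.indicator_of_mem hx]
          have hMR : 0 ≤ M / R := by positivity
          have hWe : W = Real.exp (-f x) * (v x ^ d)⁻¹ := rfl
          have hWe2 : W * v x ^ d = Real.exp (-f x) := by rw [hWe]; field_simp
          have hm := mul_le_mul_of_nonneg_left (hηg x) (sq_nonneg (v x))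
          have hvM : v x ^ 2 * ∑ i, pd i η x ^ 2 ≤ (v x * (M / R)) ^ 2 := by
            rw [mul_pow]; exact hm
          have hor : (v x * (M / R)) ^ 2 ≤ 1 + (v x * (M / R)) ^ d := by
            have hnn : 0 ≤ v x * (M / R) := by positivity
            rcases le_total (v x * (M / R)) 1 with h | h
            · have := pow_le_one₀ (n := 2) hnn h
              have := pow_nonneg hnn d
              linarith
            · have := pow_le_pow_right₀ h (show 2 ≤ d by omega)
              linarith
          calc W * (v x ^ 2 * ∑ i, pd i η x ^ 2) ≤ W * (1 + (v x * (M / R)) ^ d) :=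
                mul_le_mul_of_nonneg_left (hvM.trans hor) hw.le
            _ = W + (M / R) ^ d * (W * v x ^ d) := by rw [mul_pow]; ring
            _ = _ := by rw [hWe2]
        · rw [Set.indicator_of_notMem hx]
          rw [mem_ball_iff_norm, not_lt] at hx
          rw [hηz x (Or.inr (by linarith))]
          simp [hw.le]
      have step3 : W * η x ^ 2 ≤ W := by
        have := pow_le_one₀ (n := 2) (hη0 x) (hη1 x)
        exact mul_le_of_le_one_right hw.le this
      have e2 : (d:ℝ) / 2 - 1 = 2 * δ := by linarith
      rw [e2, hdδ]
      have hx1 : W * (2 / (4 * δ) - 2 * δ * ∑ i, pd i v x ^ 2) * η x ^ 2 = 1 / (2 * δ) * (W * η x ^ 2)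
          - 2 * δ * (W * (∑ i, pd i v x ^ 2) * η x ^ 2) := by field_simp; ring
      have hx2 : 1 / (2 * δ) * (W * η x ^ 2) ≤ 1 / δ * W := by
        have : 1 / (2 * δ) ≤ 1 / δ := by
          apply one_div_le_one_div_of_le hδ0; linarith
        exact mul_le_mul this step3 (by positivity) (by positivity)
      have hx3 := mul_le_mul_of_nonneg_left step2 (show 0 ≤ 1 / δ by positivity)
      have e5 : 2 / δ * W = 1 / δ * W + 1 / δ * W := by ring
      rw [hx1, e5]
      linarith [step1]
    have hBB : Integrable (fun x => 2 / δ * ww f v d x +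
         1 / δ * ((M / R) ^ d * (Metric.ball o (3 * R)).indicator (fun x => Real.exp (-f x)) x)) :=
      (hE.const_mul (2 / δ)).add ((hB'.const_mul ((M / R) ^ d)).const_mul (1 / δ))
    have hineq := integral_mono hI ((hA.const_mul (-δ)).add hBB) hpt
    rw [h0] at hineq
    simp only [Pi.add_apply] at hineq
    rw [integral_add (hA.const_mul (-δ)) hBB, integral_add (hE.const_mul (2 / δ))
      ((hB'.const_mul ((M / R) ^ d)).const_mul (1 / δ)), integral_const_mul, integral_const_mul,
      integral_const_mul, integral_const_mul, integral_indicator measurableSet_ball] at hineq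
    have hv3 := hvol (3 * R) (by linarith)
    have hbound : (M / R) ^ d * ∫ x in Metric.ball o (3 * R), Real.exp (-f x) ≤ M ^ d * (C * 3 ^ d) := by
      calc _ ≤ (M / R) ^ d * (C * (3 * R) ^ d) := mul_le_mul_of_nonneg_left hv3 (by positivity)
        _ = _ := by rw [div_pow, mul_pow]; field_simp
    have hb2 := mul_le_mul_of_nonneg_left hbound (show 0 ≤ 1 / δ by positivity)
    have hball : ∫ x in Metric.ball o R, ww f v d x * ∑ i, pd i v x ^ 2 ≤
        ∫ x, (ww f v d x * ∑ i, pd i v x ^ 2) * η x ^ 2 := by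
      rw [← integral_indicator measurableSet_ball]
      refine integral_mono ?_ hA ?_
      · exact ((hgc.continuousOn.integrableOn_compact (isCompact_closedBall o R)).mono_set
          Metric.ball_subset_closedBall).integrable_indicator measurableSet_ball
      · intro x
        by_cases hx : x ∈ Metric.ball o R
        · simp only [Set.indicator_of_mem hx]
          rw [hηR x (by rw [mem_ball_iff_norm] at hx; exact hx.le)]; simp
        · simp only [Set.indicator_of_notMem hx]
          have := hwp d x
          have := hg0 x
          positivity
    rw [le_div_iff₀ hδ0]
    have := mul_le_mul_of_nonneg_right hball hδ0.le
    linarith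
  have hcov : AECover (volume : Measure (EuclideanSpace ℝ (Fin d))) atTop
      (fun n : ℕ => Metric.ball o (n : ℝ)) := aecover_ball tendsto_natCast_atTop_atTop
  refine hcov.integrable_of_integral_bounded_of_nonneg_ae _ (fun n => ?_) ?_ 
    ((eventually_ge_atTop 1).mono fun n hn => main n (by exact_mod_cast hn))
  · exact (hgc.continuousOn.integrableOn_compact (isCompact_closedBall o n)).mono_set
          Metric.ball_subset_closedBall
  · exact Eventually.of_forall fun x => mul_nonneg (hwp d x).le (hg0 x)

end cutoffs


section rigidity
variable {d : ℕ} {f v : EuclideanSpace ℝ (Fin d) → ℝ}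

lemma KK_zero (hd : 3 ≤ d) (hf : ContDiff ℝ 2 f) (hv : ContDiff ℝ 3 v) (hvpos : ∀ x, 0 < v x)
    (hconv : ∀ x, ∀ ξ : Fin d → ℝ, 0 ≤ ∑ i, ∑ j, pd i (pd j f) x * ξ i * ξ j)
    (hsgn : ∀ x, 0 ≤ ∑ i, pd i f x * pd i v x)
    (heq : ∀ x, v x * PP f v x = (d:ℝ) / 2 * ∑ i, pd i v x ^ 2 + 2 / ((d:ℝ) - 2))
    (o : EuclideanSpace ℝ (Fin d)) (C0 : ℝ) (hC0 : 0 ≤ C0)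
    (hvb : ∀ x, 1 ≤ ‖x - o‖ → v x ≤ C0 * ‖x - o‖ ^ 2)
    (hG : Integrable (fun x => ww f v d x * ∑ i, pd i v x ^ 2)) (x1) : KK f v x1 = 0 := by
  have hd' : (3:ℝ) ≤ d := by exact_mod_cast hd
  obtain ⟨M, hM0, hM⟩ := cutoff o
  have hK0 : ∀ x, 0 ≤ KK f v x := fun x => by
    refine le_trans ?_ (KK_ge hd hvpos hconv hsgn heq x)
    have : 0 ≤ ∑ i, ∑ j, (pd i (pd j v) x - if i = j then PP f v x / d else 0) ^ 2 :=
      Finset.sum_nonneg fun i _ => Finset.sum_nonneg fun j _ => sq_nonneg _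
    positivity
  have hwp := fun k x => ww_pos (f := f) hvpos k x
  have hg0 : ∀ x, 0 ≤ ∑ i, pd i v x ^ 2 := fun x => Finset.sum_nonneg fun i _ => sq_nonneg _
  have hwK : Continuous fun x => ww f v (d-1) x * KK f v x :=
    (ww_C1 hf hv hvpos (d-1)).continuous.mul (KK_cont hf hv)
  have hwK0 : ∀ x, 0 ≤ ww f v (d-1) x * KK f v x := fun x => mul_nonneg (hwp _ x).le (hK0 x)
  choose! η hη hηc hη0 hη1 hηR hη2R hηg hηz using hM
  have hA : ∀ R, 1 ≤ R → Integrable (fun x => (ww f v (d-1) x * KK f v x) * η R x ^ 2) := fun R hR =>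
    Continuous.integrable_of_hasCompactSupport (hwK.mul ((hη R hR).continuous.pow 2))
      (cs_mul_sq (hηc R hR))
  have hco : Continuous fun y : EuclideanSpace ℝ (Fin d) => ‖y - o‖ := by fun_prop
  have hms : ∀ R : ℝ, MeasurableSet {x : EuclideanSpace ℝ (Fin d) | R ≤ ‖x - o‖} := fun R =>
    (isClosed_le continuous_const hco).measurableSet
  have main : ∀ R : ℝ, 1 ≤ R → ∫ x, (ww f v (d-1) x * KK f v x) * η R x ^ 2 ≤
      (16 * d * C0 * M ^ 2) * ∫ x in {x | R ≤ ‖x - o‖}, ww f v d x * ∑ i, pd i v x ^ 2 := by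
    intro R hR
    have hR0 : 0 < R := by linarith
    have hXc : ∀ i, ContDiff ℝ 1 (fun y => ww f v (d-1) y * XX f v i y) := fun i =>
      (ww_C1 hf hv hvpos (d-1)).mul (XX_C1 hf hv i)
    have h0 := ibp (fun i y => ww f v (d-1) y * XX f v i y) (η R) hXc (hη R hR) (hηc R hR)
    have hI := ibp_integrable (fun i y => ww f v (d-1) y * XX f v i y) (η R) hXc (hη R hR) (hηc R hR)
    simp_rw [div_X hd hf hv hvpos heq] at h0 hI
    have hB : Integrable ({x | R ≤ ‖x - o‖}.indicator (fun x => ww f v d x * ∑ i, pd i v x ^ 2)) :=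
      hG.indicator (hms R)
    have hpt : ∀ x, 1 / 2 * ((ww f v (d-1) x * KK f v x) * η R x ^ 2) -
        (8 * d * C0 * M ^ 2) * {x | R ≤ ‖x - o‖}.indicator (fun x => ww f v d x * ∑ i, pd i v x ^ 2) x
        ≤ ww f v (d-1) x * KK f v x * η R x ^ 2 +
          2 * η R x * ∑ i, ww f v (d-1) x * XX f v i x * pd i (η R) x := by
      intro x
      have hw1 : ww f v (d-1) x = v x * ww f v d x := by
        have := ww_succ (f := f) hvpos (d-1) x
        rwa [Nat.sub_add_cancel (by omega)] at this
      have hw := hwp d x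
      have hw' := hwp (d-1) x
      have hvx := hvpos x
      have hXb := XX_bound hd hvpos hconv hsgn heq x
      set Z := ∑ i, XX f v i x * pd i (η R) x with hZ
      set g := ∑ i, pd i v x ^ 2 with hg
      set s := ∑ i, pd i (η R) x ^ 2 with hs
      have hs0 : 0 ≤ s := Finset.sum_nonneg fun i _ => sq_nonneg _
      have hg0' : 0 ≤ g := hg0 x
      have hZ2 : Z ^ 2 ≤ (d * KK f v x * g) * s :=
        (Finset.sum_mul_sq_le_sq_mul_sq _ _ _).trans (mul_le_mul_of_nonneg_right hXb hs0)
      have e1 : ∑ i, ww f v (d-1) x * XX f v i x * pd i (η R) x = ww f v (d-1) x * Z := by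
        rw [hZ, Finset.mul_sum]; exact Finset.sum_congr rfl fun i _ => by ring
      have hy : -(2 * η R x * Z) ≤ 1 / 2 * KK f v x * η R x ^ 2 + 2 * d * g * s := by
        have hK := hK0 x
        refine (neg_le_abs _).trans (abs_le_of_sq_le_sq ?_ (by positivity))
        have h4 := mul_le_mul_of_nonneg_left hZ2 (show 0 ≤ 4 * η R x ^ 2 by positivity)
        nlinarith [sq_nonneg (1 / 2 * KK f v x * η R x ^ 2 - 2 * d * g * s)]
      have hvs : ww f v (d-1) x * (2 * d * g * s) ≤ (8 * d * C0 * M ^ 2) * {x | R ≤ ‖x - o‖}.indicator (fun x => ww f v d x * ∑ i, pd i v x ^ 2) x := by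
        by_cases hx : R ≤ ‖x - o‖
        · rw [Set.indicator_of_mem (by exact hx)]
          rcases lt_or_ge (2 * R) ‖x - o‖ with h | h
          · have : s = 0 := hηz R hR x (Or.inr h)
            rw [this]; simp; positivity
          · have hv1 : v x ≤ C0 * (2 * R) ^ 2 := (hvb x (hR.trans hx)).trans (by gcongr)
            have hs1 : s ≤ (M / R) ^ 2 := hηg R hR x
            have hvs1 : v x * s ≤ C0 * (2 * R) ^ 2 * (M / R) ^ 2 :=
              mul_le_mul hv1 hs1 hs0 (by positivity)
            have e3 : C0 * (2 * R) ^ 2 * (M / R) ^ 2 = 4 * C0 * M ^ 2 := by field_simp; ring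
            rw [e3] at hvs1
            rw [hw1]
            have := mul_le_mul_of_nonneg_left hvs1 (show 0 ≤ 2 * d * (ww f v d x * g) by positivity)
            calc _ = 2 * d * (ww f v d x * g) * (v x * s) := by ring
              _ ≤ _ := this
              _ = _ := by ring
        · rw [Set.indicator_of_notMem (by exact hx)]
          have : s = 0 := hηz R hR x (Or.inl (not_le.1 hx))
          rw [this]; simp
      rw [e1]
      have := mul_le_mul_of_nonneg_left hy hw'.le
      linarith
    have hineq := integral_mono (((hA R hR).const_mul (1/2)).sub (hB.const_mul (8 * d * C0 * M ^ 2))) hI hpt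
    rw [h0] at hineq
    simp only [Pi.sub_apply] at hineq
    rw [integral_sub ((hA R hR).const_mul (1/2)) (hB.const_mul (8 * d * C0 * M ^ 2)),
      integral_const_mul, integral_const_mul, integral_indicator (hms R)] at hineq
    linarith
  have htail : Tendsto (fun n : ℕ => (16 * d * C0 * M ^ 2) * ∫ x in {x | (n:ℝ) ≤ ‖x - o‖}, ww f v d x * ∑ i, pd i v x ^ 2) atTop (nhds 0) := by
    have h1 := tendsto_setIntegral_of_antitone (μ := volume) (s := fun n : ℕ => {x : EuclideanSpace ℝ (Fin d) | (n:ℝ) ≤ ‖x - o‖})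
      (f := fun x => ww f v d x * ∑ i, pd i v x ^ 2) (fun n => hms n)
      (fun m n hmn x hx => le_trans (show (m:ℝ) ≤ n by exact_mod_cast hmn) hx) ⟨0, hG.integrableOn⟩
    have h2 : ⋂ n : ℕ, {x : EuclideanSpace ℝ (Fin d) | (n:ℝ) ≤ ‖x - o‖} = ∅ := by
      ext x
      simp only [Set.mem_iInter, Set.mem_setOf_eq, Set.mem_empty_iff_false, iff_false, not_forall, not_le]
      exact exists_nat_gt _
    rw [h2] at h1
    simpa using h1.const_mul (16 * d * C0 * M ^ 2)
  by_contra hne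
  set ρ := max 1 ‖x1 - o‖ with hρ
  have hρ1 : 1 ≤ ρ := le_max_left _ _
  have hpos : 0 < ∫ x, (ww f v (d-1) x * KK f v x) * η ρ x ^ 2 := by
    refine Continuous.integral_pos_of_hasCompactSupport_nonneg_nonzero (x := x1)
      (hwK.mul ((hη ρ hρ1).continuous.pow 2)) (cs_mul_sq (hηc ρ hρ1))
      (fun x => mul_nonneg (hwK0 x) (sq_nonneg _)) ?_
    rw [hηR ρ hρ1 x1 (le_max_right _ _)]
    simpa using ⟨(hwp (d-1) x1).ne', hne⟩
  have hle : ∀ᶠ n : ℕ in atTop, ∫ x, (ww f v (d-1) x * KK f v x) * η ρ x ^ 2 ≤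
      (16 * d * C0 * M ^ 2) * ∫ x in {x | (n:ℝ) ≤ ‖x - o‖}, ww f v d x * ∑ i, pd i v x ^ 2 := by
    filter_upwards [tendsto_natCast_atTop_atTop.eventually_ge_atTop (2 * ρ)] with n hn
    have hn1 : (1:ℝ) ≤ n := by linarith
    refine le_trans (integral_mono (hA ρ hρ1) (hA n hn1) fun x => ?_) (main n hn1)
    refine mul_le_mul_of_nonneg_left ?_ (hwK0 x)
    rcases le_total ‖x - o‖ (2 * ρ) with h | h
    · rw [hηR n hn1 x (h.trans hn)]
      simpa using pow_le_one₀ (n := 2) (hη0 ρ hρ1 x) (hη1 ρ hρ1 x)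
    · rw [hη2R ρ hρ1 x h]; simp; positivity
  have := ge_of_tendsto htail hle
  linarith

lemma const_of_pd {g : EuclideanSpace ℝ (Fin d) → ℝ} (hg : Differentiable ℝ g)
    (h : ∀ i x, pd i g x = 0) (x y) : g x = g y := by
  refine is_const_of_fderiv_eq_zero hg (fun z => ?_) x y
  ext w
  rw [fderiv_eq_sum]; simp [h]

lemma rigid (hd : 3 ≤ d) (hf : ContDiff ℝ 2 f) (hv : ContDiff ℝ 3 v) (hvpos : ∀ x, 0 < v x)
    (hconv : ∀ x, ∀ ξ : Fin d → ℝ, 0 ≤ ∑ i, ∑ j, pd i (pd j f) x * ξ i * ξ j)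
    (hsgn : ∀ x, 0 ≤ ∑ i, pd i f x * pd i v x)
    (heq : ∀ x, v x * PP f v x = (d:ℝ) / 2 * ∑ i, pd i v x ^ 2 + 2 / ((d:ℝ) - 2))
    (hK : ∀ x, KK f v x = 0) :
    (∀ x y, f x = f y) ∧
    ∃ a : ℝ, 0 < a ∧ ∃ b : ℝ, 0 < b ∧ (d : ℝ) * ((d : ℝ) - 2) * a * b = 1 ∧
      ∃ x₀ : EuclideanSpace ℝ (Fin d), ∀ x, v x = a + b * ‖x - x₀‖ ^ 2 := by
  have hd' : (3:ℝ) ≤ d := by exact_mod_cast hd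
  have hH : ∀ x i j, pd i (pd j v) x = if i = j then PP f v x / d else 0 := by
    intro x i j
    have h1 := KK_ge hd hvpos hconv hsgn heq x
    rw [hK] at h1
    have hn : ∀ i, 0 ≤ ∑ j, (pd i (pd j v) x - if i = j then PP f v x / d else 0) ^ 2 :=
      fun i => Finset.sum_nonneg fun j _ => sq_nonneg _
    have h2 : ∑ i, ∑ j, (pd i (pd j v) x - if i = j then PP f v x / d else 0) ^ 2 = 0 := by
      refine le_antisymm ?_ (Finset.sum_nonneg fun i _ => hn i)
      exact nonpos_of_mul_nonpos_right h1 (by linarith)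
    have h3 := (Finset.sum_eq_zero_iff_of_nonneg fun i _ => hn i).1 h2 i (Finset.mem_univ i)
    have h4 := (Finset.sum_eq_zero_iff_of_nonneg fun j _ => sq_nonneg _).1 h3 j (Finset.mem_univ j)
    have h5 := pow_eq_zero_iff (two_ne_zero) |>.1 h4
    linarith
  have hPi : ∀ i x, pd i (PP f v) x = 0 := by
    intro i x
    have h1 := XX_eq hf hv heq i x
    have h2 : XX f v i x = 0 := by
      unfold XX
      simp_rw [hH, ite_mul, zero_mul, Finset.sum_ite_eq]
      simp
      field_simp
      ring
    rw [h2] at h1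
    exact (mul_eq_zero.1 h1.symm).resolve_left (hvpos x).ne'
  have hPc := const_of_pd ((PP_C1 hf hv).differentiable (by norm_num)) hPi
  set lam := PP f v 0 with hlam
  have hPl : ∀ x, PP f v x = lam := fun x => hPc x 0
  have hlam0 : 0 < lam := by
    have h1 : 0 < v 0 * lam := by
      rw [hlam, heq]
      have : 0 ≤ ∑ i, pd i v 0 ^ 2 := Finset.sum_nonneg fun i _ => sq_nonneg _
      have : 0 < (d:ℝ) - 2 := by linarith
      positivity
    exact pos_of_mul_pos_right h1 (hvpos 0).le
  set b := lam / (2 * d) with hb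
  have hb0 : 0 < b := by positivity
  have hlb : lam / d = 2 * b := by rw [hb]; field_simp
  set x₀ : EuclideanSpace ℝ (Fin d) := WithLp.toLp 2 (fun i => - pd i v 0 / (2 * b)) with hx₀
  have hdv : ∀ i, Differentiable ℝ (pd i v) := fun i => (pd1_C2 hv i).differentiable (by norm_num)
  have hgrad : ∀ i x, pd i v x = 2 * b * (x i - x₀ i) := by
    intro i x
    have hlin : Differentiable ℝ (fun y : EuclideanSpace ℝ (Fin d) => y i - x₀ i) := by fun_prop
    have hc := const_of_pd (g := fun y => pd i v y - 2 * b * (y i - x₀ i))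
      ((hdv i).sub (hlin.const_mul _)) (by
        intro j y
        rw [pd_sub j (hdv i y) ((hlin y).const_mul _), pd_const_mul j _ (hlin y), pd_coord, hH, hPl, hlb]
        by_cases h : j = i
        · simp [h]
        · simp [h, Ne.symm h]) x 0
    have h0 : pd i v 0 - 2 * b * ((0 : EuclideanSpace ℝ (Fin d)) i - x₀ i) = 0 := by
      simp [hx₀]; field_simp; ring
    simp only at hc
    rw [h0] at hc
    linarith
  have hvform : ∀ x, v x = v x₀ + b * ‖x - x₀‖ ^ 2 := by
    intro x
    have hq : Differentiable ℝ (fun y : EuclideanSpace ℝ (Fin d) => ‖y - x₀‖ ^ 2) :=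
      (q_contDiff (n := 1) x₀).differentiable (by norm_num)
    have hvd : Differentiable ℝ v := hv.differentiable (by norm_num)
    have hc := const_of_pd (g := fun y => v y - b * ‖y - x₀‖ ^ 2) (hvd.sub (hq.const_mul _)) (by
      intro j y
      rw [pd_sub j (hvd y) ((hq y).const_mul _), pd_const_mul j _ (hq y), pd_q, hgrad]; ring) x x₀
    simp at hc
    linarith
  refine ⟨?_, v x₀, hvpos x₀, b, hb0, ?_, x₀, hvform⟩
  · have hfx : ∀ y, ∑ i, pd i f y * (y i - x₀ i) = 0 := by
      intro y
      have h1 : PP f v y = ∑ i, pd i (pd i v) y - ∑ i, pd i f y * pd i v y := rfl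
      simp_rw [hH, hgrad] at h1
      simp at h1
      have h2 : (d:ℝ) * (PP f v y / d) = PP f v y := by field_simp
      rw [h2] at h1
      have h3 : ∑ i, pd i f y * (2 * b * (y i - x₀ i)) = 2 * b * ∑ i, pd i f y * (y i - x₀ i) := by
        rw [Finset.mul_sum]; exact Finset.sum_congr rfl fun i _ => by ring
      rw [h3] at h1
      have h4 : 2 * b * ∑ i, pd i f y * (y i - x₀ i) = 0 := by linarith
      exact (mul_eq_zero.1 h4).resolve_left (by positivity)
    have hfd : Differentiable ℝ f := hf.differentiable (by norm_num)
    have hfx0 : ∀ x, f x = f x₀ := by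
      intro x
      set ξ := x - x₀ with hξ
      have hcont : Continuous fun t : ℝ => fderiv ℝ f (x₀ + t • ξ) ξ := by
        have h1 : Continuous (fderiv ℝ f) := hf.continuous_fderiv (by norm_num)
        have h2 : Continuous fun t : ℝ => x₀ + t • ξ := by fun_prop
        exact (h1.comp h2).clm_apply continuous_const
      have hz : (fun t : ℝ => fderiv ℝ f (x₀ + t • ξ) ξ) = fun _ => 0 := by
        refine Continuous.ext_on (dense_compl_singleton (0:ℝ)) hcont continuous_const ?_
        intro t ht
        have h1 := hfx (x₀ + t • ξ)
        simp only
        rw [fderiv_eq_sum]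
        have h2 : t * ∑ i, ξ i * pd i f (x₀ + t • ξ) = 0 := by
          rw [← h1, Finset.mul_sum]
          refine Finset.sum_congr rfl fun i _ => ?_
          simp; ring
        exact (mul_eq_zero.1 h2).resolve_left ht
      have hcst := is_const_of_deriv_eq_zero (f := fun t : ℝ => f (x₀ + t • ξ))
        (fun t => (line_hasDerivAt x₀ ξ t (hfd _)).differentiableAt)
        (fun t => by rw [(line_hasDerivAt x₀ ξ t (hfd _)).deriv]; exact congrFun hz t) 1 0
      simpa [hξ] using hcst
    intro x y; rw [hfx0 x, hfx0 y]
  · have h1 := heq x₀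
    simp_rw [hPl, hgrad] at h1
    simp at h1
    have hl : lam = 2 * d * b := by rw [hb]; field_simp
    have hne : (d:ℝ) - 2 ≠ 0 := by linarith
    rw [hl] at h1
    field_simp at h1
    linarith

end rigidity


/-- Euclidean-base instance of Theorem 2.1 iii): rigidity for the critical Lane-Emden
equation with convex weight, ∇f·∇u ≤ 0, Euclidean weighted volume growth, the weighted
Laplacian comparison (∇f(x)·(x−o) ≥ 0 on flat ℝ^d) and finite weighted energy. -/
theorem critical_laneEmden_rigidity_finiteEnergy
    (d : ℕ) (hd : 3 ≤ d)
    (f u : EuclideanSpace ℝ (Fin d) → ℝ)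
    (hf : ContDiff ℝ 2 f) (hconv : ConvexOn ℝ Set.univ f)
    (hu : ContDiff ℝ 3 u) (hupos : ∀ x, 0 < u x)
    (heq : ∀ x, lapl u x - ⟪gradient f x, gradient u x⟫
        + u x ^ (((d : ℝ) + 2) / ((d : ℝ) - 2)) = 0)
    (hdot : ∀ x, ⟪gradient f x, gradient u x⟫ ≤ 0)
    (hvol : ∃ o : EuclideanSpace ℝ (Fin d),
        (∃ C : ℝ, 0 < C ∧ ∀ R : ℝ, 1 ≤ R →
          (∫ x in Metric.ball o R, Real.exp (-f x)) ≤ C * R ^ d) ∧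
        (∀ x, 0 ≤ ⟪gradient f x, x - o⟫))
    (henergy : (∫⁻ x, ENNReal.ofReal
        (Real.exp (-f x) * u x ^ (2 * (d : ℝ) / ((d : ℝ) - 2)))) < ⊤) :
    (∀ x y, f x = f y) ∧
    ∃ a : ℝ, 0 < a ∧ ∃ b : ℝ, 0 < b ∧ (d : ℝ) * ((d : ℝ) - 2) * a * b = 1 ∧
      ∃ x₀ : EuclideanSpace ℝ (Fin d),
        ∀ x, u x = (a + b * ‖x - x₀‖ ^ 2) ^ (-(((d : ℝ) - 2) / 2)) := by
  have hd' : (3:ℝ) ≤ d := by exact_mod_cast hd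
  have hd2 : (d:ℝ) - 2 ≠ 0 := by linarith
  obtain ⟨o, ⟨C, hC, hvolC⟩, hcomp⟩ := hvol
  have hu2 : ContDiff ℝ 2 u := hu.of_le (by norm_num)
  have hα : -(((d:ℝ) - 2) / 2) < 0 := by linarith
  obtain ⟨v, hvdef⟩ : ∃ v : EuclideanSpace ℝ (Fin d) → ℝ,
      v = fun x => u x ^ (-(2 / ((d:ℝ) - 2))) := ⟨_, rfl⟩
  have hvpos : ∀ x, 0 < v x := fun x => by rw [hvdef]; exact Real.rpow_pos_of_pos (hupos x) _
  have hv : ContDiff ℝ 3 v := by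
    rw [hvdef]; exact hu.rpow_const_of_ne fun x => (hupos x).ne'
  have huv : u = fun x => v x ^ (-(((d:ℝ) - 2) / 2)) := by
    funext x
    rw [hvdef]
    simp only
    rw [← Real.rpow_mul (hupos x).le]
    rw [show -(2 / ((d:ℝ) - 2)) * -(((d:ℝ) - 2) / 2) = 1 by field_simp, Real.rpow_one]
  have heq' : ∀ x, ∑ i, pd i (pd i u) x - ∑ i, pd i f x * pd i u x
      + u x ^ (((d : ℝ) + 2) / ((d : ℝ) - 2)) = 0 := by
    intro x
    have := heq x
    rw [lapl_eq hu2, inner_grad] at this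
    simpa only [grad_apply] using this
  have hPP : ∀ x, v x * PP f v x = (d:ℝ) / 2 * ∑ i, pd i v x ^ 2 + 2 / ((d:ℝ) - 2) := by
    intro x
    exact v_eq hd f v u (hv.of_le (by norm_num)) hvpos huv x (heq' x)
  have hsgn : ∀ x, 0 ≤ ∑ i, pd i f x * pd i v x := by
    intro x
    have h1 := hdot x
    rw [inner_grad] at h1
    simp only [grad_apply] at h1
    have h2 : ∀ i, pd i u x = -(((d:ℝ) - 2) / 2) * v x ^ (-(((d:ℝ) - 2) / 2) - 1) * pd i v x := by
      intro i
      rw [huv]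
      exact pd_rpow i _ (hv.differentiable (by norm_num) x) (hvpos x)
    have h3 : ∑ i, pd i f x * pd i u x
        = -((((d:ℝ) - 2) / 2) * v x ^ (-(((d:ℝ) - 2) / 2) - 1)) * ∑ i, pd i f x * pd i v x := by
      rw [Finset.mul_sum]
      refine Finset.sum_congr rfl fun i _ => ?_
      rw [h2]; ring
    rw [h3] at h1
    have h4 : 0 < (((d:ℝ) - 2) / 2) * v x ^ (-(((d:ℝ) - 2) / 2) - 1) :=
      mul_pos (by linarith) (Real.rpow_pos_of_pos (hvpos x) _)
    by_contra hcon
    push Not at hcon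
    nlinarith [mul_pos_of_neg_of_neg (neg_lt_zero.2 h4) hcon]
  obtain ⟨c, hc, hcu⟩ := compare hd f u hu2 hupos (fun x => by
      have := heq' x
      have h2 := Real.rpow_pos_of_pos (hupos x) (((d : ℝ) + 2) / ((d : ℝ) - 2))
      linarith) o (fun x => by
      have := hcomp x
      rw [inner_grad] at this
      simpa using this)
  have hvb : ∀ x, 1 ≤ ‖x - o‖ → v x ≤ c ^ (-(((d:ℝ) - 2) / 2))⁻¹ * ‖x - o‖ ^ 2 := by
    intro x hx
    have h1 := hcu x hx
    have hc' : 0 < c ^ (-(((d:ℝ) - 2) / 2))⁻¹ := Real.rpow_pos_of_pos hc _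
    have hn : 0 < ‖x - o‖ ^ 2 := by positivity
    rw [← Real.rpow_le_rpow_iff_of_neg (mul_pos hc' hn) (hvpos x) hα,
      Real.mul_rpow hc'.le hn.le, Real.rpow_inv_rpow hc.le hα.ne]
    have h2 : u x = v x ^ (-(((d:ℝ) - 2) / 2)) := congrFun huv x
    rw [← h2]; exact h1
  have hE : Integrable (ww f v d) := by
    have hww : ww f v d = fun x => Real.exp (-f x) * u x ^ (2 * (d : ℝ) / ((d : ℝ) - 2)) := by
      funext x
      unfold ww
      congr 1
      rw [hvdef]
      simp only
      rw [← Real.rpow_natCast, ← Real.rpow_mul (hupos x).le, ← Real.rpow_neg (hupos x).le]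
      congr 1
      ring
    rw [hww]
    refine ⟨Continuous.aestronglyMeasurable ?_, ?_⟩
    · exact (Real.continuous_exp.comp hf.continuous.neg).mul
        (hu.continuous.rpow_const fun x => Or.inl (hupos x).ne')
    · rw [hasFiniteIntegral_iff_ofReal]
      · exact henergy
      · exact Filter.Eventually.of_forall fun x =>
          mul_nonneg (Real.exp_pos _).le (Real.rpow_nonneg (hupos x).le _)
  have hH := hess_convex hf hconv
  have hG := energy hd hf hv hvpos hPP o C hvolC hE
  have hK := KK_zero hd hf hv hvpos hH hsgn hPP o _ (Real.rpow_nonneg hc.le _) hvb hG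
  obtain ⟨h1, a, ha, b, hb, hab, x₀, hx⟩ := rigid hd hf hv hvpos hH hsgn hPP hK
  refine ⟨h1, a, ha, b, hb, hab, x₀, fun x => ?_⟩
  rw [← hx x]
  exact congrFun huv x
end
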